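/- There exists a constant C > 0, depending only on Ω, such that for every λ > 0 and every Neumann eigenfunction φ of Ω with eigenvalue λ², the set of boundary nodal points {s ∈ [0, ℓ) : φ(q(s)) = 0} is finite and has cardinality at most C·λ. -/

import Mathlib

open MeasureTheory Real
open scoped RealInnerProductSpace

noncomputable section

abbrev E2 : Type := EuclideanSpace ℝ (Fin 2)

/-- The Euclidean Laplacian `∂²/∂x₁² + ∂²/∂x₂²` on `ℝ²`. -/
def lap (φ : E2 → ℝ) (x : E2) : ℝ :=
  ∑ i : Fin 2,
    fderiv ℝ (fun y => fderiv ℝ φ y (EuclideanSpace.single i 1)) x (EuclideanSpace.single i 1)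

/-- A bounded open connected planar domain. -/
structure IsPlaneDomain (Ω : Set E2) : Prop where
  isOpen : IsOpen Ω
  isBounded : Bornology.IsBounded Ω
  isConnected : IsConnected Ω

/-- An arc-length parametrization `q` of the boundary of `Ω` (periodic with period `len`,
injective on `[0, len)`, unit speed, image equal to the frontier of `Ω`), together with the
unit normal `ν` along the boundary, pointing into `Ω`. -/
structure BoundaryParam (Ω : Set E2) where
  len : ℝ
  len_pos : 0 < len
  q : ℝ → E2
  qd : ℝ → E2
  hasDerivAt : ∀ s, HasDerivAt q (qd s) s
  periodic : Function.Periodic q len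
  injOn : Set.InjOn q (Set.Ico 0 len)
  unitSpeed : ∀ s, ‖qd s‖ = 1
  range_eq : Set.range q = frontier Ω
  ν : ℝ → E2
  ν_unit : ∀ s, ‖ν s‖ = 1
  ν_orth : ∀ s, ⟪ν s, qd s⟫ = 0
  ν_inward : ∀ s, ∃ δ > 0, ∀ t ∈ Set.Ioo (0 : ℝ) δ, q s + t • ν s ∈ Ω

/-- The boundary parametrization is real-analytic. -/
def BoundaryParam.IsAnalytic {Ω : Set E2} (B : BoundaryParam Ω) : Prop :=
  AnalyticOnNhd ℝ B.q Set.univ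

/-- `φ` is a Neumann eigenfunction of `Ω` with eigenvalue `lam²`: it is real-analytic on an
open neighborhood of the closure of `Ω`, not identically zero on `Ω`, satisfies
`Δφ = -lam² φ` on `Ω` and has vanishing normal derivative along the boundary. -/
structure IsNeumannEigenfunction {Ω : Set E2} (B : BoundaryParam Ω) (lam : ℝ)
    (φ : E2 → ℝ) : Prop where
  analytic : ∃ U : Set E2, IsOpen U ∧ closure Ω ⊆ U ∧ AnalyticOnNhd ℝ φ U
  nontrivial : ∃ x ∈ Ω, φ x ≠ 0
  eigen : ∀ x ∈ Ω, lap φ x = -lam ^ 2 * φ x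
  neumann : ∀ s : ℝ, ⟪gradient φ (B.q s), B.ν s⟫ = 0

namespace NeumannNodal

open Set Filter Topology

/-! ### Comparison principles for second order ordinary differential inequalities -/

section Comparison

variable {u u' u'' : ℝ → ℝ} {a L μ : ℝ}

lemma nonneg_of_second_deriv_ge (hμ : 0 ≤ μ)
    (hu : ∀ y ∈ Icc a L, HasDerivAt u (u' y) y)
    (hu' : ∀ y ∈ Icc a L, HasDerivAt u' (u'' y) y)
    (h : ∀ y ∈ Icc a L, μ ^ 2 * u y ≤ u'' y) (h0 : 0 ≤ u a) (h1 : 0 ≤ u' a) :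
    ∀ y ∈ Icc a L, 0 ≤ u y := by
  have hexp : ∀ k y : ℝ, HasDerivAt (fun y => Real.exp (k * y)) (Real.exp (k * y) * k) y := by
    intro k y
    have := ((hasDerivAt_id y).const_mul k).exp
    simpa using this
  have hp : ∀ y ∈ Icc a L, 0 ≤ u' y + μ * u y := by
    have hd : ∀ y ∈ Icc a L, HasDerivAt (fun y => (u' y + μ * u y) * Real.exp (-μ * y))
        ((u'' y + μ * u' y) * Real.exp (-μ * y)
          + (u' y + μ * u y) * (Real.exp (-μ * y) * -μ)) y :=
      fun y hy => ((hu' y hy).add ((hu y hy).const_mul μ)).mul (hexp (-μ) y)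
    have hmono : MonotoneOn (fun y => (u' y + μ * u y) * Real.exp (-μ * y)) (Icc a L) := by
      apply monotoneOn_of_hasDerivWithinAt_nonneg (convex_Icc a L)
        (fun y hy => (hd y hy).continuousAt.continuousWithinAt)
        (fun y hy => (hd y (interior_subset hy)).hasDerivWithinAt)
      intro y hy
      have := h y (interior_subset hy)
      have e := Real.exp_pos (-μ * y)
      have : 0 ≤ (u'' y - μ ^ 2 * u y) * Real.exp (-μ * y) := by
        apply mul_nonneg _ e.le; linarith
      nlinarith
    intro y hy
    have ha : a ∈ Icc a L := ⟨le_rfl, hy.1.trans hy.2⟩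
    have h2 := hmono ha hy hy.1
    have h3 : 0 ≤ (u' a + μ * u a) * Real.exp (-μ * a) := by positivity
    have h4 : 0 ≤ (u' y + μ * u y) * Real.exp (-μ * y) := h3.trans h2
    exact nonneg_of_mul_nonneg_left h4 (Real.exp_pos _)
  have hd : ∀ y ∈ Icc a L, HasDerivAt (fun y => u y * Real.exp (μ * y))
      (u' y * Real.exp (μ * y) + u y * (Real.exp (μ * y) * μ)) y :=
    fun y hy => (hu y hy).mul (hexp μ y)
  have hmono : MonotoneOn (fun y => u y * Real.exp (μ * y)) (Icc a L) := by
    apply monotoneOn_of_hasDerivWithinAt_nonneg (convex_Icc a L)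
      (fun y hy => (hd y hy).continuousAt.continuousWithinAt)
      (fun y hy => (hd y (interior_subset hy)).hasDerivWithinAt)
    intro y hy
    have := mul_nonneg (hp y (interior_subset hy)) (Real.exp_pos (μ * y)).le
    nlinarith
  intro y hy
  have ha : a ∈ Icc a L := ⟨le_rfl, hy.1.trans hy.2⟩
  have h2 := hmono ha hy hy.1
  have h3 : 0 ≤ u a * Real.exp (μ * a) := by positivity
  exact nonneg_of_mul_nonneg_left (h3.trans h2) (Real.exp_pos _)

lemma le_of_second_deriv_ge (hμ : 0 ≤ μ)
    (hu : ∀ y ∈ Icc a L, HasDerivAt u (u' y) y)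
    (hu' : ∀ y ∈ Icc a L, HasDerivAt u' (u'' y) y)
    (h : ∀ y ∈ Icc a L, μ ^ 2 * u y ≤ u'' y) (h0 : 0 ≤ u a) (h1 : 0 ≤ u' a) :
    ∀ y ∈ Icc a L, u a ≤ u y := by
  have hn := nonneg_of_second_deriv_ge hμ hu hu' h h0 h1
  have hm' : MonotoneOn u' (Icc a L) := by
    apply monotoneOn_of_hasDerivWithinAt_nonneg (convex_Icc a L)
      (fun y hy => (hu' y hy).continuousAt.continuousWithinAt)
      (fun y hy => (hu' y (interior_subset hy)).hasDerivWithinAt)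
    intro y hy
    exact (mul_nonneg (sq_nonneg μ) (hn y (interior_subset hy))).trans (h y (interior_subset hy))
  have hm : MonotoneOn u (Icc a L) := by
    apply monotoneOn_of_hasDerivWithinAt_nonneg (convex_Icc a L)
      (fun y hy => (hu y hy).continuousAt.continuousWithinAt)
      (fun y hy => (hu y (interior_subset hy)).hasDerivWithinAt)
    intro y hy
    have hy' := interior_subset hy
    exact h1.trans (hm' ⟨le_rfl, hy'.1.trans hy'.2⟩ hy' hy'.1)
  intro y hy
  exact hm ⟨le_rfl, hy.1.trans hy.2⟩ hy hy.1

lemma nonpos_of_second_deriv_ge (hμ : 0 ≤ μ)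
    (hu : ∀ y ∈ Icc a L, HasDerivAt u (u' y) y)
    (hu' : ∀ y ∈ Icc a L, HasDerivAt u' (u'' y) y)
    (h : ∀ y ∈ Icc a L, μ ^ 2 * u y ≤ u'' y) (h0 : u a ≤ 0 ∨ 0 ≤ u' a) (h1 : u L ≤ 0) :
    ∀ y ∈ Icc a L, u y ≤ 0 := by
  by_contra! hcon
  obtain ⟨y, hy, hpos⟩ := hcon
  have hcont : ContinuousOn u (Icc a L) := fun y hy => (hu y hy).continuousAt.continuousWithinAt
  obtain ⟨y0, hy0, hmax⟩ := isCompact_Icc.exists_isMaxOn ⟨y, hy⟩ hcont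
  have hp0 : 0 < u y0 := hpos.trans_le (hmax hy)
  have hyL : y0 < L := lt_of_le_of_ne hy0.2 (by rintro rfl; linarith)
  have hd0 : 0 ≤ u' y0 := by
    rcases eq_or_lt_of_le hy0.1 with rfl | hlt
    · rcases h0 with h0 | h0
      · linarith
      · exact h0
    · have : IsLocalMax u y0 := hmax.isLocalMax (Icc_mem_nhds hlt hyL)
      exact (this.hasDerivAt_eq_zero (hu y0 hy0)).ge
  have hsub : Icc y0 L ⊆ Icc a L := Icc_subset_Icc_left hy0.1
  have := le_of_second_deriv_ge hμ (fun y hy => hu y (hsub hy)) (fun y hy => hu' y (hsub hy))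
    (fun y hy => h y (hsub hy)) hp0.le hd0 L ⟨hyL.le, le_rfl⟩
  linarith

end Comparison

section ComplexComparison

variable {c c' g : ℝ → ℂ} {b b' b'' : ℝ → ℝ} {a L μ : ℝ}

lemma exists_unit_re_eq_norm (z : ℂ) : ∃ w : ℂ, ‖w‖ = 1 ∧ (w * z).re = ‖z‖ := by
  by_cases hz : z = 0
  · exact ⟨1, by simp, by simp [hz]⟩
  · have hn : (‖z‖ : ℝ) ≠ 0 := by simpa using hz
    refine ⟨(starRingEnd ℂ) z / (‖z‖ : ℂ), ?_, ?_⟩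
    · simp [hn]
    · have : (starRingEnd ℂ) z / (‖z‖ : ℂ) * z = ((‖z‖ : ℝ) : ℂ) := by
        have h2 : (‖z‖ : ℂ) ≠ 0 := by exact_mod_cast hn
        rw [div_mul_eq_mul_div, mul_comm, Complex.mul_conj, div_eq_iff h2,
          Complex.normSq_eq_norm_sq]
        push_cast; ring
      rw [this, Complex.ofReal_re]

lemma re_mul_le_norm_of_unit {w : ℂ} (hw : ‖w‖ = 1) (z : ℂ) : (w * z).re ≤ ‖z‖ :=
  (Complex.re_le_norm _).trans (by simp [hw])

lemma neg_norm_le_re_mul_of_unit {w : ℂ} (hw : ‖w‖ = 1) (z : ℂ) : -‖z‖ ≤ (w * z).re := by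
  have := Complex.abs_re_le_norm (w * z)
  rw [norm_mul, hw, one_mul] at this
  exact (abs_le.mp this).1

lemma hasDerivAt_re_mul {c : ℝ → ℂ} {d : ℂ} {y : ℝ} (w : ℂ) (h : HasDerivAt c d y) :
    HasDerivAt (fun y => (w * c y).re) (w * d).re y :=
  Complex.reCLM.hasFDerivAt.comp_hasDerivAt y (h.const_mul w)

/-- Boundary value comparison for `c'' = μ² c + g`: Neumann or Dirichlet at the left end,
Dirichlet at the right end. -/
lemma norm_le_of_boundary (hμ : 0 ≤ μ)
    (hc : ∀ y ∈ Icc a L, HasDerivAt c (c' y) y)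
    (hc' : ∀ y ∈ Icc a L, HasDerivAt c' (μ ^ 2 * c y + g y) y)
    (hb : ∀ y ∈ Icc a L, HasDerivAt b (b' y) y)
    (hb' : ∀ y ∈ Icc a L, HasDerivAt b' (b'' y) y)
    (hg : ∀ y ∈ Icc a L, ‖g y‖ ≤ μ ^ 2 * b y - b'' y)
    (h0 : ‖c a‖ ≤ b a ∨ (c' a = 0 ∧ b' a ≤ 0)) (hL : ‖c L‖ ≤ b L) :
    ∀ y ∈ Icc a L, ‖c y‖ ≤ b y := by
  intro y hy
  obtain ⟨w, hw, hwy⟩ := exists_unit_re_eq_norm (c y)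
  have key := nonpos_of_second_deriv_ge (u := fun y => (w * c y).re - b y)
    (u' := fun y => (w * c' y).re - b' y)
    (u'' := fun y => (w * (μ ^ 2 * c y + g y)).re - b'' y) hμ
    (fun y hy => (hasDerivAt_re_mul w (hc y hy)).sub (hb y hy))
    (fun y hy => (hasDerivAt_re_mul w (hc' y hy)).sub (hb' y hy)) ?_ ?_ ?_ y hy
  · linarith
  · intro y hy
    have e : (w * (μ ^ 2 * c y + g y)).re = μ ^ 2 * (w * c y).re + (w * g y).re := by
      have : w * (μ ^ 2 * c y + g y) = ((μ ^ 2 : ℝ) : ℂ) * (w * c y) + w * g y := by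
        push_cast; ring
      rw [this, Complex.add_re, Complex.re_ofReal_mul]
    rw [e]
    have := neg_norm_le_re_mul_of_unit hw (g y)
    have := hg y hy
    nlinarith
  · rcases h0 with h0 | ⟨h0, h0'⟩
    · left
      have := re_mul_le_norm_of_unit hw (c a)
      linarith
    · right
      simp only [h0, mul_zero, Complex.zero_re]; linarith
  · have := re_mul_le_norm_of_unit hw (c L)
    linarith

/-- Initial value comparison for `c'' = μ² c + g`. -/
lemma norm_le_of_initial (hμ : 0 ≤ μ)
    (hc : ∀ y ∈ Icc a L, HasDerivAt c (c' y) y)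
    (hc' : ∀ y ∈ Icc a L, HasDerivAt c' (μ ^ 2 * c y + g y) y)
    (hb : ∀ y ∈ Icc a L, HasDerivAt b (b' y) y)
    (hb' : ∀ y ∈ Icc a L, HasDerivAt b' (b'' y) y)
    (hg : ∀ y ∈ Icc a L, ‖g y‖ ≤ b'' y - μ ^ 2 * b y)
    (h0 : ‖c a‖ ≤ b a) (h1 : ‖c' a‖ ≤ b' a) :
    ∀ y ∈ Icc a L, ‖c y‖ ≤ b y := by
  intro y hy
  obtain ⟨w, hw, hwy⟩ := exists_unit_re_eq_norm (c y)
  have key := nonneg_of_second_deriv_ge (u := fun y => b y - (w * c y).re)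
    (u' := fun y => b' y - (w * c' y).re)
    (u'' := fun y => b'' y - (w * (μ ^ 2 * c y + g y)).re) hμ
    (fun y hy => (hb y hy).sub (hasDerivAt_re_mul w (hc y hy)))
    (fun y hy => (hb' y hy).sub (hasDerivAt_re_mul w (hc' y hy))) ?_ ?_ ?_ y hy
  · linarith
  · intro y hy
    have e : (w * (μ ^ 2 * c y + g y)).re = μ ^ 2 * (w * c y).re + (w * g y).re := by
      have : w * (μ ^ 2 * c y + g y) = ((μ ^ 2 : ℝ) : ℂ) * (w * c y) + w * g y := by
        push_cast; ring
      rw [this, Complex.add_re, Complex.re_ofReal_mul]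
    rw [e]
    have := re_mul_le_norm_of_unit hw (g y)
    have := hg y hy
    nlinarith
  · have := re_mul_le_norm_of_unit hw (c a)
    linarith
  · have := re_mul_le_norm_of_unit hw (c' a)
    linarith

lemma norm_deriv_le_of_bounded {δ B : ℝ}
    (hc : ∀ y ∈ Icc a (a + 1), HasDerivAt c (c' y) y)
    (hc' : ∀ y ∈ Icc a (a + 1), HasDerivAt c' (g y) y)
    (hδ : ∀ y ∈ Icc a (a + 1), ‖c y‖ ≤ δ) (hB : ∀ y ∈ Icc a (a + 1), ‖g y‖ ≤ B) :
    ‖c' a‖ ≤ 2 * δ + B := by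
  have ha : a ∈ Icc a (a + 1) := ⟨le_rfl, by linarith⟩
  have ha1 : a + 1 ∈ Icc a (a + 1) := ⟨by linarith, le_rfl⟩
  have hB0 : 0 ≤ B := (norm_nonneg _).trans (hB a ha)
  have h1 : ∀ y ∈ Icc a (a + 1), ‖c' y - c' a‖ ≤ B := by
    intro y hy
    have := (convex_Icc a (a + 1)).norm_image_sub_le_of_norm_hasDerivWithin_le
      (fun y hy => (hc' y hy).hasDerivWithinAt) hB ha hy
    refine this.trans ?_
    rw [Real.norm_eq_abs, abs_of_nonneg (by linarith [hy.1])]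
    nlinarith [hy.2]
  have h2 := (convex_Icc a (a + 1)).norm_image_sub_le_of_norm_hasDerivWithin_le
      (f := fun y => c y - y • c' a) (f' := fun y => c' y - (1 : ℝ) • c' a)
      (fun y hy => ((hc y hy).sub ((hasDerivAt_id y).smul_const (c' a))).hasDerivWithinAt)
      (by intro y hy; simpa using h1 y hy) ha ha1
  have h3 : c' a = (c (a + 1) - c a) - ((c (a + 1) - (a + 1) • c' a) - (c a - a • c' a)) := by
    rw [add_smul, one_smul]; ring
  rw [h3]
  refine (norm_sub_le _ _).trans ?_
  have h4 := (norm_sub_le (c (a + 1)) (c a)).trans (add_le_add (hδ _ ha1) (hδ _ ha))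
  have h5 : B * ‖a + 1 - a‖ = B := by simp
  linarith

/-- An a priori estimate that reproduces itself with a gain improves to its fixed point. -/
lemma improve_bound {P : ℝ → Prop} {A₀ B : ℝ} (hB : 0 < B) (h0 : P A₀)
    (hstep : ∀ A, B ≤ A → P A → P (max B (A / 2))) (hA₀ : B ≤ A₀) : P B := by
  have : ∀ k : ℕ, P (max B (A₀ / 2 ^ k)) := by
    intro k
    induction k with
    | zero => simpa [max_eq_right hA₀] using h0
    | succ k ih =>
      have h := hstep _ (le_max_left _ _) ih
      have e : max B (max B (A₀ / 2 ^ k) / 2) = max B (A₀ / 2 ^ (k + 1)) := by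
        rw [pow_succ, ← div_div, ← max_div_div_right (by norm_num : (0 : ℝ) ≤ 2), ← max_assoc,
          max_eq_left (by linarith : B / 2 ≤ B)]
      rwa [e] at h
  obtain ⟨k, hk⟩ := pow_unbounded_of_one_lt (A₀ / B) (by norm_num : (1 : ℝ) < 2)
  have h1 : A₀ / 2 ^ k ≤ B := by
    rw [div_lt_iff₀ hB] at hk
    rw [div_le_iff₀ (by positivity)]; linarith
  simpa [max_eq_left h1] using this k

/-- Exponential growth estimate for a (possibly infinite) coupled system
`cₙ'' = νₙ² cₙ + gₙ` in which `g` is controlled by `c` in a weighted supremum norm. -/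
lemma norm_le_of_coupled {ι : Type*} {c c' g : ι → ℝ → ℂ} {ν w : ι → ℝ} {Λ D A₀ L : ℝ}
    (hν : ∀ n, 0 ≤ ν n) (hw : ∀ n, 0 < w n) (hΛ : 0 ≤ Λ) (hD : 0 < D)
    (hc : ∀ n, ∀ y ∈ Icc 0 L, HasDerivAt (c n) (c' n y) y)
    (hc' : ∀ n, ∀ y ∈ Icc 0 L, HasDerivAt (c' n) ((ν n : ℂ) ^ 2 * c n y + g n y) y)
    (hg : ∀ A, 0 ≤ A → ∀ y ∈ Icc 0 L,
      (∀ n, ‖c n y‖ ≤ A * (w n * Real.exp ((Λ + ν n) * y))) →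
      ∀ n, ‖g n y‖ ≤ Λ ^ 2 / 2 * (A * (w n * Real.exp ((Λ + ν n) * y))))
    (hbdd : ∀ n, ∀ y ∈ Icc 0 L, ‖c n y‖ ≤ A₀ * (w n * Real.exp ((Λ + ν n) * y)))
    (h0 : ∀ n, ‖c n 0‖ ≤ D * w n) (h1 : ∀ n, ‖c' n 0‖ ≤ D * (Λ + ν n) * w n) :
    ∀ n, ∀ y ∈ Icc 0 L, ‖c n y‖ ≤ D * (w n * Real.exp ((Λ + ν n) * y)) := by
  refine improve_bound (P := fun A => ∀ n, ∀ y ∈ Icc 0 L,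
    ‖c n y‖ ≤ A * (w n * Real.exp ((Λ + ν n) * y))) (A₀ := max D A₀) hD ?_ ?_ (le_max_left _ _)
  · intro n y hy
    refine (hbdd n y hy).trans ?_
    gcongr
    · have := hw n; positivity
    · exact le_max_right _ _
  · intro A hA hP n
    set M := max D (A / 2) with hM
    have hMD : D ≤ M := le_max_left _ _
    have hMA : A / 2 ≤ M := le_max_right _ _
    have hwn := hw n
    have hνn := hν n
    set k := Λ + ν n with hk
    have hk0 : 0 ≤ k := by positivity
    have hexp : ∀ y : ℝ, HasDerivAt (fun y => Real.exp (k * y)) (Real.exp (k * y) * k) y := by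
      intro y
      have := ((hasDerivAt_id y).const_mul k).exp
      simpa using this
    refine norm_le_of_initial (μ := ν n) (c := c n) (c' := c' n) (g := g n)
      (b := fun y => M * (w n * Real.exp (k * y)))
      (b' := fun y => M * (w n * (Real.exp (k * y) * k)))
      (b'' := fun y => M * (w n * (Real.exp (k * y) * k * k))) hνn (hc n) (hc' n) ?_ ?_ ?_ ?_ ?_
    · intro y _
      exact ((hexp y).const_mul _).const_mul _
    · intro y _
      exact (((hexp y).mul_const k).const_mul _).const_mul _
    · intro y hy
      have h2 := hg A (by linarith) y hy (fun m => hP m y hy) n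
      refine h2.trans ?_
      have hX : 0 ≤ w n * Real.exp (k * y) := by positivity
      have h3 : Λ ^ 2 ≤ k ^ 2 - ν n ^ 2 := by rw [hk]; nlinarith
      have h4 : 0 ≤ M * (w n * Real.exp (k * y)) := by
        apply mul_nonneg _ hX; linarith
      calc Λ ^ 2 / 2 * (A * (w n * Real.exp (k * y)))
          = Λ ^ 2 * (A / 2) * (w n * Real.exp (k * y)) := by ring
        _ ≤ Λ ^ 2 * M * (w n * Real.exp (k * y)) := by gcongr
        _ = Λ ^ 2 * (M * (w n * Real.exp (k * y))) := by ring
        _ ≤ (k ^ 2 - ν n ^ 2) * (M * (w n * Real.exp (k * y))) := by gcongr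
        _ = _ := by ring
    · have := h0 n
      simp only [mul_zero, Real.exp_zero, mul_one]
      exact this.trans (by gcongr)
    · have := h1 n
      simp only [mul_zero, Real.exp_zero, one_mul]
      refine this.trans ?_
      rw [show M * (w n * k) = M * k * w n by ring]
      gcongr

end ComplexComparison

/-- The `n`-th Fourier coefficient of a `2π`-periodic function. -/
def fc (g : ℝ → ℂ) (n : ℤ) : ℂ :=
  (1 / (2 * π) : ℝ) • ∫ x in (0 : ℝ)..(2 * π), Complex.exp (-(Complex.I * n * x)) * g x

lemma norm_cexp_I_mul (n : ℤ) (x : ℝ) : ‖Complex.exp (-(Complex.I * n * x))‖ = 1 := by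
  rw [Complex.norm_exp]; simp

lemma norm_cexp_I_mul_pos (n : ℤ) (x : ℝ) : ‖Complex.exp (Complex.I * n * x)‖ = 1 := by
  rw [Complex.norm_exp]; simp

lemma norm_fc_le {g : ℝ → ℂ} {M : ℝ} (hg : ∀ x, ‖g x‖ ≤ M) (n : ℤ) : ‖fc g n‖ ≤ M := by
  have h := intervalIntegral.norm_integral_le_of_norm_le_const (a := (0 : ℝ)) (b := 2 * π)
    (f := fun x : ℝ => Complex.exp (-(Complex.I * n * x)) * g x) (C := M)
    (fun x _ => by rw [norm_mul, norm_cexp_I_mul, one_mul]; exact hg x)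
  have hpi : 0 < 2 * π := by positivity
  rw [fc, norm_smul, Real.norm_of_nonneg (by positivity)]
  rw [sub_zero, abs_of_pos hpi] at h
  calc _ ≤ 1 / (2 * π) * (M * (2 * π)) := by gcongr
    _ = M := by field_simp

lemma cexp_two_pi (n : ℤ) : Complex.exp (-(Complex.I * n * ((2 * π : ℝ) : ℂ))) = 1 := by
  rw [show -(Complex.I * n * ((2 * π : ℝ) : ℂ)) = ((-n : ℤ) : ℂ) * (2 * π * Complex.I) by
    push_cast; ring]
  exact Complex.exp_int_mul_two_pi_mul_I _

lemma fc_deriv {g g' : ℝ → ℂ} (hg : ∀ x, HasDerivAt g (g' x) x) (hg' : Continuous g')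
    (hp : g 0 = g (2 * π)) (n : ℤ) : fc g' n = Complex.I * n * fc g n := by
  have hgc : Continuous g := continuous_iff_continuousAt.2 fun x => (hg x).continuousAt
  have he : ∀ x : ℝ, HasDerivAt (fun x : ℝ => Complex.exp (-(Complex.I * n * x)))
      (Complex.exp (-(Complex.I * n * x)) * (-(Complex.I * n))) x := by
    intro x
    have h1 : HasDerivAt (fun x : ℝ => -(Complex.I * n * (x : ℂ))) (-(Complex.I * n * 1)) x :=
      ((Complex.ofRealCLM.hasDerivAt (x := x)).const_mul (Complex.I * n)).neg
    simpa using h1.cexp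
  have key := intervalIntegral.integral_mul_deriv_eq_deriv_mul (a := (0 : ℝ)) (b := 2 * π)
    (u := fun x : ℝ => Complex.exp (-(Complex.I * n * x))) (v := g)
    (u' := fun x : ℝ => Complex.exp (-(Complex.I * n * x)) * (-(Complex.I * n))) (v' := g')
    (fun x _ => he x) (fun x _ => hg x)
    ((by fun_prop : Continuous fun x : ℝ =>
      Complex.exp (-(Complex.I * n * x)) * (-(Complex.I * n))).intervalIntegrable _ _)
    (hg'.intervalIntegrable _ _)
  have h2 : ∫ x in (0 : ℝ)..(2 * π), Complex.exp (-(Complex.I * n * x)) * (-(Complex.I * n)) * g x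
      = -(Complex.I * n) * ∫ x in (0 : ℝ)..(2 * π), Complex.exp (-(Complex.I * n * x)) * g x := by
    rw [← intervalIntegral.integral_const_mul]
    congr 1; ext x; ring
  have h3 := cexp_two_pi n
  rw [h2, h3, ← hp] at key
  simp only [fc]
  rw [key]
  simp only [Complex.real_smul, Complex.ofReal_zero, mul_zero, neg_zero, Complex.exp_zero]
  ring

lemma fc_hasSum {g : ℝ → ℂ} (hg : Continuous g) (hp : Function.Periodic g (2 * π))
    (hs : Summable fun n => ‖fc g n‖) (x : ℝ) :
    HasSum (fun n : ℤ => fc g n * Complex.exp (Complex.I * n * x)) (g x) := by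
  have : Fact (0 < 2 * π) := ⟨by positivity⟩
  have hlift : Continuous (hp.lift : AddCircle (2 * π) → ℂ) :=
    continuous_coinduced_dom.2 hg
  let F : C(AddCircle (2 * π), ℂ) := ⟨hp.lift, hlift⟩
  have hco : ∀ n, fourierCoeff F n = fc g n := by
    intro n
    rw [fourierCoeff_eq_intervalIntegral _ n 0, fc, zero_add]
    congr 1
    refine intervalIntegral.integral_congr fun t _ => ?_
    simp only [smul_eq_mul]
    rw [fourier_coe_apply]
    congr 2
    push_cast
    have : (π : ℂ) ≠ 0 := by exact_mod_cast Real.pi_ne_zero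
    field_simp
  have h := has_pointwise_sum_fourier_series_of_summable (f := F)
    (by rw [show fourierCoeff F = fc g from funext hco]; exact hs.of_norm) (x : AddCircle (2 * π))
  simp only [hco] at h
  have hF : F (x : AddCircle (2 * π)) = g x := rfl
  rw [hF] at h
  convert h using 2 with n
  rw [fourier_coe_apply, smul_eq_mul]
  congr 2
  push_cast
  have : (π : ℂ) ≠ 0 := by exact_mod_cast Real.pi_ne_zero
  field_simp

lemma norm_le_of_fc {g : ℝ → ℂ} (hg : Continuous g) (hp : Function.Periodic g (2 * π))
    {b : ℤ → ℝ} {S : ℝ} (hb : ∀ n, ‖fc g n‖ ≤ b n) (hS : HasSum b S) (x : ℝ) : ‖g x‖ ≤ S := by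
  have hs : Summable fun n => ‖fc g n‖ :=
    Summable.of_nonneg_of_le (fun n => norm_nonneg _) hb hS.summable
  have h := fc_hasSum hg hp hs x
  have h1 : ∀ n : ℤ, ‖fc g n * Complex.exp (Complex.I * n * x)‖ = ‖fc g n‖ := fun n => by
    rw [norm_mul, norm_cexp_I_mul_pos, mul_one]
  rw [← h.tsum_eq]
  refine (norm_tsum_le_tsum_norm (by simpa only [h1] using hs)).trans ?_
  simp only [h1]
  rw [← hS.tsum_eq]
  exact hs.tsum_le_tsum hb hS.summable

lemma hasSum_congr_of_eq {f g : ℤ → ℂ} {a : ℂ} (h : HasSum f a) (hfg : ∀ n, g n = f n) :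
    HasSum g a := (funext hfg : g = f) ▸ h

/-- Fourier coefficients of a product with an absolutely convergent Fourier series. -/
lemma fc_mul_hasSum {g h : ℝ → ℂ} {b : ℤ → ℂ} (hg : Continuous g)
    (hb : Summable fun m => ‖b m‖)
    (hh : ∀ x : ℝ, HasSum (fun m : ℤ => b m * Complex.exp (Complex.I * m * x)) (h x)) (n : ℤ) :
    HasSum (fun m : ℤ => b m * fc g (n - m)) (fc (fun x => h x * g x) n) := by
  obtain ⟨C, hC⟩ := (isCompact_Icc (a := (0 : ℝ)) (b := 2 * π)).exists_bound_of_continuousOn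
    hg.continuousOn
  have hpi : (0 : ℝ) ≤ 2 * π := by positivity
  have h1 := intervalIntegral.hasSum_integral_of_dominated_convergence (a := (0 : ℝ))
    (b := 2 * π) (μ := volume)
    (F := fun (m : ℤ) (x : ℝ) => b m * (Complex.exp (-(Complex.I * (n - m : ℤ) * x)) * g x))
    (f := fun x => Complex.exp (-(Complex.I * n * x)) * (h x * g x))
    (bound := fun m _ => ‖b m‖ * C)
    (fun m => (by fun_prop : Continuous fun x : ℝ =>
      b m * (Complex.exp (-(Complex.I * (n - m : ℤ) * x)) * g x)).aestronglyMeasurable)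
    (fun m => Filter.Eventually.of_forall fun x hx => by
      rw [norm_mul, norm_mul, norm_cexp_I_mul, one_mul]
      gcongr
      rw [uIoc_of_le hpi] at hx
      exact hC x ⟨hx.1.le, hx.2⟩)
    (Filter.Eventually.of_forall fun x _ => hb.mul_right C)
    (by simp)
    (Filter.Eventually.of_forall fun x _ => by
      have := (hh x).mul_left (Complex.exp (-(Complex.I * n * x)) * g x)
      rw [show Complex.exp (-(Complex.I * n * x)) * (h x * g x) =
        Complex.exp (-(Complex.I * n * x)) * g x * h x by ring]
      refine hasSum_congr_of_eq this fun m => ?_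
      have h4 : Complex.exp (-(Complex.I * ((n - m : ℤ) : ℂ) * x)) =
          Complex.exp (-(Complex.I * n * x)) * Complex.exp (Complex.I * m * x) := by
        rw [← Complex.exp_add]; congr 1; push_cast; ring
      rw [h4]; ring)
  have h2 := h1.const_smul (1 / (2 * π) : ℝ)
  refine hasSum_congr_of_eq h2 fun m => ?_
  rw [intervalIntegral.integral_const_mul, fc]
  simp only [Complex.real_smul]
  ring

lemma norm_fc_mul_le {g h : ℝ → ℂ} {b : ℤ → ℂ} {β w : ℤ → ℝ} {A H : ℝ} (hg : Continuous g)
    (hA : 0 ≤ A) (hbβ : ∀ m, ‖b m‖ ≤ β m) {ω : ℤ → ℝ} (hω : ∀ m, 1 ≤ ω m)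
    (hwω : ∀ n m, w (n - m) ≤ w n * ω m) (hH : HasSum (fun m => β m * ω m) H)
    (hh : ∀ x : ℝ, HasSum (fun m : ℤ => b m * Complex.exp (Complex.I * m * x)) (h x))
    (hfc : ∀ n, ‖fc g n‖ ≤ A * w n) (n : ℤ) : ‖fc (fun x => h x * g x) n‖ ≤ A * H * w n := by
  have hb : Summable fun m => ‖b m‖ := by
    refine Summable.of_nonneg_of_le (fun m => norm_nonneg _) (fun m => ?_) hH.summable
    exact (hbβ m).trans (le_mul_of_one_le_right ((norm_nonneg _).trans (hbβ m)) (hω m))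
  have h1 := fc_mul_hasSum hg hb hh n
  have h2 : ∀ m, ‖b m * fc g (n - m)‖ ≤ (A * w n) * (β m * ω m) := fun m => by
    rw [norm_mul]
    calc ‖b m‖ * ‖fc g (n - m)‖ ≤ β m * (A * (w n * ω m)) :=
          mul_le_mul (hbβ m) ((hfc _).trans (by gcongr; exact hwω n m)) (norm_nonneg _)
            ((norm_nonneg _).trans (hbβ m))
      _ = _ := by ring
  have h3 := hH.mul_left (A * w n)
  rw [← h1.tsum_eq]
  calc _ ≤ ∑' m, ‖b m * fc g (n - m)‖ := norm_tsum_le_tsum_norm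
        (Summable.of_nonneg_of_le (fun m => norm_nonneg _) h2 h3.summable)
    _ ≤ A * w n * H := by
        rw [← h3.tsum_eq]
        exact (Summable.of_nonneg_of_le (fun m => norm_nonneg _) h2 h3.summable).tsum_le_tsum h2
          h3.summable
    _ = _ := by ring

lemma hasDerivAt_fc_of_analyticAt {G : ℂ → ℂ} {y : ℝ}
    (hG : ∀ x : ℝ, AnalyticAt ℝ G (x + y * Complex.I)) (n : ℤ) :
    HasDerivAt (fun y : ℝ => fc (fun x : ℝ => G (x + y * Complex.I)) n)
      (fc (fun x : ℝ => fderiv ℝ G (x + y * Complex.I) Complex.I) n) y := by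
  have hopen : IsOpen {p : ℝ × ℝ | AnalyticAt ℝ G (p.1 + p.2 * Complex.I)} :=
    (isOpen_analyticAt ℝ G).preimage (by fun_prop)
  obtain ⟨u, v, hu, hv, hKu, hyv, huv⟩ := generalized_tube_lemma
    (isCompact_Icc (a := (0 : ℝ)) (b := 2 * π)) (isCompact_singleton (x := y)) hopen
    (by rintro ⟨a, b⟩ ⟨_, hb⟩; rw [mem_singleton_iff] at hb; subst hb; exact hG a)
  obtain ⟨ε, hε, hεv⟩ := Metric.nhds_basis_closedBall.mem_iff.1 (hv.mem_nhds (hyv rfl))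
  have hA : ∀ x ∈ Icc (0 : ℝ) (2 * π), ∀ y' ∈ Metric.closedBall y ε,
      AnalyticAt ℝ G (x + y' * Complex.I) := fun x hx y' hy' =>
    huv (show (x, y') ∈ u ×ˢ v from ⟨hKu hx, hεv hy'⟩)
  have hmem : (fun p : ℝ × ℝ => (p.1 + p.2 * Complex.I : ℂ)) '' (Icc 0 (2 * π) ×ˢ
      Metric.closedBall y ε) ⊆ {z | AnalyticAt ℝ G z} := by
    rintro _ ⟨p, ⟨h1, h2⟩, rfl⟩; exact hA _ h1 _ h2
  have hcd : ContinuousOn (fun p : ℝ × ℝ => fderiv ℝ G (p.1 + p.2 * Complex.I) Complex.I)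
      (Icc 0 (2 * π) ×ˢ Metric.closedBall y ε) := by
    intro p hp
    have h1 := (hA _ hp.1 _ hp.2).fderiv.continuousAt
    have h2 : ContinuousAt (fun p : ℝ × ℝ => (p.1 + p.2 * Complex.I : ℂ)) p := by fun_prop
    have h3 : ContinuousAt (fun p : ℝ × ℝ => fderiv ℝ G (p.1 + p.2 * Complex.I)) p :=
      ContinuousAt.comp (f := fun p : ℝ × ℝ => (p.1 + p.2 * Complex.I : ℂ)) h1 h2
    exact (h3.clm_apply continuousAt_const).continuousWithinAt
  obtain ⟨C, hC⟩ := (isCompact_Icc.prod (isCompact_closedBall y ε)).exists_bound_of_continuousOn hcd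
  have hpi : (0 : ℝ) ≤ 2 * π := by positivity
  have hcG : ∀ y' ∈ Metric.closedBall y ε,
      ContinuousOn (fun x : ℝ => G (x + y' * Complex.I)) (Icc 0 (2 * π)) := fun y' hy' x hx =>
    (ContinuousAt.comp (f := fun x : ℝ => (x + y' * Complex.I : ℂ)) (hA x hx y' hy').continuousAt
      (by fun_prop)).continuousWithinAt
  have hcG' : ContinuousOn (fun x : ℝ => Complex.exp (-(Complex.I * n * x)) *
      fderiv ℝ G (x + y * Complex.I) Complex.I) (Icc 0 (2 * π)) := by
    refine ContinuousOn.mul (by fun_prop) ?_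
    exact hcd.comp (f := fun x : ℝ => (x, y)) (by fun_prop)
      (fun x hx => ⟨hx, Metric.mem_closedBall_self hε.le⟩)
  have key := intervalIntegral.hasDerivAt_integral_of_dominated_loc_of_deriv_le (μ := volume)
    (a := 0) (b := 2 * π) (x₀ := y) (s := Metric.closedBall y ε)
    (F := fun (y : ℝ) (x : ℝ) => Complex.exp (-(Complex.I * n * x)) * G (x + y * Complex.I))
    (F' := fun (y : ℝ) (x : ℝ) => Complex.exp (-(Complex.I * n * x)) *
      fderiv ℝ G (x + y * Complex.I) Complex.I)
    (bound := fun _ => C) (Metric.closedBall_mem_nhds y hε)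
    (by
      filter_upwards [Metric.closedBall_mem_nhds y hε] with y' hy'
      rw [uIoc_of_le hpi]
      exact ((ContinuousOn.mul (by fun_prop) (hcG y' hy')).mono Ioc_subset_Icc_self
        ).aestronglyMeasurable measurableSet_Ioc)
    (by
      refine ContinuousOn.intervalIntegrable ?_
      rw [uIcc_of_le hpi]
      exact ContinuousOn.mul (by fun_prop) (hcG y (Metric.mem_closedBall_self hε.le)))
    (by
      rw [uIoc_of_le hpi]
      exact (hcG'.mono Ioc_subset_Icc_self).aestronglyMeasurable measurableSet_Ioc)
    (Filter.Eventually.of_forall fun x hx y' hy' => by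
      rw [uIoc_of_le hpi] at hx
      rw [norm_mul, norm_cexp_I_mul, one_mul]
      exact hC (x, y') ⟨⟨hx.1.le, hx.2⟩, hy'⟩)
    (by simp)
    (Filter.Eventually.of_forall fun x hx y' hy' => by
      rw [uIoc_of_le hpi] at hx
      refine HasDerivAt.const_mul _ ?_
      have h1 := (hA x ⟨hx.1.le, hx.2⟩ y' hy').differentiableAt.hasFDerivAt
      have h2 : HasDerivAt (fun y : ℝ => (x + y * Complex.I : ℂ)) Complex.I y' := by
        simpa using ((Complex.ofRealCLM.hasDerivAt (x := y')).mul_const Complex.I).const_add (x : ℂ)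
      exact h1.comp_hasDerivAt y' h2)
  exact key.2.const_smul (1 / (2 * π) : ℝ)

lemma exists_local_complex_extension {f : ℝ → ℂ} {x₀ : ℝ} (hf : AnalyticAt ℝ f x₀) :
    ∃ ρ > 0, ∃ C : ℝ, ∃ g : ℂ → ℂ, DifferentiableOn ℂ g (Metric.ball (x₀ : ℂ) ρ) ∧
      (∀ z ∈ Metric.ball (x₀ : ℂ) ρ, ‖g z‖ ≤ C) ∧ ∀ x ∈ Metric.ball x₀ ρ, f x = g x := by
  obtain ⟨p, hp⟩ := hf
  have h1 := hasFPowerSeriesAt_iff.1 hp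
  obtain ⟨ε, hε, h2⟩ := Metric.eventually_nhds_iff_ball.1 h1
  set ρ := ε / 2 with hρ
  have hρ0 : 0 < ρ := by positivity
  have h3 := (h2 ρ (by
    rw [Metric.mem_ball, Real.dist_eq, sub_zero, abs_of_pos hρ0]; linarith)).summable
  obtain ⟨C, hC⟩ := h3.tendsto_cofinite_zero.norm.bddAbove_range_of_cofinite
  have hC' : ∀ n, ‖p.coeff n‖ * ρ ^ n ≤ C := fun n => by
    have := hC (mem_range_self n)
    rwa [norm_smul, norm_pow, Real.norm_of_nonneg hρ0.le, mul_comm] at this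
  have hC0 : 0 ≤ C := le_trans (by positivity) (hC' 0)
  have hbound : ∀ (n : ℕ) (w : ℂ), w ∈ Metric.ball (x₀ : ℂ) (ρ / 2) →
      ‖(w - x₀) ^ n * p.coeff n‖ ≤ C * (1 / 2) ^ n := by
    intro n w hw
    rw [Metric.mem_ball, dist_eq_norm] at hw
    rw [norm_mul, norm_pow]
    calc ‖w - x₀‖ ^ n * ‖p.coeff n‖ ≤ (ρ / 2) ^ n * ‖p.coeff n‖ := by gcongr
      _ = (‖p.coeff n‖ * ρ ^ n) * (1 / 2) ^ n := by rw [div_pow ρ, one_div, inv_pow]; ring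
      _ ≤ _ := by gcongr; exact hC' n
  have hsum : Summable fun n : ℕ => C * (1 / 2 : ℝ) ^ n :=
    (summable_geometric_of_lt_one (by norm_num) (by norm_num)).mul_left C
  refine ⟨ρ / 2, by positivity, ∑' n : ℕ, C * (1 / 2 : ℝ) ^ n,
    fun z => ∑' n : ℕ, (z - x₀) ^ n * p.coeff n, ?_, ?_, ?_⟩
  · exact Complex.differentiableOn_tsum_of_summable_norm hsum
      (fun n => by fun_prop) Metric.isOpen_ball hbound
  · exact fun z hz => tsum_of_norm_bounded hsum.hasSum fun n => hbound n z hz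
  · intro x hx
    have h4 := h2 (x - x₀) (by
      rw [Metric.mem_ball, Real.dist_eq] at hx ⊢; rw [sub_zero]; linarith)
    rw [add_sub_cancel] at h4
    rw [← h4.tsum_eq]
    congr 1; ext n
    rw [Complex.real_smul]; push_cast; rfl

lemma ofReal_mem_ball {x x₀ ρ : ℝ} (hx : x ∈ Metric.ball x₀ ρ) :
    (x : ℂ) ∈ Metric.ball (x₀ : ℂ) ρ := by
  rwa [Metric.mem_ball, dist_eq_norm, ← Complex.ofReal_sub, Complex.norm_real, ← dist_eq_norm]

lemma iteratedDeriv_eq_of_restrict {f : ℝ → ℂ} {g : ℂ → ℂ} {x₀ ρ : ℝ}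
    (hg : DifferentiableOn ℂ g (Metric.ball (x₀ : ℂ) ρ))
    (hfg : ∀ x ∈ Metric.ball x₀ ρ, f x = g x) (k : ℕ) :
    ∀ x ∈ Metric.ball x₀ ρ, iteratedDeriv k f x = iteratedDeriv k g x := by
  induction k with
  | zero => simpa using hfg
  | succ k ih =>
    intro x hx
    have hxc := ofReal_mem_ball hx
    have h1 : iteratedDeriv k f =ᶠ[𝓝 x] fun x : ℝ => iteratedDeriv k g x := by
      filter_upwards [Metric.isOpen_ball.mem_nhds hx] with y hy using ih y hy
    rw [iteratedDeriv_succ, h1.deriv_eq, iteratedDeriv_succ]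
    have h2 : AnalyticAt ℂ g x := hg.analyticAt (Metric.isOpen_ball.mem_nhds hxc)
    have h3 : DifferentiableAt ℂ (iteratedDeriv k g) x := by
      rw [iteratedDeriv_eq_iterate]
      exact (h2.iterated_deriv k).differentiableAt
    exact h3.hasDerivAt.comp_ofReal.deriv

lemma exists_iteratedDeriv_bound_at {f : ℝ → ℂ} {x₀ : ℝ} (hf : AnalyticAt ℝ f x₀) :
    ∃ ε > 0, ∃ C : ℝ, ∃ R > 0, ∀ x ∈ Metric.ball x₀ ε, ∀ k : ℕ,
      ‖iteratedDeriv k f x‖ ≤ C * R ^ k * k.factorial := by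
  obtain ⟨ρ, hρ, C, g, hg, hC, hfg⟩ := exists_local_complex_extension hf
  refine ⟨ρ / 2, by positivity, C, (ρ / 4)⁻¹, by positivity, fun x hx k => ?_⟩
  have hx' : x ∈ Metric.ball x₀ ρ := Metric.ball_subset_ball (by linarith) hx
  rw [iteratedDeriv_eq_of_restrict hg hfg k x hx']
  have hsub : Metric.closedBall (x : ℂ) (ρ / 4) ⊆ Metric.ball (x₀ : ℂ) ρ := by
    refine Metric.closedBall_subset_ball' ?_
    have := ofReal_mem_ball hx
    rw [Metric.mem_ball] at this
    linarith
  have h1 := Complex.norm_iteratedDeriv_le_of_forall_mem_sphere_norm_le k (R := ρ / 4) (C := C)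
    (by positivity) ((hg.mono hsub).diffContOnCl_ball subset_rfl)
    (fun z hz => hC z (hsub (Metric.sphere_subset_closedBall hz)))
  refine h1.trans (le_of_eq ?_)
  rw [inv_pow]; ring

lemma exists_iteratedDeriv_bound {f : ℝ → ℂ} (hf : ∀ x, AnalyticAt ℝ f x) {K : Set ℝ}
    (hK : IsCompact K) : ∃ C : ℝ, ∃ R > 0, ∀ x ∈ K, ∀ k : ℕ,
      ‖iteratedDeriv k f x‖ ≤ C * R ^ k * k.factorial := by
  refine hK.induction_on (p := fun K => ∃ C : ℝ, ∃ R > 0, ∀ x ∈ K, ∀ k : ℕ,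
      ‖iteratedDeriv k f x‖ ≤ C * R ^ k * k.factorial) ⟨0, 1, one_pos, by simp⟩ ?_ ?_ ?_
  · rintro s t hst ⟨C, R, hR, h⟩
    exact ⟨C, R, hR, fun x hx => h x (hst hx)⟩
  · rintro s t ⟨C, R, hR, h⟩ ⟨C', R', hR', h'⟩
    refine ⟨max (max C C') 0, max R R', lt_max_of_lt_left hR, fun x hx k => ?_⟩
    rcases hx with hx | hx
    · refine (h x hx k).trans ?_
      gcongr
      · exact (le_max_left _ _).trans (le_max_left _ _)
      · exact le_max_left _ _
    · refine (h' x hx k).trans ?_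
      gcongr
      · exact (le_max_right _ _).trans (le_max_left _ _)
      · exact le_max_right _ _
  · intro x _
    obtain ⟨ε, hε, C, R, hR, h⟩ := exists_iteratedDeriv_bound_at (hf x)
    exact ⟨_, mem_nhdsWithin_of_mem_nhds (Metric.ball_mem_nhds x hε), C, R, hR, h⟩

lemma fc_iteratedDeriv {f : ℝ → ℂ} (hf : ∀ x, AnalyticAt ℝ f x)
    (hp : Function.Periodic f (2 * π)) (n : ℤ) (k : ℕ) :
    fc (iteratedDeriv k f) n = (Complex.I * n) ^ k * fc f n := by
  have hcd : ContDiff ℝ ⊤ f := contDiff_iff_contDiffAt.2 fun x => (hf x).contDiffAt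
  induction k with
  | zero => simp
  | succ k ih =>
    have hper : iteratedDeriv k f 0 = iteratedDeriv k f (2 * π) := by
      have h1 : (fun x => f (x + 2 * π)) = f := funext hp
      have h2 := iteratedDeriv_comp_add_const k f (2 * π)
      rw [h1] at h2
      have := congrFun h2 0
      simpa using this
    have hd : ∀ x, HasDerivAt (iteratedDeriv k f) (iteratedDeriv (k + 1) f x) x := fun x => by
      rw [iteratedDeriv_succ]
      exact (hcd.differentiable_iteratedDeriv k
        (by exact_mod_cast WithTop.coe_lt_top _) x).hasDerivAt
    rw [fc_deriv hd (hcd.continuous_iteratedDeriv _ (by exact_mod_cast le_top)) hper, ih, pow_succ]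
    ring

/-- Fourier coefficients of a real-analytic periodic function decay exponentially. -/
lemma exists_fc_decay {f : ℝ → ℂ} (hf : ∀ x, AnalyticAt ℝ f x)
    (hp : Function.Periodic f (2 * π)) :
    ∃ B : ℝ, ∃ r > 0, ∀ n : ℤ, ‖fc f n‖ ≤ B * Real.exp (-(r * |(n : ℝ)|)) := by
  obtain ⟨C, R, hR, h⟩ := exists_iteratedDeriv_bound hf (isCompact_Icc (a := (0 : ℝ)) (b := 2 * π))
  have hpi : (0 : ℝ) < 2 * π := by positivity
  have hall : ∀ x, ∀ k : ℕ, ‖iteratedDeriv k f x‖ ≤ C * R ^ k * k.factorial := by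
    intro x k
    have hper : Function.Periodic (iteratedDeriv k f) (2 * π) := by
      have h1 : (fun x => f (x + 2 * π)) = f := funext hp
      have h2 := iteratedDeriv_comp_add_const k f (2 * π)
      rw [h1] at h2
      exact fun x => (congrFun h2 x).symm
    obtain ⟨y, hy, hxy⟩ := hper.exists_mem_Ico₀ hpi x
    rw [hxy]; exact h y ⟨hy.1, hy.2.le⟩ k
  refine ⟨2 * C, 1 / (2 * R), by positivity, fun n => ?_⟩
  have h1 : ∀ k : ℕ, |(n : ℝ)| ^ k * ‖fc f n‖ ≤ C * R ^ k * k.factorial := fun k => by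
    have h2 := norm_fc_le (fun x => hall x k) n
    rw [fc_iteratedDeriv hf hp, norm_mul, norm_pow, norm_mul, Complex.norm_I, one_mul,
      Complex.norm_intCast] at h2
    exact h2
  have h3 : HasSum (fun k : ℕ => ‖fc f n‖ * ((1 / (2 * R) * |(n : ℝ)|) ^ k / k.factorial))
      (‖fc f n‖ * Real.exp (1 / (2 * R) * |(n : ℝ)|)) := by
    rw [Real.exp_eq_exp_ℝ]
    exact (NormedSpace.expSeries_div_hasSum_exp (1 / (2 * R) * |(n : ℝ)|)).mul_left _
  have h4 : HasSum (fun k : ℕ => C * (1 / 2 : ℝ) ^ k) (C * (1 - 1 / 2)⁻¹) :=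
    (hasSum_geometric_of_lt_one (by norm_num) (by norm_num)).mul_left C
  have h5 := hasSum_le (fun k => ?_) h3 h4
  · rw [Real.exp_neg, ← div_eq_mul_inv, le_div_iff₀ (Real.exp_pos _)]
    linarith
  · rw [mul_pow, div_pow, mul_pow, one_pow]
    have := h1 k
    rw [div_pow, one_pow, ← mul_div_assoc, div_le_iff₀ (by positivity)]
    calc ‖fc f n‖ * (1 / (2 ^ k * R ^ k) * |(n : ℝ)| ^ k)
        = (|(n : ℝ)| ^ k * ‖fc f n‖) / (2 ^ k * R ^ k) := by ring
      _ ≤ (C * R ^ k * k.factorial) / (2 ^ k * R ^ k) := by gcongr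
      _ = _ := by field_simp

lemma summable_exp_abs {c : ℝ} (hc : 0 < c) :
    Summable fun n : ℤ => Real.exp (-(c * |(n : ℝ)|)) := by
  have h : Summable fun n : ℕ => Real.exp (-(c * (n : ℝ))) := by
    have := Real.summable_exp_nat_mul_iff.2 (neg_lt_zero.2 hc)
    refine this.congr fun n => ?_
    congr 1; ring
  refine Summable.of_nat_of_neg ?_ ?_ <;> simpa using h

/-- The sum of `exp (-c |n|)` over the integers. -/
def expSum (c : ℝ) : ℝ := ∑' n : ℤ, Real.exp (-(c * |(n : ℝ)|))

lemma hasSum_expSum {c : ℝ} (hc : 0 < c) :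
    HasSum (fun n : ℤ => Real.exp (-(c * |(n : ℝ)|))) (expSum c) := (summable_exp_abs hc).hasSum

lemma expSum_nonneg (c : ℝ) : 0 ≤ expSum c := tsum_nonneg fun _ => (Real.exp_pos _).le

lemma norm_cexp_le (n : ℤ) {z : ℂ} {s : ℝ} (hz : |z.im| ≤ s) :
    ‖Complex.exp (Complex.I * n * z)‖ ≤ Real.exp (s * |(n : ℝ)|) := by
  rw [Complex.norm_exp]
  gcongr
  have : (Complex.I * n * z).re = -(n * z.im) := by simp
  rw [this]
  calc -((n : ℝ) * z.im) ≤ |(n : ℝ) * z.im| := neg_le_abs _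
    _ = |z.im| * |(n : ℝ)| := by rw [abs_mul, mul_comm]
    _ ≤ _ := by gcongr

/-- The function on a strip with prescribed Fourier coefficients on the real line. -/
def fser (a : ℤ → ℂ) (z : ℂ) : ℂ := ∑' n : ℤ, a n * Complex.exp (Complex.I * n * z)

lemma norm_fser_term_le {a : ℤ → ℂ} {B r s : ℝ}
    (ha : ∀ n : ℤ, ‖a n‖ ≤ B * Real.exp (-(r * |(n : ℝ)|))) {z : ℂ} (hz : |z.im| ≤ s) (n : ℤ) :
    ‖a n * Complex.exp (Complex.I * n * z)‖ ≤ B * Real.exp (-((r - s) * |(n : ℝ)|)) := by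
  rw [norm_mul]
  calc _ ≤ (B * Real.exp (-(r * |(n : ℝ)|))) * Real.exp (s * |(n : ℝ)|) :=
        mul_le_mul (ha n) (norm_cexp_le n hz) (norm_nonneg _) ((norm_nonneg _).trans (ha n))
    _ = _ := by rw [mul_assoc, ← Real.exp_add]; congr 2; ring

lemma fser_hasSum {a : ℤ → ℂ} {B r : ℝ}
    (ha : ∀ n : ℤ, ‖a n‖ ≤ B * Real.exp (-(r * |(n : ℝ)|))) {z : ℂ} (hz : |z.im| < r) :
    HasSum (fun n : ℤ => a n * Complex.exp (Complex.I * n * z)) (fser a z) :=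
  (Summable.of_norm_bounded ((hasSum_expSum (sub_pos.2 hz)).summable.mul_left B)
    (norm_fser_term_le ha le_rfl)).hasSum

lemma norm_fser_le {a : ℤ → ℂ} {B r s : ℝ}
    (ha : ∀ n : ℤ, ‖a n‖ ≤ B * Real.exp (-(r * |(n : ℝ)|))) (hs : s < r) {z : ℂ}
    (hz : |z.im| ≤ s) : ‖fser a z‖ ≤ B * expSum (r - s) :=
  tsum_of_norm_bounded ((hasSum_expSum (sub_pos.2 hs)).mul_left B) (norm_fser_term_le ha hz)

lemma fser_add_two_pi (a : ℤ → ℂ) (z : ℂ) : fser a (z + 2 * π) = fser a z := by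
  unfold fser
  congr 1; ext n
  rw [show Complex.I * n * (z + 2 * π) = Complex.I * n * z + n * (2 * π * Complex.I) by ring,
    Complex.exp_add, Complex.exp_int_mul_two_pi_mul_I, mul_one]

lemma isOpen_strip (s : ℝ) : IsOpen {z : ℂ | |z.im| < s} :=
  isOpen_lt (by fun_prop) continuous_const

lemma fser_hasDerivAt {a : ℤ → ℂ} {B r : ℝ}
    (ha : ∀ n : ℤ, ‖a n‖ ≤ B * Real.exp (-(r * |(n : ℝ)|))) {z : ℂ} (hz : |z.im| < r) :
    HasDerivAt (fser a) (fser (fun n => Complex.I * n * a n) z) z := by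
  obtain ⟨s, hzs, hs⟩ := exists_between hz
  have hsum := (hasSum_expSum (sub_pos.2 hs)).summable.mul_left B
  have hle : ∀ (n : ℤ) (w : ℂ), w ∈ {z : ℂ | |z.im| < s} →
      ‖a n * Complex.exp (Complex.I * n * w)‖ ≤ B * Real.exp (-((r - s) * |(n : ℝ)|)) :=
    fun n w hw => norm_fser_term_le ha (le_of_lt hw) n
  have hd : ∀ n : ℤ, DifferentiableOn ℂ (fun w : ℂ => a n * Complex.exp (Complex.I * n * w))
      {z : ℂ | |z.im| < s} := fun n => by fun_prop
  have h1 := Complex.differentiableOn_tsum_of_summable_norm hsum hd (isOpen_strip s) hle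
  have h2 := Complex.hasSum_deriv_of_summable_norm hsum hd (isOpen_strip s) hle hzs
  have h3 : HasDerivAt (fser a) (deriv (fser a) z) z :=
    (h1.differentiableAt ((isOpen_strip s).mem_nhds hzs)).hasDerivAt
  convert h3 using 1
  have h4 : deriv (fser a) z = _ := h2.tsum_eq.symm
  rw [h4, fser]
  congr 1; ext n
  have h5 : HasDerivAt (fun w : ℂ => Complex.I * n * w) (Complex.I * n * 1) z :=
    (hasDerivAt_id z).const_mul _
  rw [(h5.cexp.const_mul (a n)).deriv]
  ring

lemma norm_deriv_coeff_le {a : ℤ → ℂ} {B r c : ℝ} (hc : 0 < c)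
    (ha : ∀ n : ℤ, ‖a n‖ ≤ B * Real.exp (-(r * |(n : ℝ)|))) (n : ℤ) :
    ‖Complex.I * n * a n‖ ≤ B / c * Real.exp (-((r - c) * |(n : ℝ)|)) := by
  rw [norm_mul, norm_mul, Complex.norm_I, one_mul, Complex.norm_intCast]
  have h1 : c * |(n : ℝ)| ≤ Real.exp (c * |(n : ℝ)|) := by
    linarith [Real.add_one_le_exp (c * |(n : ℝ)|)]
  have hB : 0 ≤ B := by
    by_contra hB
    have := (norm_nonneg _).trans (ha 0)
    have := mul_neg_of_neg_of_pos (not_le.1 hB) (Real.exp_pos (-(r * |((0 : ℤ) : ℝ)|)))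
    linarith
  calc |(n : ℝ)| * ‖a n‖ ≤ (Real.exp (c * |(n : ℝ)|) / c) * (B * Real.exp (-(r * |(n : ℝ)|))) := by
        gcongr
        · rw [le_div_iff₀ hc]; linarith
        · exact ha n
    _ = B / c * (Real.exp (c * |(n : ℝ)|) * Real.exp (-(r * |(n : ℝ)|))) := by ring
    _ = _ := by rw [← Real.exp_add]; congr 2; ring

/-- The Laplacian on `ℂ`, as a sum of two iterated directional derivatives. -/
def lapl (G : ℂ → ℂ) (z : ℂ) : ℂ :=
  fderiv ℝ (fun w => fderiv ℝ G w 1) z 1 + fderiv ℝ (fun w => fderiv ℝ G w Complex.I) z Complex.I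

lemma analyticAt_fderiv_apply {G : ℂ → ℂ} {z : ℂ} (hG : AnalyticAt ℝ G z) (v : ℂ) :
    AnalyticAt ℝ (fun w => fderiv ℝ G w v) z :=
  ((ContinuousLinearMap.apply ℝ ℂ v).analyticAt _).comp hG.fderiv

lemma fderiv_fderiv_apply {G : ℂ → ℂ} {z : ℂ} (hG : AnalyticAt ℝ G z) (u v : ℂ) :
    fderiv ℝ (fun w => fderiv ℝ G w v) z u = fderiv ℝ (fderiv ℝ G) z u v := by
  have h := hG.fderiv.differentiableAt.hasFDerivAt.clm_apply (hasFDerivAt_const v z)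
  rw [h.fderiv]
  simp

lemma analyticAt_lapl {G : ℂ → ℂ} {z : ℂ} (hG : AnalyticAt ℝ G z) : AnalyticAt ℝ (lapl G) z :=
  (analyticAt_fderiv_apply (analyticAt_fderiv_apply hG _) _).add
    (analyticAt_fderiv_apply (analyticAt_fderiv_apply hG _) _)

lemma bilin_add_rotate (L : ℂ →L[ℝ] ℂ →L[ℝ] ℂ) (w : ℂ) :
    L w w + L (w * Complex.I) (w * Complex.I) =
      (Complex.normSq w : ℂ) * (L 1 1 + L Complex.I Complex.I) := by
  have h1 : w = w.re • (1 : ℂ) + w.im • Complex.I := by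
    apply Complex.ext <;> simp
  have h2 : w * Complex.I = (-w.im) • (1 : ℂ) + w.re • Complex.I := by
    apply Complex.ext <;> simp
  rw [Complex.normSq_apply]
  generalize w * Complex.I = w' at h2
  generalize w.re = a, w.im = b at *
  subst h1 h2
  simp only [map_add, ContinuousLinearMap.map_smul, _root_.add_apply, _root_.smul_apply]
  simp only [Complex.real_smul]
  push_cast
  ring

lemma lapl_comp {Φ Q Q₁ : ℂ → ℂ} {q₂ z : ℂ} (hΦ : AnalyticAt ℝ Φ (Q z))
    (hQ : ∀ᶠ w in 𝓝 z, HasDerivAt Q (Q₁ w) w) (hQ₁ : HasDerivAt Q₁ q₂ z) :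
    lapl (fun w => Φ (Q w)) z = (Complex.normSq (Q₁ z) : ℂ) * lapl Φ (Q z) := by
  have hQc : ContinuousAt Q z := hQ.self_of_nhds.continuousAt
  have hΦe : ∀ᶠ w in 𝓝 z, AnalyticAt ℝ Φ (Q w) :=
    hQc.eventually hΦ.eventually_analyticAt
  have h1 : ∀ v : ℂ, (fun w => fderiv ℝ (fun w => Φ (Q w)) w v) =ᶠ[𝓝 z]
      fun w => fderiv ℝ Φ (Q w) (Q₁ w * v) := by
    intro v
    filter_upwards [hQ, hΦe] with w hw hΦw
    have h2 := hΦw.differentiableAt.hasFDerivAt.comp w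
      (hw.hasFDerivAt.restrictScalars ℝ)
    have h3 : fderiv ℝ (fun w => Φ (Q w)) w = _ := h2.fderiv
    rw [h3]
    simp [mul_comm]
  have h2 : ∀ v : ℂ, fderiv ℝ (fun w => fderiv ℝ (fun w => Φ (Q w)) w v) z v =
      fderiv ℝ (fderiv ℝ Φ) (Q z) (Q₁ z * v) (Q₁ z * v) + fderiv ℝ Φ (Q z) (q₂ * v * v) := by
    intro v
    rw [(h1 v).fderiv_eq]
    have h3 := hΦ.fderiv.differentiableAt.hasFDerivAt.comp z
      (hQ.self_of_nhds.hasFDerivAt.restrictScalars ℝ)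
    have h4 := ((hQ₁.mul_const v).hasFDerivAt.restrictScalars ℝ)
    have h5 := h3.clm_apply h4
    have h6 : fderiv ℝ (fun w => fderiv ℝ Φ (Q w) (Q₁ w * v)) z = _ := h5.fderiv
    rw [h6]
    simp [mul_comm, add_comm]
  have h3 : q₂ * Complex.I * Complex.I = -(q₂ * 1 * 1) := by
    rw [mul_assoc, Complex.I_mul_I]; ring
  rw [lapl, h2, h2, h3, map_neg, lapl, fderiv_fderiv_apply hΦ, fderiv_fderiv_apply hΦ,
    ← bilin_add_rotate, mul_one]
  ring

/-- `G` is `2π`-periodic in the real direction. -/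
def XPeriodic (G : ℂ → ℂ) : Prop := ∀ z, G (z + 2 * π) = G z

lemma XPeriodic.fderiv {G : ℂ → ℂ} (hG : XPeriodic G) (v : ℂ) :
    XPeriodic fun w => fderiv ℝ G w v := by
  intro z
  have h : (fun w => G (w + 2 * π)) = G := funext hG
  have h1 := fderiv_comp_add_right (𝕜 := ℝ) (f := G) (x := z) (2 * π : ℂ)
  rw [h] at h1
  simp only [h1]

lemma XPeriodic.line {G : ℂ → ℂ} (hG : XPeriodic G) (y : ℝ) :
    Function.Periodic (fun x : ℝ => G (x + y * Complex.I)) (2 * π) := by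
  intro x
  have := hG (x + y * Complex.I)
  simp only
  rw [← this]; congr 1; push_cast; ring

lemma continuous_line {G : ℂ → ℂ} {y : ℝ} (hG : ∀ x : ℝ, AnalyticAt ℝ G (x + y * Complex.I)) :
    Continuous fun x : ℝ => G (x + y * Complex.I) :=
  continuous_iff_continuousAt.2 fun x =>
    ContinuousAt.comp (f := fun x : ℝ => (x + y * Complex.I : ℂ)) (hG x).continuousAt
      (by fun_prop)

/-- Fourier coefficients along the horizontal line at height `y`. -/
def lc (G : ℂ → ℂ) (n : ℤ) (y : ℝ) : ℂ := fc (fun x : ℝ => G (x + y * Complex.I)) n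

lemma lc_fderiv_one {G : ℂ → ℂ} {y : ℝ} (hp : XPeriodic G)
    (hG : ∀ x : ℝ, AnalyticAt ℝ G (x + y * Complex.I)) (n : ℤ) :
    lc (fun w => fderiv ℝ G w 1) n y = Complex.I * n * lc G n y := by
  refine fc_deriv (fun x => ?_) (continuous_line fun x => analyticAt_fderiv_apply (hG x) 1) ?_ n
  · have h2 : HasDerivAt (fun x : ℝ => (x + y * Complex.I : ℂ)) 1 x :=
      (Complex.ofRealCLM.hasDerivAt (x := x)).add_const _
    exact (hG x).differentiableAt.hasFDerivAt.comp_hasDerivAt x h2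
  · have := hp.line y 0
    simpa using this.symm

lemma hasDerivAt_lc {G : ℂ → ℂ} {y : ℝ} (hG : ∀ x : ℝ, AnalyticAt ℝ G (x + y * Complex.I))
    (n : ℤ) : HasDerivAt (lc G n) (lc (fun w => fderiv ℝ G w Complex.I) n y) y :=
  hasDerivAt_fc_of_analyticAt hG n

lemma fc_add {g h : ℝ → ℂ} (hg : Continuous g) (hh : Continuous h) (n : ℤ) :
    fc (fun x => g x + h x) n = fc g n + fc h n := by
  unfold fc
  rw [← smul_add, ← intervalIntegral.integral_add
    ((by fun_prop : Continuous _).intervalIntegrable _ _)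
    ((by fun_prop : Continuous _).intervalIntegrable _ _)]
  congr 2; ext x; ring

lemma hasDerivAt_lc_fderiv {G : ℂ → ℂ} {y : ℝ} (hp : XPeriodic G)
    (hG : ∀ x : ℝ, AnalyticAt ℝ G (x + y * Complex.I)) (n : ℤ) :
    HasDerivAt (lc (fun w => fderiv ℝ G w Complex.I) n)
      ((n : ℂ) ^ 2 * lc G n y + lc (lapl G) n y) y := by
  have h1 := hasDerivAt_lc (fun x => analyticAt_fderiv_apply (hG x) Complex.I) n
  convert h1 using 1
  have h2 : ∀ x : ℝ, AnalyticAt ℝ (fun w => fderiv ℝ G w 1) (x + y * Complex.I) :=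
    fun x => analyticAt_fderiv_apply (hG x) 1
  have h3 := lc_fderiv_one (hp.fderiv 1) h2 n
  rw [lc_fderiv_one hp hG] at h3
  have h4 : lc (lapl G) n y = lc (fun w => fderiv ℝ (fun w => fderiv ℝ G w 1) w 1) n y +
      lc (fun w => fderiv ℝ (fun w => fderiv ℝ G w Complex.I) w Complex.I) n y :=
    fc_add (continuous_line fun x => analyticAt_fderiv_apply (h2 x) 1)
      (continuous_line fun x => analyticAt_fderiv_apply
        (analyticAt_fderiv_apply (hG x) Complex.I) Complex.I) n
  rw [h4, h3]
  have : Complex.I * n * (Complex.I * n * lc G n y) = -((n : ℂ) ^ 2 * lc G n y) := by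
    linear_combination (n : ℂ) ^ 2 * lc G n y * Complex.I_mul_I
  rw [this]; ring

/-- A normalized solution of the Helmholtz equation on the closure of `Ω`. -/
structure Adm (Ω : Set ℂ) (lam : ℝ) (Φ : ℂ → ℂ) : Prop where
  analytic : ∀ z ∈ closure Ω, AnalyticAt ℝ Φ z
  eigen : ∀ z ∈ closure Ω, lapl Φ z = -(lam : ℂ) ^ 2 * Φ z
  bound : ∀ z ∈ closure Ω, ‖Φ z‖ ≤ 1

/-- A holomorphic parametrization of a one-sided neighbourhood of the boundary of `Ω`. -/
structure Collar (Ω : Set ℂ) (Q Q₁ : ℂ → ℂ) (Y H : ℝ) : Prop where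
  Y_pos : 0 < Y
  H_pos : 0 < H
  deriv : ∀ z : ℂ, |z.im| ≤ Y → ∀ᶠ w in 𝓝 z, HasDerivAt Q (Q₁ w) w
  deriv₁ : ∀ z : ℂ, |z.im| ≤ Y → DifferentiableAt ℂ Q₁ z
  periodic : XPeriodic Q
  series : ∃ b : ℤ → ℂ, HasSum (fun m => ‖b m‖ * Real.exp (Y * |(m : ℝ)|) *
    Real.exp (Y * |(m : ℝ)|)) H ∧ ∀ z : ℂ, |z.im| ≤ Y →
      HasSum (fun m : ℤ => b m * Complex.exp (Complex.I * m * z)) (Q₁ z)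
  maps : ∀ z : ℂ, 0 < z.im → z.im ≤ Y → Q z ∈ Ω
  maps_real : ∀ x : ℝ, Q x ∈ frontier Ω

lemma im_line (x y : ℝ) : ((x : ℂ) + y * Complex.I).im = y := by simp

section Collar

variable {Ω : Set ℂ} {Q Q₁ : ℂ → ℂ} {Y H lam : ℝ} {Φ : ℂ → ℂ} {y : ℝ}

lemma Collar.mem_closure (hC : Collar Ω Q Q₁ Y H) {z : ℂ} (h0 : 0 ≤ z.im) (h1 : z.im ≤ Y) :
    Q z ∈ closure Ω := by
  rcases h0.eq_or_lt with h0 | h0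
  · have hz : z = (z.re : ℂ) := by apply Complex.ext <;> simp [← h0]
    rw [hz]
    exact frontier_subset_closure (hC.maps_real z.re)
  · exact subset_closure (hC.maps z h0 h1)

lemma Collar.abs_im (hC : Collar Ω Q Q₁ Y H) {z : ℂ} (h0 : 0 ≤ z.im) (h1 : z.im ≤ Y) :
    |z.im| ≤ Y := by
  have hY := hC.Y_pos
  exact abs_le.2 ⟨by linarith, h1⟩

lemma Collar.analyticAt (hC : Collar Ω Q Q₁ Y H) {z : ℂ} (hz : |z.im| ≤ Y) :
    AnalyticAt ℝ Q z := by
  have h : AnalyticAt ℂ Q z := Complex.analyticAt_iff_eventually_differentiableAt.2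
    ((hC.deriv z hz).mono fun w hw => hw.differentiableAt)
  exact h.restrictScalars

lemma Collar.analyticAt_comp (hC : Collar Ω Q Q₁ Y H) (hΦ : Adm Ω lam Φ) {z : ℂ}
    (h0 : 0 ≤ z.im) (h1 : z.im ≤ Y) : AnalyticAt ℝ (fun w => Φ (Q w)) z :=
  (hΦ.analytic _ (hC.mem_closure h0 h1)).comp (hC.analyticAt (hC.abs_im h0 h1))

lemma Collar.lapl_comp (hC : Collar Ω Q Q₁ Y H) (hΦ : Adm Ω lam Φ) {z : ℂ}
    (h0 : 0 ≤ z.im) (h1 : z.im ≤ Y) : lapl (fun w => Φ (Q w)) z =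
      -(lam : ℂ) ^ 2 * ((Complex.normSq (Q₁ z) : ℂ) * Φ (Q z)) := by
  have hm := hC.mem_closure h0 h1
  have hi := hC.abs_im h0 h1
  rw [NeumannNodal.lapl_comp (hΦ.analytic _ hm) (hC.deriv z hi) (hC.deriv₁ z hi).hasDerivAt,
    hΦ.eigen _ hm]
  ring

lemma Collar.periodic_comp (hC : Collar Ω Q Q₁ Y H) (Φ : ℂ → ℂ) :
    XPeriodic fun w => Φ (Q w) := fun z => by simp only [hC.periodic z]

lemma Collar.continuous_line₁ (hC : Collar Ω Q Q₁ Y H) (hy : |y| ≤ Y) :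
    Continuous fun x : ℝ => Q₁ (x + y * Complex.I) :=
  continuous_iff_continuousAt.2 fun x =>
    ContinuousAt.comp (f := fun x : ℝ => (x + y * Complex.I : ℂ))
      (hC.deriv₁ _ (by rwa [im_line])).continuousAt (by fun_prop)

lemma exp_abs_le_of_line {b : ℂ} {Y y : ℝ} (hy : |y| ≤ Y) (m : ℤ) :
    ‖b * Complex.exp (-(m * y : ℝ))‖ ≤ ‖b‖ * Real.exp (Y * |(m : ℝ)|) := by
  rw [norm_mul, Complex.norm_exp]
  gcongr
  rw [← Complex.ofReal_neg, Complex.ofReal_re]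
  calc -((m : ℝ) * y) ≤ |(m : ℝ) * y| := neg_le_abs _
    _ = |y| * |(m : ℝ)| := by rw [abs_mul, mul_comm]
    _ ≤ _ := by gcongr

/-- Multiplication by the conformal factor, on the level of Fourier coefficients. -/
lemma Collar.norm_fc_normSq_mul_le (hC : Collar Ω Q Q₁ Y H) (hy : |y| ≤ Y) {g : ℝ → ℂ}
    (hg : Continuous g) {A : ℝ} (hA : 0 ≤ A) {w : ℤ → ℝ}
    (hw : ∀ n m : ℤ, w (n - m) ≤ w n * Real.exp (Y * |(m : ℝ)|))
    (hfc : ∀ n, ‖fc g n‖ ≤ A * w n) (n : ℤ) :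
    ‖fc (fun x => (Complex.normSq (Q₁ (x + y * Complex.I)) : ℂ) * g x) n‖ ≤ A * H ^ 2 * w n := by
  obtain ⟨b, hb, hs⟩ := hC.series
  have hω : ∀ m : ℤ, 1 ≤ Real.exp (Y * |(m : ℝ)|) := fun m =>
    Real.one_le_exp (mul_nonneg hC.Y_pos.le (abs_nonneg _))
  have h1 : ∀ x : ℝ, HasSum (fun m : ℤ => (b m * Complex.exp (-(m * y : ℝ))) *
      Complex.exp (Complex.I * m * x)) (Q₁ (x + y * Complex.I)) := fun x => by
    refine hasSum_congr_of_eq (hs (x + y * Complex.I) (by rwa [im_line])) fun m => ?_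
    rw [mul_assoc, ← Complex.exp_add]
    congr 2
    push_cast
    linear_combination (-(m : ℂ) * y) * Complex.I_mul_I
  have h2 : ∀ x : ℝ, HasSum (fun m : ℤ =>
      ((starRingEnd ℂ) (b (-m) * Complex.exp (-((-m : ℤ) * y : ℝ)))) *
      Complex.exp (Complex.I * m * x)) ((starRingEnd ℂ) (Q₁ (x + y * Complex.I))) := fun x => by
    have h3 := (Complex.hasSum_conj'.2 (h1 x))
    have h4 := (Equiv.neg ℤ).hasSum_iff.2 h3
    refine hasSum_congr_of_eq h4 fun m => ?_
    simp only [Function.comp_apply, Equiv.neg_apply, map_mul, ← Complex.exp_conj]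
    congr 2
    simp
  have hg2 : Continuous fun x : ℝ => (starRingEnd ℂ) (Q₁ (x + y * Complex.I)) * g x :=
    (Complex.continuous_conj.comp (hC.continuous_line₁ hy)).mul hg
  have hb' : HasSum (fun m : ℤ => ‖b (-m)‖ * Real.exp (Y * |((-m : ℤ) : ℝ)|) *
      Real.exp (Y * |(m : ℝ)|)) H := by
    have h3 := (Equiv.neg ℤ).hasSum_iff.2 hb
    convert h3 using 2 with m
    simp
  have h5 := norm_fc_mul_le hg hA (β := fun m => ‖b (-m)‖ * Real.exp (Y * |((-m : ℤ) : ℝ)|))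
    (fun m => by
      rw [RCLike.norm_conj]; exact exp_abs_le_of_line hy (-m)) hω hw hb' h2 hfc
  have h6 := norm_fc_mul_le hg2 (mul_nonneg hA hC.H_pos.le)
    (fun m => exp_abs_le_of_line (b := b m) hy m) hω hw hb h1 h5 n
  calc _ = _ := by
        congr 2; ext x
        rw [← mul_assoc, Complex.mul_conj]
    _ ≤ _ := h6
    _ = _ := by ring

lemma line_coeff_ode (hC : Collar Ω Q Q₁ Y H) (hΦ : Adm Ω lam Φ) (n : ℤ) (hy : y ∈ Icc 0 Y) :
    HasDerivAt (lc (fun w => Φ (Q w)) n)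
      (lc (fun w => fderiv ℝ (fun w => Φ (Q w)) w Complex.I) n y) y ∧
    HasDerivAt (lc (fun w => fderiv ℝ (fun w => Φ (Q w)) w Complex.I) n)
      (((|(n : ℝ)| : ℝ) : ℂ) ^ 2 * lc (fun w => Φ (Q w)) n y +
        lc (lapl fun w => Φ (Q w)) n y) y := by
  have han : ∀ x : ℝ, AnalyticAt ℝ (fun w => Φ (Q w)) (x + y * Complex.I) := fun x =>
    hC.analyticAt_comp hΦ (by rw [im_line]; exact hy.1) (by rw [im_line]; exact hy.2)
  refine ⟨hasDerivAt_lc han n, ?_⟩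
  have h := hasDerivAt_lc_fderiv (hC.periodic_comp Φ) han n
  have h2 : ((|(n : ℝ)| : ℝ) : ℂ) ^ 2 = (n : ℂ) ^ 2 := by
    rw [← Complex.ofReal_pow, sq_abs]; push_cast; rfl
  rwa [h2]

lemma norm_lc_lapl_le (hC : Collar Ω Q Q₁ Y H) (hΦ : Adm Ω lam Φ) (hy : y ∈ Icc 0 Y)
    {A : ℝ} (hA : 0 ≤ A) {w : ℤ → ℝ}
    (hw : ∀ n m : ℤ, w (n - m) ≤ w n * Real.exp (Y * |(m : ℝ)|))
    (hfc : ∀ n, ‖lc (fun w => Φ (Q w)) n y‖ ≤ A * w n) (n : ℤ) :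
    ‖lc (lapl fun w => Φ (Q w)) n y‖ ≤ (lam * H) ^ 2 * (A * w n) := by
  have him0 : ∀ x : ℝ, 0 ≤ ((x : ℂ) + y * Complex.I).im := fun x => by rw [im_line]; exact hy.1
  have him1 : ∀ x : ℝ, ((x : ℂ) + y * Complex.I).im ≤ Y := fun x => by rw [im_line]; exact hy.2
  have h1 := hC.norm_fc_normSq_mul_le (y := y) (abs_le.2 ⟨by linarith [hC.Y_pos, hy.1], hy.2⟩)
    (continuous_line fun x => hC.analyticAt_comp hΦ (him0 x) (him1 x)) hA hw hfc n
  have h2 : lc (lapl fun w => Φ (Q w)) n y = -(lam : ℂ) ^ 2 *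
      fc (fun x => (Complex.normSq (Q₁ (x + y * Complex.I)) : ℂ) * Φ (Q (x + y * Complex.I))) n := by
    unfold lc fc
    rw [mul_smul_comm, ← intervalIntegral.integral_const_mul]
    congr 2; ext x
    beta_reduce
    rw [hC.lapl_comp hΦ (him0 x) (him1 x)]
    ring
  rw [h2, norm_mul, norm_neg, norm_pow, Complex.norm_real, Real.norm_eq_abs, sq_abs]
  calc _ ≤ lam ^ 2 * (A * H ^ 2 * w n) := by gcongr
    _ = _ := by ring

lemma norm_lc_le_one (hC : Collar Ω Q Q₁ Y H) (hΦ : Adm Ω lam Φ) (hy : y ∈ Icc 0 Y) (n : ℤ) :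
    ‖lc (fun w => Φ (Q w)) n y‖ ≤ 1 :=
  norm_fc_le (fun x => hΦ.bound _ (hC.mem_closure (by rw [im_line]; exact hy.1)
    (by rw [im_line]; exact hy.2))) n

lemma lc_fderiv_zero (hC : Collar Ω Q Q₁ Y H) (hΦ : Adm Ω lam Φ)
    (hN : ∀ x : ℝ, fderiv ℝ Φ (Q x) (Q₁ x * Complex.I) = 0) (n : ℤ) :
    lc (fun w => fderiv ℝ (fun w => Φ (Q w)) w Complex.I) n 0 = 0 := by
  have h : ∀ x : ℝ, fderiv ℝ (fun w => Φ (Q w)) (x + (0 : ℝ) * Complex.I) Complex.I = 0 := by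
    intro x
    have h0 : ((x : ℂ) + (0 : ℝ) * Complex.I) = x := by simp
    rw [h0]
    have hi : |(x : ℂ).im| ≤ Y := by simpa using hC.Y_pos.le
    have h1 := (hΦ.analytic _ (frontier_subset_closure (hC.maps_real x))).differentiableAt.hasFDerivAt.comp
      (x : ℂ) ((hC.deriv x hi).self_of_nhds.hasFDerivAt.restrictScalars ℝ)
    have h2 : fderiv ℝ (fun w => Φ (Q w)) (x : ℂ) = _ := h1.fderiv
    rw [h2]
    simpa [mul_comm] using hN x
  unfold lc fc
  simp only [h, mul_zero]
  simp

end Collar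

lemma min_abs_sub (n m : ℤ) (N : ℝ) : min |(n : ℝ)| N - |(m : ℝ)| ≤ min |((n - m : ℤ) : ℝ)| N := by
  have h : |(n : ℝ)| ≤ |((n - m : ℤ) : ℝ)| + |(m : ℝ)| := by
    have := abs_add_le (((n - m : ℤ) : ℝ)) (m : ℝ)
    push_cast at this ⊢
    simpa using this
  have := abs_nonneg (m : ℝ)
  rcases le_total |(n : ℝ)| N with h1 | h1 <;> rcases le_total |((n - m : ℤ) : ℝ)| N with h2 | h2 <;>
    simp only [h1, h2, min_eq_left, min_eq_right] <;> linarith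

lemma exp_weight_shift {t Y k k' m : ℝ} (ht : 0 ≤ t) (htY : t ≤ Y) (hm : 0 ≤ m)
    (h : k - m ≤ k') : Real.exp (-(k' * t)) ≤ Real.exp (-(k * t)) * Real.exp (Y * m) := by
  rw [← Real.exp_add]
  gcongr
  have h1 : (k - m) * t ≤ k' * t := by gcongr
  have h2 : m * t ≤ m * Y := by gcongr
  linarith

section Collar

variable {Ω : Set ℂ} {Q Q₁ : ℂ → ℂ} {Y H lam : ℝ} {Φ : ℂ → ℂ} {y : ℝ}

lemma norm_lc_le_trunc (hC : Collar Ω Q Q₁ Y H) (hlam : 0 < lam) (hΦ : Adm Ω lam Φ)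
    (hN : ∀ x : ℝ, fderiv ℝ Φ (Q x) (Q₁ x * Complex.I) = 0) {N : ℝ} (hN0 : 0 ≤ N) :
    ∀ n : ℤ, ∀ y ∈ Icc 0 Y, ‖lc (fun w => Φ (Q w)) n y‖ ≤
      2 * Real.exp (3 * (lam * H) * Y) * Real.exp (-(min |(n : ℝ)| N * ((Y - y) / 2))) := by
  set K := lam * H with hK
  have hK0 : 0 < K := mul_pos hlam hC.H_pos
  have hY := hC.Y_pos
  set B := 2 * Real.exp (3 * K * Y) with hB
  have hB2 : 2 ≤ B := by
    have := Real.one_le_exp (show 0 ≤ 3 * K * Y by positivity)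
    linarith
  refine improve_bound (P := fun A => ∀ n : ℤ, ∀ y ∈ Icc 0 Y, ‖lc (fun w => Φ (Q w)) n y‖ ≤
      A * Real.exp (-(min |(n : ℝ)| N * ((Y - y) / 2)))) (A₀ := B + Real.exp (N * Y / 2))
      (by linarith) ?_ ?_ (by linarith [Real.exp_pos (N * Y / 2)])
  · intro n y hy
    refine (norm_lc_le_one hC hΦ hy n).trans ?_
    have h1 : Real.exp (-(N * Y / 2)) ≤ Real.exp (-(min |(n : ℝ)| N * ((Y - y) / 2))) := by
      gcongr
      have h2 : min |(n : ℝ)| N * ((Y - y) / 2) ≤ N * (Y / 2) := by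
        gcongr
        · linarith [hy.2]
        · exact min_le_right _ _
        · linarith [hy.1]
      linarith
    calc (1 : ℝ) = Real.exp (N * Y / 2) * Real.exp (-(N * Y / 2)) := by
          rw [← Real.exp_add]; simp
      _ ≤ (B + Real.exp (N * Y / 2)) * Real.exp (-(min |(n : ℝ)| N * ((Y - y) / 2))) := by
          gcongr; linarith
  · intro A hA hP n
    set k := min |(n : ℝ)| N with hk
    have hk0 : 0 ≤ k := le_min (abs_nonneg _) hN0
    have hkn : k ≤ |(n : ℝ)| := min_le_left _ _
    have hg : ∀ y ∈ Icc 0 Y, ‖lc (lapl fun w => Φ (Q w)) n y‖ ≤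
        K ^ 2 * (A * Real.exp (-(k * ((Y - y) / 2)))) := fun y hy =>
      norm_lc_lapl_le hC hΦ hy (by linarith)
        (w := fun n : ℤ => Real.exp (-(min |(n : ℝ)| N * ((Y - y) / 2))))
        (fun n m => exp_weight_shift (by linarith [hy.2]) (by linarith [hy.1]) (abs_nonneg _)
          (min_abs_sub n m N)) (fun n => hP n y hy) n
    by_cases hn : |(n : ℝ)| < 3 * K
    · intro y hy
      refine (norm_lc_le_one hC hΦ hy n).trans ?_
      have h1 : Real.exp (-(3 * K * Y)) ≤ Real.exp (-(k * ((Y - y) / 2))) := by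
        have h2 : k * ((Y - y) / 2) ≤ 3 * K * Y := by
          gcongr
          · linarith [hy.2]
          · linarith
          · linarith [hy.1]
        exact Real.exp_le_exp.2 (neg_le_neg h2)
      calc (1 : ℝ) = Real.exp (3 * K * Y) * Real.exp (-(3 * K * Y)) := by
            rw [← Real.exp_add]; simp
        _ ≤ max B (A / 2) * Real.exp (-(k * ((Y - y) / 2))) := by
            gcongr
            refine le_max_of_le_left ?_
            linarith [Real.exp_pos (3 * K * Y)]
    · push Not at hn
      set A' := max 1 (A / 4) with hA'
      have hA'1 : 1 ≤ A' := le_max_left _ _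
      have hA'4 : A / 4 ≤ A' := le_max_right _ _
      have hb : ∀ y, HasDerivAt (fun y => A' * (Real.exp (-(k * ((Y - y) / 2))) +
          Real.exp (-(k * ((Y + y) / 2)))))
          (A' * (k / 2) * (Real.exp (-(k * ((Y - y) / 2))) - Real.exp (-(k * ((Y + y) / 2))))) y := by
        intro y
        have h1 : HasDerivAt (fun y => -(k * ((Y - y) / 2))) (-(k * ((0 - 1) / 2))) y :=
          ((((hasDerivAt_const y Y).sub (hasDerivAt_id y)).div_const 2).const_mul k).neg
        have h2 : HasDerivAt (fun y => -(k * ((Y + y) / 2))) (-(k * ((0 + 1) / 2))) y :=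
          ((((hasDerivAt_const y Y).add (hasDerivAt_id y)).div_const 2).const_mul k).neg
        refine ((h1.exp.add h2.exp).const_mul A').congr_deriv ?_
        ring
      have hb' : ∀ y, HasDerivAt (fun y => A' * (k / 2) * (Real.exp (-(k * ((Y - y) / 2))) -
          Real.exp (-(k * ((Y + y) / 2)))))
          (A' * (k / 2) ^ 2 * (Real.exp (-(k * ((Y - y) / 2))) +
            Real.exp (-(k * ((Y + y) / 2))))) y := by
        intro y
        have h1 : HasDerivAt (fun y => -(k * ((Y - y) / 2))) (-(k * ((0 - 1) / 2))) y :=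
          ((((hasDerivAt_const y Y).sub (hasDerivAt_id y)).div_const 2).const_mul k).neg
        have h2 : HasDerivAt (fun y => -(k * ((Y + y) / 2))) (-(k * ((0 + 1) / 2))) y :=
          ((((hasDerivAt_const y Y).add (hasDerivAt_id y)).div_const 2).const_mul k).neg
        refine ((h1.exp.sub h2.exp).const_mul (A' * (k / 2))).congr_deriv ?_
        ring
      have key := norm_le_of_boundary (abs_nonneg (n : ℝ)) (a := 0) (L := Y)
        (fun y hy => (line_coeff_ode hC hΦ n hy).1) (fun y hy => (line_coeff_ode hC hΦ n hy).2)
        (fun y _ => hb y) (fun y _ => hb' y)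
        (fun y hy => by
          refine (hg y hy).trans ?_
          have e1 := Real.exp_pos (-(k * ((Y - y) / 2)))
          have e2 := Real.exp_pos (-(k * ((Y + y) / 2)))
          set E1 := Real.exp (-(k * ((Y - y) / 2)))
          set E2 := Real.exp (-(k * ((Y + y) / 2)))
          have h1 : K ^ 2 ≤ |(n : ℝ)| ^ 2 / 9 := by nlinarith
          have h2 : k ^ 2 ≤ |(n : ℝ)| ^ 2 := by gcongr
          have h3 : 0 ≤ |(n : ℝ)| ^ 2 := by positivity
          have hA0 : 0 ≤ A := by linarith
          calc K ^ 2 * (A * E1) ≤ |(n : ℝ)| ^ 2 / 9 * (4 * A' * E1) := by gcongr; linarith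
            _ ≤ (3 / 4 * |(n : ℝ)| ^ 2) * (A' * E1) := by
              have : 0 ≤ |(n : ℝ)| ^ 2 * (A' * E1) := by positivity
              linarith
            _ ≤ (3 / 4 * |(n : ℝ)| ^ 2) * (A' * (E1 + E2)) := by gcongr; linarith
            _ ≤ (|(n : ℝ)| ^ 2 - k ^ 2 / 4) * (A' * (E1 + E2)) := by gcongr; linarith
            _ = _ := by ring)
        (Or.inr ⟨lc_fderiv_zero hC hΦ hN n, by simp⟩)
        ((norm_lc_le_one hC hΦ ⟨hY.le, le_rfl⟩ n).trans (by
          simp only [sub_self, zero_div, mul_zero, neg_zero, Real.exp_zero]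
          nlinarith [Real.exp_pos (-(k * ((Y + Y) / 2)))]))
      intro y hy
      refine (key y hy).trans ?_
      have h1 : Real.exp (-(k * ((Y + y) / 2))) ≤ Real.exp (-(k * ((Y - y) / 2))) := by
        gcongr
        · linarith [hy.1]
      calc _ ≤ A' * (Real.exp (-(k * ((Y - y) / 2))) + Real.exp (-(k * ((Y - y) / 2)))) := by
            gcongr
        _ = (2 * A') * Real.exp (-(k * ((Y - y) / 2))) := by ring
        _ ≤ _ := by
          gcongr
          rw [hA', mul_max_of_nonneg _ _ (by norm_num : (0 : ℝ) ≤ 2)]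
          refine max_le_max (by linarith) (by linarith)

/-- Exponential decay of the Fourier coefficients of an eigenfunction on collar lines. -/
lemma norm_lc_le_exp (hC : Collar Ω Q Q₁ Y H) (hlam : 0 < lam) (hΦ : Adm Ω lam Φ)
    (hN : ∀ x : ℝ, fderiv ℝ Φ (Q x) (Q₁ x * Complex.I) = 0) (n : ℤ) (hy : y ∈ Icc 0 Y) :
    ‖lc (fun w => Φ (Q w)) n y‖ ≤
      2 * Real.exp (3 * (lam * H) * Y) * Real.exp (-(|(n : ℝ)| * ((Y - y) / 2))) := by
  have h := norm_lc_le_trunc hC hlam hΦ hN (abs_nonneg (n : ℝ)) n y hy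
  rwa [min_self] at h

/-- If an eigenfunction is small on the boundary, then it is small near the boundary. -/
lemma norm_le_near_boundary (hC : Collar Ω Q Q₁ Y H) (hlam : 0 < lam) (hΦ : Adm Ω lam Φ)
    (hN : ∀ x : ℝ, fderiv ℝ Φ (Q x) (Q₁ x * Complex.I) = 0) {δ : ℝ} (hδ : 0 < δ)
    (hb : ∀ x : ℝ, ‖Φ (Q x)‖ ≤ δ) {z : ℂ} (hz0 : 0 ≤ z.im) (hz1 : z.im ≤ Y / 8) :
    ‖Φ (Q z)‖ ≤ 2 * expSum (Y / 8) * Real.exp (5 * (lam * H) * Y) * δ ^ (1 / 2 : ℝ) := by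
  set K := lam * H with hK
  have hK0 : 0 < K := mul_pos hlam hC.H_pos
  have hY := hC.Y_pos
  set D := 2 * Real.exp (3 * K * Y) * δ ^ (1 / 2 : ℝ) with hD
  have hδ2 : 0 < δ ^ (1 / 2 : ℝ) := Real.rpow_pos_of_pos hδ _
  have hD0 : 0 < D := by positivity
  have he3 := Real.one_le_exp (show 0 ≤ 3 * K * Y by positivity)
  have hc0 : ∀ n : ℤ, ‖lc (fun w => Φ (Q w)) n 0‖ ≤ D * Real.exp (-(|(n : ℝ)| * (Y / 4))) := by
    intro n
    have h1 : ‖lc (fun w => Φ (Q w)) n 0‖ ≤ δ := norm_fc_le (fun x => by simpa using hb x) n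
    have h2 := norm_lc_le_exp hC hlam hΦ hN n (y := 0) ⟨le_rfl, hY.le⟩
    refine abs_le_of_sq_le_sq' (a := ‖lc (fun w => Φ (Q w)) n 0‖) ?_ (by positivity) |>.2
    have h3 : (δ ^ (1 / 2 : ℝ)) ^ 2 = δ := by
      rw [← Real.rpow_natCast, ← Real.rpow_mul hδ.le]; norm_num
    have h4 : Real.exp (-(|(n : ℝ)| * (Y / 4))) ^ 2 = Real.exp (-(|(n : ℝ)| * ((Y - 0) / 2))) := by
      rw [← Real.exp_nat_mul]; congr 1; push_cast; ring
    rw [hD, mul_pow, mul_pow, h3, h4]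
    set e := 2 * Real.exp (3 * K * Y)
    calc _ = ‖lc (fun w => Φ (Q w)) n 0‖ * ‖lc (fun w => Φ (Q w)) n 0‖ := sq _
      _ ≤ δ * (e * Real.exp (-(|(n : ℝ)| * ((Y - 0) / 2)))) := by gcongr
      _ ≤ δ * (e ^ 2 * Real.exp (-(|(n : ℝ)| * ((Y - 0) / 2)))) := by
          gcongr
          nlinarith
      _ = _ := by ring
  have key := norm_le_of_coupled (ι := ℤ) (c := lc fun w => Φ (Q w))
    (c' := lc (fun w => fderiv ℝ (fun w => Φ (Q w)) w Complex.I))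
    (g := lc (lapl fun w => Φ (Q w))) (ν := fun n => |(n : ℝ)|)
    (w := fun n => Real.exp (-(|(n : ℝ)| * (Y / 4)))) (Λ := 2 * K) (D := D)
    (A₀ := 2 * Real.exp (3 * K * Y)) (L := Y / 8)
    (fun n => abs_nonneg _) (fun n => Real.exp_pos _) (by positivity) hD0
    (fun n y hy => (line_coeff_ode hC hΦ n ⟨hy.1, by linarith [hy.2]⟩).1)
    (fun n y hy => (line_coeff_ode hC hΦ n ⟨hy.1, by linarith [hy.2]⟩).2)
    (fun A hA y hy hle n => by
      have h1 := norm_lc_lapl_le hC hΦ (y := y) ⟨hy.1, by linarith [hy.2]⟩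
        (A := A * Real.exp (2 * K * y)) (by positivity)
        (w := fun n : ℤ => Real.exp (-(|(n : ℝ)| * (Y / 4 - y))))
        (fun n m => exp_weight_shift (by linarith [hy.2]) (by linarith [hy.1]) (abs_nonneg _)
          (by
            have := abs_add_le (((n - m : ℤ) : ℝ)) (m : ℝ)
            push_cast at this ⊢
            rw [sub_add_cancel] at this; linarith))
        (fun n => (hle n).trans (le_of_eq (by
          rw [mul_assoc, ← Real.exp_add, ← Real.exp_add]; congr 2; ring))) n
      refine h1.trans ?_
      have h2 : A * Real.exp (2 * K * y) * Real.exp (-(|(n : ℝ)| * (Y / 4 - y))) =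
          A * (Real.exp (-(|(n : ℝ)| * (Y / 4))) * Real.exp ((2 * K + |(n : ℝ)|) * y)) := by
        rw [mul_assoc, ← Real.exp_add, ← Real.exp_add]; congr 2; ring
      rw [h2]
      have h3 : 0 ≤ A * (Real.exp (-(|(n : ℝ)| * (Y / 4))) * Real.exp ((2 * K + |(n : ℝ)|) * y)) := by
        positivity
      nlinarith [mul_nonneg (sq_nonneg K) h3])
    (fun n y hy => by
      refine (norm_lc_le_exp hC hlam hΦ hN n ⟨hy.1, by linarith [hy.2]⟩).trans ?_
      rw [← Real.exp_add]
      gcongr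
      have := abs_nonneg (n : ℝ)
      have h1 : 0 ≤ |(n : ℝ)| * (Y / 4 - y / 2) := mul_nonneg this (by linarith [hy.2])
      have h2 : 0 ≤ 2 * K * y := by have := hy.1; positivity
      have h3 : 0 ≤ |(n : ℝ)| * y := mul_nonneg this hy.1
      nlinarith)
    hc0
    (fun n => by
      rw [lc_fderiv_zero hC hΦ hN n, norm_zero]; positivity)
  have hy : z.im ∈ Icc 0 (Y / 8) := ⟨hz0, hz1⟩
  have h1 : ∀ n : ℤ, ‖fc (fun x : ℝ => Φ (Q (x + z.im * Complex.I))) n‖ ≤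
      (D * Real.exp (2 * K * Y)) * Real.exp (-(Y / 8 * |(n : ℝ)|)) := fun n => by
    refine (key n z.im hy).trans ?_
    rw [mul_assoc D, ← Real.exp_add, ← Real.exp_add]
    refine mul_le_mul_of_nonneg_left (Real.exp_le_exp.2 ?_) hD0.le
    have h2 : 0 ≤ |(n : ℝ)| * (Y / 8 - z.im) := mul_nonneg (abs_nonneg _) (by linarith)
    have h3 : 2 * K * z.im ≤ 2 * K * Y := by gcongr; linarith
    linarith
  have hY8 : 0 < Y / 8 := by positivity
  have han : ∀ x : ℝ, AnalyticAt ℝ (fun w => Φ (Q w)) (x + z.im * Complex.I) := fun x =>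
    hC.analyticAt_comp hΦ (by rw [im_line]; exact hz0) (by rw [im_line]; linarith)
  have h2 := norm_le_of_fc (continuous_line han) ((hC.periodic_comp Φ).line z.im) h1
    ((hasSum_expSum hY8).mul_left _) z.re
  rw [Complex.re_add_im] at h2
  refine h2.trans (le_of_eq ?_)
  rw [hD, show 5 * K * Y = 3 * K * Y + 2 * K * Y by ring, Real.exp_add]
  ring

end Collar

lemma norm_cosh_sq (w : ℂ) :
    ‖Complex.cosh w‖ ^ 2 = Real.sinh w.re ^ 2 + Real.cos w.im ^ 2 := by
  have h : Complex.cosh w = (Real.cosh w.re * Real.cos w.im : ℝ) +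
      (Real.sinh w.re * Real.sin w.im : ℝ) * Complex.I := by
    conv_lhs => rw [← Complex.re_add_im w]
    rw [Complex.cosh_add, Complex.cosh_mul_I, Complex.sinh_mul_I]
    push_cast; ring
  rw [h, ← Complex.normSq_eq_norm_sq, Complex.normSq_add_mul_I]
  nlinarith [Real.cosh_sq w.re, Real.sin_sq_add_cos_sq w.im]

lemma norm_sinh_sq (w : ℂ) :
    ‖Complex.sinh w‖ ^ 2 = Real.sinh w.re ^ 2 + Real.sin w.im ^ 2 := by
  have h : Complex.sinh w = (Real.sinh w.re * Real.cos w.im : ℝ) +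
      (Real.cosh w.re * Real.sin w.im : ℝ) * Complex.I := by
    conv_lhs => rw [← Complex.re_add_im w]
    rw [Complex.sinh_add, Complex.cosh_mul_I, Complex.sinh_mul_I]
    push_cast; ring
  rw [h, ← Complex.normSq_eq_norm_sq, Complex.normSq_add_mul_I]
  nlinarith [Real.cosh_sq w.re, Real.sin_sq_add_cos_sq w.im]

/-- Dividing out a real zero of a bounded holomorphic function on a strip. -/
lemma exists_blaschke_quotient {F : ℂ → ℂ} {ε ε' M a : ℝ} (hε : 0 < ε) (h1 : ε < ε')
    (h2 : ε' < 2 * ε) (hF : DifferentiableOn ℂ F {z | |z.im| < ε'})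
    (hM : ∀ z : ℂ, |z.im| ≤ ε → ‖F z‖ ≤ M) (ha : F a = 0) :
    ∃ G : ℂ → ℂ, DifferentiableOn ℂ G {z | |z.im| < ε'} ∧
      (∀ z : ℂ, |z.im| ≤ ε → ‖G z‖ ≤ M) ∧
      ∀ z : ℂ, |z.im| < ε' → F z = Complex.tanh ((π / (4 * ε) : ℝ) * (z - a)) * G z := by
  set κ : ℝ := π / (4 * ε) with hκ
  have hκ0 : 0 < κ := by positivity
  have hκε : κ * ε = π / 4 := by rw [hκ]; field_simp
  set U : Set ℂ := {z | |z.im| < ε'} with hU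
  have hUo : IsOpen U := isOpen_strip ε'
  have haU : (a : ℂ) ∈ U := by simp [hU]; linarith
  have him : ∀ z : ℂ, ((κ : ℂ) * (z - a)).im = κ * z.im := fun z => by simp
  have hre : ∀ z : ℂ, ((κ : ℂ) * (z - a)).re = κ * (z.re - a) := fun z => by simp
  have hcosim : ∀ z ∈ U, 0 < Real.cos (κ * z.im) := fun z hz => by
    have h3 : |κ * z.im| < π / 2 := by
      rw [abs_mul, abs_of_pos hκ0]
      calc κ * |z.im| < κ * (2 * ε) := by
            have := lt_trans (show |z.im| < ε' from hz) h2
            gcongr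
        _ = π / 2 := by linarith
    exact Real.cos_pos_of_mem_Ioo (abs_lt.1 h3)
  have hcosh : ∀ z ∈ U, Complex.cosh (κ * (z - a)) ≠ 0 := fun z hz h => by
    have h3 := norm_cosh_sq (κ * (z - a))
    rw [h, him, norm_zero] at h3
    nlinarith [hcosim z hz, sq_nonneg (Real.sinh ((κ : ℂ) * (z - a)).re)]
  set T : ℂ → ℂ := fun z => Complex.tanh (κ * (z - a)) with hT
  have hTe : T = fun z => Complex.sinh (κ * (z - a)) / Complex.cosh (κ * (z - a)) := by
    exact funext fun z => Complex.tanh_eq_sinh_div_cosh _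
  have hTd : DifferentiableOn ℂ T U := by
    rw [hTe]
    exact DifferentiableOn.div (by fun_prop) (by fun_prop) hcosh
  have hTa : T a = 0 := by simp [hT]
  have hTn : ∀ z ∈ U, ‖T z‖ ^ 2 = (Real.sinh (κ * (z.re - a)) ^ 2 + Real.sin (κ * z.im) ^ 2) /
      (Real.sinh (κ * (z.re - a)) ^ 2 + Real.cos (κ * z.im) ^ 2) := fun z _ => by
    rw [hTe]
    simp only
    rw [norm_div, div_pow, norm_sinh_sq, norm_cosh_sq, him, hre]
  have hT0 : ∀ z ∈ U, z ≠ a → T z ≠ 0 := by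
    intro z hz hza h
    have h3 := hTn z hz
    have h4 := hcosim z hz
    rw [h, norm_zero, eq_comm, zero_pow two_ne_zero, div_eq_zero_iff] at h3
    have h5 : Real.sinh (κ * (z.re - a)) ^ 2 + Real.sin (κ * z.im) ^ 2 = 0 :=
      h3.resolve_right (by positivity)
    have h6 : Real.sinh (κ * (z.re - a)) = 0 := by nlinarith [sq_nonneg (Real.sin (κ * z.im))]
    have h7 : Real.sin (κ * z.im) = 0 := by nlinarith [sq_nonneg (Real.sinh (κ * (z.re - a)))]
    have h8 : z.re = a := by
      rw [Real.sinh_eq_zero] at h6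
      have := (mul_eq_zero.1 h6).resolve_left hκ0.ne'
      linarith
    have h9 : z.im = 0 := by
      have h10 : |κ * z.im| < π := by
        rw [abs_mul, abs_of_pos hκ0]
        have : κ * |z.im| < κ * (2 * ε) := by
          have := lt_trans (show |z.im| < ε' from hz) h2
          gcongr
        linarith [Real.pi_pos]
      have h11 := (Real.sin_eq_zero_iff_of_lt_of_lt (abs_lt.1 h10).1 (abs_lt.1 h10).2).1 h7
      exact (mul_eq_zero.1 h11).resolve_left hκ0.ne'
    exact hza (by apply Complex.ext <;> simp [h8, h9])
  have hTda : HasDerivAt T κ a := by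
    have e1 : HasDerivAt (fun z : ℂ => (κ : ℂ) * (z - a)) (κ * 1) (a : ℂ) :=
      ((hasDerivAt_id (a : ℂ)).sub_const _).const_mul _
    have e2 := e1.csinh.div e1.ccosh (hcosh a haU)
    rw [hTe]
    refine e2.congr_deriv ?_
    simp
  have hds : ∀ z ∈ U, dslope T a z ≠ 0 := by
    intro z hz
    by_cases hza : z = a
    · rw [hza, dslope_same, hTda.deriv]; exact_mod_cast hκ0.ne'
    · rw [dslope_of_ne _ hza, slope_def_field, hTa, sub_zero]
      exact div_ne_zero (hT0 z hz hza) (sub_ne_zero.2 hza)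
  set G : ℂ → ℂ := fun z => dslope F a z / dslope T a z with hG
  have hGd : DifferentiableOn ℂ G U :=
    ((Complex.differentiableOn_dslope (hUo.mem_nhds haU)).2 hF).div
      ((Complex.differentiableOn_dslope (hUo.mem_nhds haU)).2 hTd) hds
  have hFG : ∀ z ∈ U, F z = T z * G z := by
    intro z hz
    have e1 := sub_smul_dslope F (a : ℂ) z
    have e2 := sub_smul_dslope T (a : ℂ) z
    rw [ha, sub_zero, smul_eq_mul] at e1
    rw [hTa, sub_zero, smul_eq_mul] at e2
    rw [← e1, ← e2, hG]
    have := hds z hz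
    field_simp
  have hM0 : 0 ≤ M := (norm_nonneg _).trans (hM 0 (by simpa using hε.le))
  refine ⟨G, hGd, ?_, hFG⟩
  have hsub : ∀ z : ℂ, |z.im| ≤ ε → z ∈ U := fun z hz => lt_of_le_of_lt hz h1
  have hline : ∀ z : ℂ, |z.im| = ε → ‖G z‖ ≤ M := by
    intro z hz
    have hzU := hsub z hz.le
    have e1 := hTn z hzU
    have hc := hcosim z hzU
    have e2 : Real.sin (κ * z.im) ^ 2 = Real.cos (κ * z.im) ^ 2 := by
      rcases abs_eq hε.le |>.1 hz with h | h <;> rw [h]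
      · rw [hκε, Real.sin_pi_div_four, Real.cos_pi_div_four]
      · rw [mul_neg, hκε, Real.sin_neg, Real.cos_neg, Real.sin_pi_div_four, Real.cos_pi_div_four]
        ring
    rw [e2, div_self (by positivity)] at e1
    have e3 : ‖T z‖ = 1 := by nlinarith [norm_nonneg (T z)]
    have e4 := hM z hz.le
    rw [hFG z hzU, norm_mul, e3, one_mul] at e4
    exact e4
  have hbdd : ∃ C, ∀ z : ℂ, |z.im| ≤ ε → ‖G z‖ ≤ C := by
    have hK : IsCompact (Icc (a - 1) (a + 1) ×ℂ Icc (-ε) ε) := isCompact_Icc.reProdIm isCompact_Icc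
    have hKU : (Icc (a - 1) (a + 1) ×ℂ Icc (-ε) ε) ⊆ U := fun z hz => hsub z (abs_le.2 hz.2)
    obtain ⟨C, hC⟩ := hK.exists_bound_of_continuousOn (hGd.continuousOn.mono hKU)
    set s := Real.sinh κ with hs
    have hs0 : 0 < s := Real.sinh_pos_iff.2 hκ0
    refine ⟨max C (M * Real.sqrt ((s ^ 2 + 1) / s ^ 2)), fun z hz => ?_⟩
    by_cases hzK : z ∈ Icc (a - 1) (a + 1) ×ℂ Icc (-ε) ε
    · exact le_max_of_le_left (hC z hzK)
    · refine le_max_of_le_right ?_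
      have hzU := hsub z hz
      have hx : 1 ≤ |z.re - a| := by
        by_contra hx
        push Not at hx
        have := abs_lt.1 hx
        exact hzK ⟨⟨by linarith, by linarith⟩, abs_le.1 hz⟩
      have e0 : s ^ 2 ≤ Real.sinh (κ * (z.re - a)) ^ 2 := by
        rw [← sq_abs (Real.sinh (κ * (z.re - a))), Real.abs_sinh, abs_mul, abs_of_pos hκ0]
        gcongr
        refine Real.sinh_le_sinh.2 ?_
        nlinarith
      have hc := hcosim z hzU
      have e1 : s ^ 2 / (s ^ 2 + 1) ≤ ‖T z‖ ^ 2 := by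
        rw [hTn z hzU, div_le_div_iff₀ (by positivity) (by positivity)]
        nlinarith [Real.sin_sq_add_cos_sq (κ * z.im), sq_nonneg (Real.sin (κ * z.im)), sq_nonneg s]
      have e2 : Real.sqrt (s ^ 2 / (s ^ 2 + 1)) ≤ ‖T z‖ := by
        rw [← Real.sqrt_sq (norm_nonneg (T z))]; exact Real.sqrt_le_sqrt e1
      have e3 : Real.sqrt (s ^ 2 / (s ^ 2 + 1)) * Real.sqrt ((s ^ 2 + 1) / s ^ 2) = 1 := by
        rw [← Real.sqrt_mul (by positivity), Real.sqrt_eq_one]; field_simp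
      have e4 := hM z hz
      rw [hFG z hzU, norm_mul] at e4
      calc ‖G z‖ = (Real.sqrt (s ^ 2 / (s ^ 2 + 1)) * ‖G z‖) * Real.sqrt ((s ^ 2 + 1) / s ^ 2) := by
            linear_combination -‖G z‖ * e3
        _ ≤ (‖T z‖ * ‖G z‖) * Real.sqrt ((s ^ 2 + 1) / s ^ 2) := by gcongr
        _ ≤ _ := by gcongr
  obtain ⟨C, hC⟩ := hbdd
  intro z hz
  have hcl : closure (Complex.im ⁻¹' Ioo (-ε) ε) ⊆ U := by
    have : closure (Complex.im ⁻¹' Ioo (-ε) ε) ⊆ Complex.im ⁻¹' Icc (-ε) ε :=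
      closure_minimal (preimage_mono Ioo_subset_Icc_self) (isClosed_Icc.preimage Complex.continuous_im)
    exact fun w hw => hsub w (abs_le.2 (this hw))
  refine PhragmenLindelof.horizontal_strip (a := -ε) (b := ε) (f := G) (C := M) (z := z)
    ((hGd.mono hcl).diffContOnCl) ⟨0, div_pos Real.pi_pos (by linarith), 0, ?_⟩ ?_ ?_
    (abs_le.1 hz).1 (abs_le.1 hz).2
  · refine Asymptotics.IsBigO.of_bound C ?_
    rw [eventually_inf_principal]
    refine Eventually.of_forall fun w hw => ?_
    simp only [zero_mul, Real.exp_zero, norm_one, mul_one]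
    exact hC w (abs_le.2 ⟨hw.1.le, hw.2.le⟩)
  · intro w hw
    exact hline w (by rw [hw, abs_neg, abs_of_pos hε])
  · intro w hw
    exact hline w (by rw [hw, abs_of_pos hε])

lemma tanh_le_tanh {u v : ℝ} (h : u ≤ v) : Real.tanh u ≤ Real.tanh v := by
  rw [← Real.artanh_le_artanh_iff ⟨Real.neg_one_lt_tanh u, Real.tanh_lt_one u⟩
    ⟨Real.neg_one_lt_tanh v, Real.tanh_lt_one v⟩, Real.artanh_tanh, Real.artanh_tanh]
  exact h

lemma norm_le_of_zeros {F : ℂ → ℂ} {ε ε' M L : ℝ} (hε : 0 < ε) (h1 : ε < ε')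
    (h2 : ε' < 2 * ε) (hF : DifferentiableOn ℂ F {z | |z.im| < ε'})
    (hM : ∀ z : ℂ, |z.im| ≤ ε → ‖F z‖ ≤ M) (T : Finset ℝ) (hT : ∀ a ∈ T, F a = 0) {x : ℝ}
    (hL : ∀ a ∈ T, |x - a| ≤ L) :
    ‖F x‖ ≤ M * Real.tanh (π / (4 * ε) * L) ^ T.card := by
  induction T using Finset.induction_on generalizing F with
  | empty => simpa using hM x (by simpa using hε.le)
  | insert a s has ih =>
    obtain ⟨G, hG, hGM, hFG⟩ := exists_blaschke_quotient hε h1 h2 hF hM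
      (hT a (Finset.mem_insert_self _ _))
    have hre : ∀ b : ℝ, |(b : ℂ).im| < ε' := fun b => by simp; linarith
    have htanh : ∀ b c : ℝ, Complex.tanh ((π / (4 * ε) : ℝ) * ((b : ℂ) - c)) =
        (Real.tanh (π / (4 * ε) * (b - c)) : ℝ) := fun b c => by
      push_cast; rfl
    have h3 := ih hG hGM (fun b hb => by
      have h4 := hT b (Finset.mem_insert_of_mem hb)
      rw [hFG b (hre b), htanh] at h4
      refine (mul_eq_zero.1 h4).resolve_left ?_
      intro h5
      rw [Complex.ofReal_eq_zero] at h5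
      have h6 : (π / (4 * ε) * (b - a)) = 0 := by
        rwa [Real.tanh_eq_sinh_div_cosh, div_eq_zero_iff, or_iff_left (Real.cosh_pos _).ne',
          Real.sinh_eq_zero] at h5
      have h7 : b - a = 0 := (mul_eq_zero.1 h6).resolve_left (by positivity)
      exact has ((sub_eq_zero.1 h7) ▸ hb))
      (fun b hb => hL b (Finset.mem_insert_of_mem hb))
    rw [hFG x (hre x), htanh, norm_mul, Finset.card_insert_of_notMem has, pow_succ,
      Complex.norm_real, Real.norm_eq_abs]
    have h8 : |Real.tanh (π / (4 * ε) * (x - a))| ≤ Real.tanh (π / (4 * ε) * L) := by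
      have h9 := abs_le.1 (hL a (Finset.mem_insert_self _ _))
      have h10 : 0 < π / (4 * ε) := by positivity
      rw [abs_le, ← Real.tanh_neg]
      exact ⟨tanh_le_tanh (by nlinarith), tanh_le_tanh (by nlinarith)⟩
    calc _ ≤ Real.tanh (π / (4 * ε) * L) * (M * Real.tanh (π / (4 * ε) * L) ^ s.card) :=
          mul_le_mul h8 h3 (norm_nonneg _) ((abs_nonneg _).trans h8)
      _ = _ := by ring

section Count

variable {Ω : Set ℂ} {Q Q₁ : ℂ → ℂ} {Y H lam : ℝ} {Φ : ℂ → ℂ}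

lemma le_pow_card_of_zeros (hC : Collar Ω Q Q₁ Y H) (hlam : 0 < lam) (hΦ : Adm Ω lam Φ)
    (hN : ∀ x : ℝ, fderiv ℝ Φ (Q x) (Q₁ x * Complex.I) = 0) (T : Finset ℝ)
    (hT : ∀ a ∈ T, Φ (Q a) = 0) {x L : ℝ} (hL : ∀ a ∈ T, |x - a| ≤ L) :
    ‖Φ (Q x)‖ ≤ 2 * Real.exp (3 * (lam * H) * Y) * expSum (Y / 4) *
      Real.tanh (π / Y * L) ^ T.card := by
  have hY := hC.Y_pos
  set a : ℤ → ℂ := fun n => lc (fun w => Φ (Q w)) n 0 with ha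
  set B := 2 * Real.exp (3 * (lam * H) * Y) with hB
  have hB0 : 0 ≤ B := by positivity
  have hab : ∀ n : ℤ, ‖a n‖ ≤ B * Real.exp (-(Y / 2 * |(n : ℝ)|)) := fun n => by
    refine (norm_lc_le_exp hC hlam hΦ hN n ⟨le_rfl, hY.le⟩).trans_eq ?_
    rw [hB]; congr 2; ring
  have hcont : Continuous fun x : ℝ => Φ (Q (x + (0 : ℝ) * Complex.I)) :=
    continuous_line (G := fun w => Φ (Q w)) fun x => hC.analyticAt_comp hΦ (by rw [im_line])
      (by rw [im_line]; exact hY.le)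
  have hFΦ : ∀ x : ℝ, fser a x = Φ (Q x) := fun x => by
    have h1 := fc_hasSum hcont ((hC.periodic_comp Φ).line 0)
      (((hasSum_expSum (c := Y / 2) (by positivity)).summable.mul_left B).of_nonneg_of_le
        (fun _ => norm_nonneg _) hab) x
    simp only [Complex.ofReal_zero, zero_mul, add_zero] at h1
    refine HasSum.tsum_eq ?_
    convert h1 using 5
    simp [a, lc]
  have h := norm_le_of_zeros (F := fser a) (ε := Y / 4) (ε' := 3 * Y / 8)
    (M := B * expSum (Y / 4)) (by positivity) (by linarith) (by linarith)
    (fun z hz => (fser_hasDerivAt hab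
      (lt_trans (show |z.im| < 3 * Y / 8 from hz)
        (by linarith))).differentiableAt.differentiableWithinAt)
    (fun z hz => by
      have := norm_fser_le hab (s := Y / 4) (by linarith) hz
      rwa [show Y / 2 - Y / 4 = Y / 4 by ring] at this)
    T (fun a ha => by rw [hFΦ, hT a ha]) hL
  rwa [hFΦ, show π / (4 * (Y / 4)) = π / Y by rw [mul_div_cancel₀ Y four_ne_zero]] at h

end Count

/-- Polar coordinates around `p`; the height is the logarithmic distance to the circle of
radius `R`. -/
def polar (p : ℂ) (R : ℝ) (w : ℂ) : ℂ := p + R * Complex.exp (Complex.I * w)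

lemma norm_polar_sub {p : ℂ} {R : ℝ} (hR : 0 ≤ R) (w : ℂ) :
    ‖polar p R w - p‖ = R * Real.exp (-w.im) := by
  simp [polar, Complex.norm_exp, abs_of_nonneg hR]

lemma exists_polar {p : ℂ} {R : ℝ} (hR : 0 < R) {z : ℂ} (hz : z ≠ p) :
    ∃ x y : ℝ, polar p R (x + y * Complex.I) = z := by
  have h : (z - p) / R ≠ 0 := div_ne_zero (sub_ne_zero.2 hz) (by exact_mod_cast hR.ne')
  set w := -Complex.I * Complex.log ((z - p) / R) with hw
  refine ⟨w.re, w.im, ?_⟩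
  rw [Complex.re_add_im, polar, hw,
    show Complex.I * (-Complex.I * Complex.log ((z - p) / R)) = Complex.log ((z - p) / R) by
      linear_combination -Complex.log ((z - p) / R) * Complex.I_mul_I, Complex.exp_log h]
  have : (R : ℂ) ≠ 0 := by exact_mod_cast hR.ne'
  field_simp
  ring

lemma xPeriodic_polar (Φ : ℂ → ℂ) (p : ℂ) (R : ℝ) : XPeriodic fun w => Φ (polar p R w) := by
  intro z
  have : Complex.exp (Complex.I * (z + 2 * π)) = Complex.exp (Complex.I * z) := by
    rw [show Complex.I * (z + 2 * π) = Complex.I * z + 2 * π * Complex.I by ring,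
      Complex.exp_add, Complex.exp_two_pi_mul_I, mul_one]
  simp only [polar, this]

section Polar

variable {Ω : Set ℂ} {lam R y : ℝ} {Φ : ℂ → ℂ} {p : ℂ}

lemma polar_mem (hR : 0 < R) (hB : Metric.closedBall p R ⊆ Ω) {w : ℂ} (hw : 0 ≤ w.im) :
    polar p R w ∈ Ω := by
  apply hB
  rw [Metric.mem_closedBall, dist_eq_norm, norm_polar_sub hR.le]
  exact mul_le_of_le_one_right hR.le (Real.exp_le_one_iff.2 (by linarith))

lemma analyticAt_polar (w : ℂ) : AnalyticAt ℝ (polar p R) w := by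
  have h : AnalyticAt ℂ (polar p R) w := by unfold polar; fun_prop
  exact h.restrictScalars

lemma analyticAt_polar_comp (hΦ : Adm Ω lam Φ) (hR : 0 < R) (hB : Metric.closedBall p R ⊆ Ω)
    {w : ℂ} (hw : 0 ≤ w.im) : AnalyticAt ℝ (fun w => Φ (polar p R w)) w :=
  (hΦ.analytic _ (subset_closure (polar_mem hR hB hw))).comp (analyticAt_polar w)

lemma lapl_polar_comp (hΦ : Adm Ω lam Φ) (hR : 0 < R) (hB : Metric.closedBall p R ⊆ Ω)
    {w : ℂ} (hw : 0 ≤ w.im) : lapl (fun w => Φ (polar p R w)) w =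
      ((-(lam * R * Real.exp (-w.im)) ^ 2 : ℝ) : ℂ) * Φ (polar p R w) := by
  have hm := subset_closure (polar_mem hR hB hw)
  have h1 : ∀ z, HasDerivAt (polar p R) (R * (Complex.exp (Complex.I * z) * Complex.I)) z :=
    fun z => ((((hasDerivAt_id z).const_mul Complex.I).cexp.const_mul (R : ℂ)).const_add
      p).congr_deriv (by simp)
  have h2 : DifferentiableAt ℂ (fun z => (R : ℂ) * (Complex.exp (Complex.I * z) * Complex.I)) w := by
    fun_prop
  rw [lapl_comp (hΦ.analytic _ hm) (Eventually.of_forall h1) h2.hasDerivAt, hΦ.eigen _ hm,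
    Complex.normSq_eq_norm_sq]
  simp only [norm_mul, Complex.norm_I, Complex.norm_exp, Complex.norm_real, Real.norm_eq_abs,
    mul_one]
  rw [show (Complex.I * w).re = -w.im by simp, mul_pow, sq_abs]
  push_cast
  ring

lemma polar_line_analytic (hΦ : Adm Ω lam Φ) (hR : 0 < R) (hB : Metric.closedBall p R ⊆ Ω)
    (hy : 0 ≤ y) (x : ℝ) :
    AnalyticAt ℝ (fun w => Φ (polar p R w)) (x + y * Complex.I) :=
  analyticAt_polar_comp hΦ hR hB (by rwa [im_line])

lemma fc_const_mul (a : ℂ) (g : ℝ → ℂ) (n : ℤ) : fc (fun x => a * g x) n = a * fc g n := by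
  unfold fc
  rw [mul_smul_comm, ← intervalIntegral.integral_const_mul]
  congr 2; ext x; ring

/-- The Bessel equation, in logarithmic coordinates. -/
lemma polar_coeff_ode (hΦ : Adm Ω lam Φ) (hR : 0 < R) (hB : Metric.closedBall p R ⊆ Ω)
    (n : ℤ) (hy : 0 ≤ y) :
    HasDerivAt (lc (fun w => Φ (polar p R w)) n)
      (lc (fun w => fderiv ℝ (fun w => Φ (polar p R w)) w Complex.I) n y) y ∧
    HasDerivAt (lc (fun w => fderiv ℝ (fun w => Φ (polar p R w)) w Complex.I) n)
      ((((n : ℝ) ^ 2 - (lam * R * Real.exp (-y)) ^ 2 : ℝ) : ℂ) *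
        lc (fun w => Φ (polar p R w)) n y) y := by
  have han := polar_line_analytic hΦ hR hB hy
  refine ⟨hasDerivAt_lc han n, ?_⟩
  refine (hasDerivAt_lc_fderiv (xPeriodic_polar Φ p R) han n).congr_deriv ?_
  have h2 : lc (lapl fun w => Φ (polar p R w)) n y =
      ((-(lam * R * Real.exp (-y)) ^ 2 : ℝ) : ℂ) * lc (fun w => Φ (polar p R w)) n y := by
    unfold lc
    rw [← fc_const_mul]
    congr 1; ext x
    rw [lapl_polar_comp hΦ hR hB (by rwa [im_line]), im_line]
  rw [h2]
  push_cast
  ring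

lemma norm_polar_coeff_le_one (hΦ : Adm Ω lam Φ) (hR : 0 < R) (hB : Metric.closedBall p R ⊆ Ω)
    (n : ℤ) (hy : 0 ≤ y) : ‖lc (fun w => Φ (polar p R w)) n y‖ ≤ 1 :=
  norm_fc_le (fun x => hΦ.bound _ (subset_closure (polar_mem hR hB (by rwa [im_line])))) n

lemma hasDerivAt_normSq {c : ℝ → ℂ} {d : ℂ} (h : HasDerivAt c d y) :
    HasDerivAt (fun y => Complex.normSq (c y)) (2 * (star (c y) * d).re) y := by
  have h1 : HasDerivAt (fun y => (c y).re) d.re y :=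
    (Complex.reCLM.hasFDerivAt.comp_hasDerivAt y h)
  have h2 : HasDerivAt (fun y => (c y).im) d.im y :=
    (Complex.imCLM.hasFDerivAt.comp_hasDerivAt y h)
  have h3 := (h1.mul h1).add (h2.mul h2)
  refine h3.congr_deriv ?_
  simp; ring

lemma polar_coeff_decay (hΦ : Adm Ω lam Φ) (hR : 0 < R) (hB : Metric.closedBall p R ⊆ Ω)
    {n : ℤ} (hn : 2 * (lam * R) ^ 2 ≤ (n : ℝ) ^ 2) (hy : 0 ≤ y) :
    ‖lc (fun w => Φ (polar p R w)) n y‖ ≤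
      ‖lc (fun w => Φ (polar p R w)) n 0‖ * Real.exp (-(|(n : ℝ)| * (y / 2))) := by
  set c := lc (fun w => Φ (polar p R w)) n with hc
  set c' := lc (fun w => fderiv ℝ (fun w => Φ (polar p R w)) w Complex.I) n with hc'
  set ν := |(n : ℝ)| with hν
  have hν0 : 0 ≤ ν := abs_nonneg _
  have hode := fun y (hy : 0 ≤ y) => polar_coeff_ode hΦ hR hB n hy
  have hone := fun y (hy : 0 ≤ y) => norm_polar_coeff_le_one hΦ hR hB n hy
  rcases hν0.eq_or_lt with hν1 | hν1
  · have hn0 : (n : ℝ) = 0 := abs_eq_zero.1 (hν ▸ hν1.symm)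
    have hlR : lam * R = 0 := by
      rw [hn0] at hn
      nlinarith [sq_nonneg (lam * R)]
    have hnorm : ∀ L, y < L → ‖c y‖ ≤ ‖c 0‖ + y / L := by
      intro L hL
      have hL0 : 0 < L := lt_of_le_of_lt hy hL
      refine norm_le_of_boundary (μ := 0) (g := 0) (a := 0) (L := L) (b := fun y => ‖c 0‖ + y / L)
        (b' := fun _ => 1 / L) (b'' := fun _ => 0) le_rfl (fun y hy => (hode y hy.1).1)
        (fun y hy => (hode y hy.1).2.congr_deriv ?_)
        (fun y _ => ((hasDerivAt_id y).div_const L).const_add _)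
        (fun y _ => hasDerivAt_const _ _) (by simp) (Or.inl (by simp [hc])) ?_ y ⟨hy, hL.le⟩
      · rw [hn0, hlR]; simp
      · rw [div_self hL0.ne']
        exact (hone L hL0.le).trans (by linarith [norm_nonneg (c 0)])
    have : Tendsto (fun L : ℝ => ‖c 0‖ + y / L) atTop (𝓝 (‖c 0‖ + 0)) :=
      tendsto_const_nhds.add (tendsto_const_nhds.div_atTop tendsto_id)
    have h := ge_of_tendsto this ((eventually_gt_atTop y).mono hnorm)
    simpa [← hν1] using h
  · have hsq : ∀ L, y < L → Complex.normSq (c y) ≤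
        Complex.normSq (c 0) * Real.exp (-(ν * y)) + Real.exp (-(ν * (L - y))) := by
      intro L hL
      have hL0 : 0 < L := lt_of_le_of_lt hy hL
      have he : ∀ y, HasDerivAt (fun y => Real.exp (-(ν * y))) (-ν * Real.exp (-(ν * y))) y :=
        fun y => ((((hasDerivAt_id y).const_mul ν).neg).exp).congr_deriv (by simp; ring)
      have he2 : ∀ y, HasDerivAt (fun y => Real.exp (-(ν * (L - y))))
          (ν * Real.exp (-(ν * (L - y)))) y :=
        fun y => (((((hasDerivAt_id y).const_sub L).const_mul ν).neg).exp).congr_deriv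
          (by simp; ring)
      have h := nonpos_of_second_deriv_ge (μ := ν) (a := 0) (L := L)
        (u := fun y => Complex.normSq (c y) - (Complex.normSq (c 0) * Real.exp (-(ν * y)) +
          Real.exp (-(ν * (L - y)))))
        (u' := fun y => 2 * (star (c y) * c' y).re - (Complex.normSq (c 0) *
          (-ν * Real.exp (-(ν * y))) + ν * Real.exp (-(ν * (L - y)))))
        (u'' := fun y => 2 * (Complex.normSq (c' y) + ((n : ℝ) ^ 2 -
          (lam * R * Real.exp (-y)) ^ 2) * Complex.normSq (c y)) - (Complex.normSq (c 0) *
          (-ν * (-ν * Real.exp (-(ν * y)))) + ν * (ν * Real.exp (-(ν * (L - y))))))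
        hν0
        (fun y hy => (hasDerivAt_normSq (hode y hy.1).1).sub
          (((he y).const_mul _).add (he2 y)))
        (fun y hy => by
          have e1 := (hode y hy.1).1
          have e2 := (hode y hy.1).2
          have e3 : HasDerivAt (fun y => (star (c y) * c' y).re) (Complex.normSq (c' y) +
              ((n : ℝ) ^ 2 - (lam * R * Real.exp (-y)) ^ 2) * Complex.normSq (c y)) y := by
            have f1 := (e1.star.mul e2)
            have f2 := Complex.reCLM.hasFDerivAt.comp_hasDerivAt y f1
            refine f2.congr_deriv ?_
            simp only [Complex.reCLM_apply, Complex.normSq_apply, Complex.add_re, Complex.mul_re,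
              Complex.mul_im, Complex.star_def, Complex.conj_re, Complex.conj_im,
              Complex.ofReal_re, Complex.ofReal_im]
            ring
          exact (e3.const_mul 2).sub ((((he y).const_mul _).const_mul _).add
            ((he2 y).const_mul _)))
        (fun y hy => by
          have e1 : Real.exp (-y) ≤ 1 := Real.exp_le_one_iff.2 (by linarith [hy.1])
          have e2 : (lam * R * Real.exp (-y)) ^ 2 ≤ (lam * R) ^ 2 := by
            rw [mul_pow]
            exact mul_le_of_le_one_right (sq_nonneg _) (pow_le_one₀ (Real.exp_pos _).le e1)
          have e3 : ν ^ 2 = (n : ℝ) ^ 2 := sq_abs _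
          have e4 := Complex.normSq_nonneg (c y)
          have e5 := Complex.normSq_nonneg (c' y)
          have e6 : ν ^ 2 * Complex.normSq (c y) ≤ 2 * (((n : ℝ) ^ 2 -
              (lam * R * Real.exp (-y)) ^ 2) * Complex.normSq (c y)) := by
            rw [e3, ← mul_assoc]
            exact mul_le_mul_of_nonneg_right (by linarith) e4
          linear_combination e6 + 2 * e5)
        (Or.inl (by simp; exact (Real.exp_pos _).le))
        (by
          have e1 := hone L hL0.le
          have e2 : Complex.normSq (c L) ≤ 1 := by
            rw [Complex.normSq_eq_norm_sq]; exact pow_le_one₀ (norm_nonneg _) e1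
          have e3 := mul_nonneg (Complex.normSq_nonneg (c 0)) (Real.exp_pos (-(ν * L))).le
          simp only [sub_self, mul_zero, neg_zero, Real.exp_zero]
          linarith) y ⟨hy, hL.le⟩
      linarith
    have hlim : Tendsto (fun L : ℝ => Complex.normSq (c 0) * Real.exp (-(ν * y)) +
        Real.exp (-(ν * (L - y)))) atTop (𝓝 (Complex.normSq (c 0) * Real.exp (-(ν * y)) + 0)) := by
      refine tendsto_const_nhds.add (Real.tendsto_exp_neg_atTop_nhds_zero.comp ?_)
      exact (tendsto_atTop_add_const_right _ (-y) tendsto_id).const_mul_atTop hν1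
    have h := ge_of_tendsto hlim ((eventually_gt_atTop y).mono hsq)
    rw [add_zero, Complex.normSq_eq_norm_sq, Complex.normSq_eq_norm_sq] at h
    refine (pow_le_pow_iff_left₀ (norm_nonneg _) (by positivity) two_ne_zero).1 ?_
    refine h.trans_eq ?_
    rw [mul_pow, ← Real.exp_nat_mul]
    congr 2; push_cast; ring

lemma polar_coeff_le_exp (hΦ : Adm Ω lam Φ) (hlam : 0 < lam) (hR : 0 < R)
    (hB : Metric.closedBall p R ⊆ Ω) (n : ℤ) (hy : 0 ≤ y) :
    ‖lc (fun w => Φ (polar p R w)) n y‖ ≤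
      Real.exp (lam * R * y) * Real.exp (-(|(n : ℝ)| * (y / 2))) := by
  have hK : 0 < lam * R := mul_pos hlam hR
  rcases le_total (2 * (lam * R)) |(n : ℝ)| with h | h
  · have h1 : 2 * (lam * R) ^ 2 ≤ (n : ℝ) ^ 2 := by rw [← sq_abs (n : ℝ)]; nlinarith
    refine (polar_coeff_decay hΦ hR hB h1 hy).trans ?_
    gcongr
    exact (norm_polar_coeff_le_one hΦ hR hB n le_rfl).trans (Real.one_le_exp (by positivity))
  · refine (norm_polar_coeff_le_one hΦ hR hB n hy).trans ?_
    rw [← Real.exp_add]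
    refine Real.one_le_exp ?_
    nlinarith

end Polar

section ThreeBall

variable {Ω : Set ℂ} {lam R y : ℝ} {Φ : ℂ → ℂ} {p : ℂ}

lemma abs_bessel_coeff_le (n : ℤ) (K : ℝ) (hy : 0 ≤ y) :
    |(n : ℝ) ^ 2 - (K * Real.exp (-y)) ^ 2| ≤ (n : ℝ) ^ 2 + K ^ 2 := by
  have e1 : Real.exp (-y) ≤ 1 := Real.exp_le_one_iff.2 (by linarith)
  have e2 : (K * Real.exp (-y)) ^ 2 ≤ K ^ 2 := by
    rw [mul_pow]
    exact mul_le_of_le_one_right (sq_nonneg _) (pow_le_one₀ (Real.exp_pos _).le e1)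
  rw [abs_le]
  constructor <;> nlinarith [sq_nonneg (n : ℝ), sq_nonneg (K * Real.exp (-y))]

/-- Outward propagation of smallness, for a single Fourier coefficient. -/
lemma polar_coeff_le_of_small (hΦ : Adm Ω lam Φ) (hlam : 0 < lam) (hR : 0 < R)
    (hB : Metric.closedBall p R ⊆ Ω) {δ y₀ : ℝ} (hδ : 0 < δ) (hy₀ : 0 ≤ y₀)
    (h : ∀ w : ℂ, y₀ ≤ w.im → ‖Φ (polar p R w)‖ ≤ δ) (n : ℤ) (hy : y ∈ Icc 0 y₀) :
    ‖lc (fun w => Φ (polar p R w)) n y‖ ≤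
      δ * Real.exp ((3 + 2 * (lam * R) + |(n : ℝ)|) * (1 + y₀)) := by
  set c := lc (fun w => Φ (polar p R w)) n with hc
  set c' := lc (fun w => fderiv ℝ (fun w => Φ (polar p R w)) w Complex.I) n with hc'
  set K := lam * R with hK
  set ν := |(n : ℝ)| with hν
  have hK0 : 0 < K := mul_pos hlam hR
  have hν0 : 0 ≤ ν := abs_nonneg _
  have hν2 : ν ^ 2 = (n : ℝ) ^ 2 := sq_abs _
  have hode := fun y (hy : 0 ≤ y) => polar_coeff_ode hΦ hR hB n hy
  have hsmall : ∀ y, y₀ ≤ y → ‖c y‖ ≤ δ := fun y hy =>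
    norm_fc_le (fun x => h _ (by rwa [im_line])) n
  have hder : ‖c' y₀‖ ≤ 2 * δ + ((n : ℝ) ^ 2 + K ^ 2) * δ :=
    norm_deriv_le_of_bounded (fun y hy => (hode y (hy₀.trans hy.1)).1)
      (fun y hy => (hode y (hy₀.trans hy.1)).2) (fun y hy => hsmall y hy.1) (fun y hy => by
        rw [norm_mul, Complex.norm_real, Real.norm_eq_abs]
        exact mul_le_mul (abs_bessel_coeff_le n _ (hy₀.trans hy.1)) (hsmall y hy.1)
          (norm_nonneg _) (by positivity))
  set Λ := 1 + 2 * K with hΛ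
  have hΛ0 : 0 ≤ Λ := by positivity
  have hrev : ∀ s, HasDerivAt (fun s => y₀ - s) (-1 : ℝ) s := fun s =>
    (hasDerivAt_id s).const_sub y₀
  have key := norm_le_of_coupled (ι := Unit) (c := fun _ s => c (y₀ - s))
    (c' := fun _ s => -c' (y₀ - s))
    (g := fun _ s => ((-(K * Real.exp (-(y₀ - s))) ^ 2 : ℝ) : ℂ) * c (y₀ - s))
    (ν := fun _ => ν) (w := fun _ => 1) (Λ := Λ) (D := δ * (2 + ν + Λ)) (A₀ := 1) (L := y₀)
    (fun _ => hν0) (fun _ => one_pos) hΛ0 (by positivity)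
    (fun _ s hs => ((hode (y₀ - s) (by linarith [hs.2])).1.scomp s (hrev s)).congr_deriv
      (by simp [hc']))
    (fun _ s hs => ((hode (y₀ - s) (by linarith [hs.2])).2.scomp s (hrev s)).neg.congr_deriv (by
      have : (ν : ℂ) ^ 2 = (n : ℂ) ^ 2 := by exact_mod_cast hν2
      rw [this, neg_smul, one_smul, neg_neg]
      simp only [hc, hK]
      push_cast
      ring))
    (fun A hA s hs hcA _ => by
      rw [norm_mul, Complex.norm_real, Real.norm_eq_abs, abs_neg, abs_of_nonneg (sq_nonneg _)]
      refine mul_le_mul ?_ (hcA ()) (norm_nonneg _) (by positivity)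
      have e1 : Real.exp (-(y₀ - s)) ≤ 1 := Real.exp_le_one_iff.2 (by linarith [hs.2])
      have e2 : (K * Real.exp (-(y₀ - s))) ^ 2 ≤ K ^ 2 := by
        rw [mul_pow]
        exact mul_le_of_le_one_right (sq_nonneg _) (pow_le_one₀ (Real.exp_pos _).le e1)
      rw [hΛ]; nlinarith)
    (fun _ s hs => by
      refine (norm_polar_coeff_le_one hΦ hR hB n (by linarith [hs.2])).trans ?_
      rw [one_mul, one_mul]
      exact Real.one_le_exp (mul_nonneg (by positivity) hs.1))
    (fun _ => by
      have := hsmall y₀ le_rfl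
      simp only [sub_zero, mul_one]
      refine this.trans (le_mul_of_one_le_right hδ.le ?_)
      linarith)
    (fun _ => by
      simp only [sub_zero, norm_neg, mul_one]
      refine hder.trans ?_
      rw [← hν2, hΛ, mul_assoc]
      have : 2 * δ + (ν ^ 2 + K ^ 2) * δ = δ * (2 + ν ^ 2 + K ^ 2) := by ring
      rw [this]
      refine mul_le_mul_of_nonneg_left ?_ hδ.le
      nlinarith [mul_nonneg hν0 hK0.le])
    () (y₀ - y) ⟨by linarith [hy.2], by linarith [hy.1]⟩
  simp only [sub_sub_cancel, one_mul] at key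
  refine key.trans ?_
  rw [mul_assoc]
  refine mul_le_mul_of_nonneg_left ?_ hδ.le
  have e1 : 2 + ν + Λ ≤ Real.exp (2 + ν + Λ) := by linarith [Real.add_one_le_exp (2 + ν + Λ)]
  calc (2 + ν + Λ) * Real.exp ((Λ + ν) * (y₀ - y)) ≤
        Real.exp (2 + ν + Λ) * Real.exp ((Λ + ν) * (y₀ - y)) := by gcongr
    _ = Real.exp (2 + ν + Λ + (Λ + ν) * (y₀ - y)) := (Real.exp_add _ _).symm
    _ ≤ _ := Real.exp_le_exp.2 (by
      have e2 : (Λ + ν) * (y₀ - y) ≤ (Λ + ν) * y₀ :=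
        mul_le_mul_of_nonneg_left (by linarith [hy.1]) (by positivity)
      rw [show 3 + 2 * K + ν = 2 + (Λ + ν) by rw [hΛ]; ring]
      nlinarith)

/-- A three-ball inequality with constants explicit in the frequency. -/
lemma three_ball (hΦ : Adm Ω lam Φ) (hlam : 0 < lam) (hR : 0 < R)
    (hB : Metric.closedBall p R ⊆ Ω) {δ y₀ y₁ θ : ℝ} (hδ : 0 < δ) (hδ1 : δ ≤ 1) (hy₁ : 0 < y₁)
    (hy₀ : 0 ≤ y₀) (hθ0 : 0 ≤ θ) (hθ1 : θ ≤ 1)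
    (hθ : θ * (y₁ / 2 + 1 + y₀) ≤ y₁ / 4)
    (h : ∀ w : ℂ, y₀ ≤ w.im → ‖Φ (polar p R w)‖ ≤ δ) {w : ℂ} (hw : y₁ ≤ w.im) :
    ‖Φ (polar p R w)‖ ≤
      (1 + expSum (y₁ / 4)) * Real.exp ((3 + 3 * (lam * R)) * (1 + y₀)) * δ ^ θ := by
  set K := lam * R with hK
  have hK0 : 0 < K := mul_pos hlam hR
  have hE := expSum_nonneg (y₁ / 4)
  have hδθ : 0 < δ ^ θ := Real.rpow_pos_of_pos hδ _
  have hexp1 : 1 ≤ Real.exp ((3 + 3 * K) * (1 + y₀)) := Real.one_le_exp (by positivity)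
  rcases le_total y₀ w.im with h0 | h0
  · refine (h w h0).trans ?_
    have h1 : δ ≤ δ ^ θ := Real.self_le_rpow_of_le_one hδ.le hδ1 hθ1
    refine h1.trans (le_mul_of_one_le_left hδθ.le ?_)
    nlinarith
  · have hy : 0 ≤ w.im := hy₁.le.trans hw
    have hb : ∀ n : ℤ, ‖fc (fun x : ℝ => Φ (polar p R (x + w.im * Complex.I))) n‖ ≤
        Real.exp ((3 + 3 * K) * (1 + y₀)) * δ ^ θ * Real.exp (-(y₁ / 4 * |(n : ℝ)|)) := by
      intro n
      set ν := |(n : ℝ)| with hν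
      have hν0 : 0 ≤ ν := abs_nonneg _
      have a1 := polar_coeff_le_of_small hΦ hlam hR hB hδ hy₀ h n ⟨hy, h0⟩
      have a2 := polar_coeff_le_exp hΦ hlam hR hB n hy
      rw [← Real.exp_add] at a2
      change ‖lc (fun w => Φ (polar p R w)) n w.im‖ ≤ _
      set X := ‖lc (fun w => Φ (polar p R w)) n w.im‖ with hX
      have hX0 : 0 ≤ X := norm_nonneg _
      have a3 : X = X ^ θ * X ^ (1 - θ) := by
        rw [← Real.rpow_add_of_nonneg hX0 hθ0 (by linarith)]; simp
      rw [a3]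
      have a4 := Real.rpow_le_rpow hX0 a1 hθ0
      have a5 := Real.rpow_le_rpow hX0 a2 (show 0 ≤ 1 - θ by linarith)
      rw [Real.mul_rpow hδ.le (Real.exp_pos _).le, ← Real.exp_mul] at a4
      rw [← Real.exp_mul] at a5
      refine (mul_le_mul a4 a5 (Real.rpow_nonneg hX0 _) (by positivity)).trans ?_
      rw [mul_assoc, ← Real.exp_add, show Real.exp ((3 + 3 * K) * (1 + y₀)) * δ ^ θ *
        Real.exp (-(y₁ / 4 * ν)) = δ ^ θ * Real.exp ((3 + 3 * K) * (1 + y₀) + -(y₁ / 4 * ν)) by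
          rw [Real.exp_add]; ring]
      refine mul_le_mul_of_nonneg_left (Real.exp_le_exp.2 ?_) hδθ.le
      have b1 : (K * w.im + -(ν * (w.im / 2))) * (1 - θ) ≤
          K * y₀ + -(ν * (y₁ / 2)) * (1 - θ) := by
        have : K * w.im * (1 - θ) ≤ K * y₀ := by
          have : K * w.im ≤ K * y₀ := mul_le_mul_of_nonneg_left h0 hK0.le
          nlinarith [mul_nonneg hK0.le hy]
        have : ν * (y₁ / 2) * (1 - θ) ≤ ν * (w.im / 2) * (1 - θ) :=
          mul_le_mul_of_nonneg_right (mul_le_mul_of_nonneg_left (by linarith) hν0) (by linarith)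
        linarith
      have b2 : (3 + 2 * K + ν) * (1 + y₀) * θ ≤ (3 + 2 * K) * (1 + y₀) + ν * ((1 + y₀) * θ) := by
        have : (3 + 2 * K) * (1 + y₀) * θ ≤ (3 + 2 * K) * (1 + y₀) :=
          mul_le_of_le_one_right (by positivity) hθ1
        linarith
      have b3 : ν * (θ * (y₁ / 2 + 1 + y₀)) ≤ ν * (y₁ / 4) := mul_le_mul_of_nonneg_left hθ hν0
      nlinarith
    have hfin := norm_le_of_fc (continuous_line (y := w.im) fun x =>
      polar_line_analytic hΦ hR hB hy x) ((xPeriodic_polar Φ p R).line w.im) hb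
      ((hasSum_expSum (c := y₁ / 4) (by positivity)).mul_left _) w.re
    simp only [Complex.re_add_im] at hfin
    refine hfin.trans ?_
    have : 0 < Real.exp ((3 + 3 * K) * (1 + y₀)) * δ ^ θ := by positivity
    nlinarith

end ThreeBall

lemma le_of_convex_of_bounded {u u' u'' : ℝ → ℝ} {B s t : ℝ}
    (hu : ∀ y, 0 ≤ y → HasDerivAt u (u' y) y) (hu' : ∀ y, 0 ≤ y → HasDerivAt u' (u'' y) y)
    (h : ∀ y, 0 ≤ y → 0 ≤ u'' y) (hB : ∀ y, 0 ≤ y → |u y| ≤ B) (hs : 0 ≤ s) (hst : s ≤ t) :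
    u t ≤ u s := by
  have hB0 : 0 ≤ B := (abs_nonneg _).trans (hB s hs)
  have key : ∀ ε > 0, u t ≤ u s + ε * (t - s) := by
    intro ε hε
    set L := max t (s + 2 * B / ε) with hL
    have h1 := nonpos_of_second_deriv_ge (μ := 0) (a := s) (L := L)
      (u := fun y => u y - (u s + ε * (y - s))) (u' := fun y => u' y - ε * 1) (u'' := u'') le_rfl
      (fun y hy => (hu y (hs.trans hy.1)).sub
        ((((hasDerivAt_id y).sub_const s).const_mul ε).const_add (u s)))
      (fun y hy => ((hu' y (hs.trans hy.1)).sub_const _))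
      (fun y hy => by simpa using h y (hs.trans hy.1)) (Or.inl (by simp))
      (by
        have h2 : s + 2 * B / ε ≤ L := le_max_right _ _
        have h3 : 2 * B ≤ ε * (L - s) := by
          have h4 : ε * (2 * B / ε) = 2 * B := by field_simp
          rw [← h4]
          exact mul_le_mul_of_nonneg_left (by linarith) hε.le
        have h5 := abs_le.1 (hB L (by linarith [le_max_left t (s + 2 * B / ε)]))
        have h6 := abs_le.1 (hB s hs)
        linarith) t ⟨hst, le_max_left _ _⟩
    linarith
  have hlim : Tendsto (fun ε : ℝ => u s + ε * (t - s)) (𝓝[>] 0) (𝓝 (u s + 0 * (t - s))) :=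
    ((continuous_const.add (continuous_id.mul continuous_const)).tendsto 0).mono_left
      nhdsWithin_le_nhds
  have := ge_of_tendsto hlim (by filter_upwards [self_mem_nhdsWithin] with ε hε using key ε hε)
  simpa using this

lemma fc_const_zero (a : ℂ) : fc (fun _ => a) 0 = a := by
  unfold fc
  simp only [Int.cast_zero, mul_zero, zero_mul, neg_zero, Complex.exp_zero, one_mul,
    intervalIntegral.integral_const, sub_zero, smul_smul]
  rw [one_div_mul_cancel (by positivity), one_smul]

lemma fc_const_of_ne {n : ℤ} (hn : n ≠ 0) (a : ℂ) : fc (fun _ => a) n = 0 := by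
  have h := fc_deriv (g := fun _ => a) (g' := fun _ => 0) (fun x => hasDerivAt_const _ _)
    continuous_const rfl n
  have h0 : fc (fun _ => (0 : ℂ)) n = 0 := by simp [fc]
  rw [h0, eq_comm, mul_eq_zero] at h
  refine h.resolve_left (mul_ne_zero Complex.I_ne_zero (by exact_mod_cast hn))

lemma norm_fc_le_of_nonneg {g : ℝ → ℂ} (hg : Continuous g) (h0 : ∀ x, 0 ≤ (g x).re)
    (h1 : ∀ x, (g x).im = 0) (n : ℤ) : ‖fc g n‖ ≤ (fc g 0).re := by
  have hpi : 0 ≤ 2 * π := by positivity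
  have e1 : ∀ x, ‖g x‖ = (g x).re := fun x => by
    conv_lhs => rw [← Complex.re_add_im (g x), h1]
    simp [abs_of_nonneg (h0 x)]
  have h2 : (fc g 0).re = (1 / (2 * π)) * ∫ x in (0 : ℝ)..(2 * π), (g x).re := by
    unfold fc
    simp only [Int.cast_zero, mul_zero, zero_mul, neg_zero, Complex.exp_zero, one_mul]
    rw [Complex.smul_re, smul_eq_mul]
    congr 1
    exact (Complex.reCLM.intervalIntegral_comp_comm (hg.intervalIntegrable _ _)).symm
  rw [h2, fc, norm_smul, Real.norm_of_nonneg (by positivity)]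
  refine mul_le_mul_of_nonneg_left ?_ (by positivity)
  refine (intervalIntegral.norm_integral_le_integral_norm hpi).trans_eq ?_
  refine intervalIntegral.integral_congr fun x _ => ?_
  rw [norm_mul, norm_cexp_I_mul, one_mul, e1]

section Harnack

variable {Ω : Set ℂ} {lam R y : ℝ} {Φ : ℂ → ℂ} {p : ℂ}

/-- The mean over a circle, compared with the value at the centre. -/
lemma polar_mean_ge (hΦ : Adm Ω lam Φ) (hR : 0 < R) (hB : Metric.closedBall p R ⊆ Ω)
    (hy : 0 ≤ y) :
    (Φ p).re - (lam * R) ^ 2 / 4 ≤ (lc (fun w => Φ (polar p R w)) 0 y).re := by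
  set c := lc (fun w => Φ (polar p R w)) 0 with hc
  set c' := lc (fun w => fderiv ℝ (fun w => Φ (polar p R w)) w Complex.I) 0 with hc'
  set K := lam * R with hK
  have hode := fun y (hy : 0 ≤ y) => polar_coeff_ode hΦ hR hB 0 hy
  have hone : ∀ y, 0 ≤ y → |(c y).re| ≤ 1 := fun y hy =>
    (Complex.abs_re_le_norm _).trans (norm_polar_coeff_le_one hΦ hR hB 0 hy)
  have hlim : Tendsto c atTop (𝓝 (Φ p)) := by
    rw [Metric.tendsto_atTop]
    intro ε hε
    have hcont : ContinuousAt Φ p :=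
      (hΦ.analytic p (subset_closure (hB (Metric.mem_closedBall_self hR.le)))).continuousAt
    obtain ⟨η, hη, hball⟩ := Metric.continuousAt_iff.1 hcont (ε / 2) (by positivity)
    have h1 : Tendsto (fun y : ℝ => R * Real.exp (-y)) atTop (𝓝 (R * 0)) :=
      Real.tendsto_exp_neg_atTop_nhds_zero.const_mul R
    rw [mul_zero] at h1
    obtain ⟨N, hN⟩ := eventually_atTop.1 (h1.eventually (gt_mem_nhds hη))
    refine ⟨max N 0, fun t ht => ?_⟩
    have ht0 : 0 ≤ t := (le_max_right _ _).trans ht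
    have h2 : c t - Φ p = fc (fun x : ℝ => Φ (polar p R (x + t * Complex.I)) + -Φ p) 0 := by
      rw [fc_add (continuous_line fun x => polar_line_analytic hΦ hR hB ht0 x) continuous_const,
        fc_const_zero, ← sub_eq_add_neg]
      rfl
    rw [dist_eq_norm, h2]
    refine lt_of_le_of_lt (norm_fc_le (M := ε / 2) (fun x => ?_) 0) (by linarith)
    rw [← sub_eq_add_neg, ← dist_eq_norm]
    refine (hball ?_).le
    rw [dist_eq_norm, norm_polar_sub hR.le, im_line]
    exact hN t ((le_max_left _ _).trans ht)
  have he : ∀ y, HasDerivAt (fun y => K ^ 2 / 4 * Real.exp (-(2 * y)))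
      (-(K ^ 2 / 2) * Real.exp (-(2 * y))) y := fun y =>
    ((((hasDerivAt_id y).const_mul 2).neg.exp).const_mul (K ^ 2 / 4)).congr_deriv (by simp; ring)
  have he' : ∀ y, HasDerivAt (fun y => -(K ^ 2 / 2) * Real.exp (-(2 * y)))
      (K ^ 2 * Real.exp (-(2 * y))) y := fun y =>
    ((((hasDerivAt_id y).const_mul 2).neg.exp).const_mul (-(K ^ 2 / 2))).congr_deriv
      (by simp; ring)
  have hanti : ∀ t, y ≤ t → (c t).re ≤ (c y).re + K ^ 2 / 4 := by
    intro t ht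
    have h := le_of_convex_of_bounded (u := fun y => (c y).re + K ^ 2 / 4 * Real.exp (-(2 * y)))
      (u' := fun y => (c' y).re + -(K ^ 2 / 2) * Real.exp (-(2 * y)))
      (u'' := fun y => -(K * Real.exp (-y)) ^ 2 * (c y).re + K ^ 2 * Real.exp (-(2 * y)))
      (B := 1 + K ^ 2 / 4) (s := y) (t := t)
      (fun y hy => (Complex.reCLM.hasFDerivAt.comp_hasDerivAt y (hode y hy).1).add (he y))
      (fun y hy => ((Complex.reCLM.hasFDerivAt.comp_hasDerivAt y (hode y hy).2).congr_deriv
        (by rw [Complex.reCLM_apply, Complex.re_ofReal_mul]; simp [hc, hK])).add (he' y))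
      (fun y hy => by
        have h1 := (abs_le.1 (hone y hy)).2
        have h2 : Real.exp (-(2 * y)) = Real.exp (-y) ^ 2 := by
          rw [← Real.exp_nat_mul]; congr 1; push_cast; ring
        rw [h2]
        nlinarith [mul_nonneg (sq_nonneg (K * Real.exp (-y))) (sub_nonneg.2 h1)])
      (fun y hy => by
        have h1 := abs_le.1 (hone y hy)
        have h2 : Real.exp (-(2 * y)) ≤ 1 := Real.exp_le_one_iff.2 (by linarith)
        have h3 := (Real.exp_pos (-(2 * y))).le
        rw [abs_le]
        constructor <;> nlinarith [sq_nonneg K]) hy ht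
    have h2 : Real.exp (-(2 * y)) ≤ 1 := Real.exp_le_one_iff.2 (by linarith)
    have h3 := (Real.exp_pos (-(2 * t))).le
    nlinarith [sq_nonneg K]
  have h := le_of_tendsto ((Complex.continuous_re.tendsto _).comp hlim)
    ((eventually_ge_atTop y).mono hanti)
  linarith

/-- Harnack's inequality for `1 - Φ`, where `Φ` is a real eigenfunction of low frequency. -/
lemma harnack (hΦ : Adm Ω lam Φ) (hreal : ∀ z ∈ closure Ω, (Φ z).im = 0) (hlam : 0 < lam)
    (hR : 0 < R) (hK : lam * R ≤ 1 / 2) (hB : Metric.closedBall p R ⊆ Ω) {y₁ : ℝ} (hy₁ : 0 < y₁)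
    {w : ℂ} (hw : y₁ ≤ w.im) :
    1 - (Φ (polar p R w)).re ≤ (1 - (Φ p).re + (lam * R) ^ 2 / 4) * expSum (y₁ / 2) := by
  set K := lam * R with hKdef
  have hK0 : 0 < K := mul_pos hlam hR
  set V : ℂ → ℂ := fun w => -1 * Φ (polar p R w) + 1 with hV
  have hcont : ∀ y : ℝ, 0 ≤ y → Continuous fun x : ℝ => Φ (polar p R (x + y * Complex.I)) :=
    fun y hy => continuous_line fun x => polar_line_analytic hΦ hR hB hy x
  have hVc : ∀ y : ℝ, 0 ≤ y → Continuous fun x : ℝ => V (x + y * Complex.I) := fun y hy =>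
    ((hcont y hy).const_mul (-1) |>.add continuous_const)
  have hmem : ∀ w : ℂ, 0 ≤ w.im → polar p R w ∈ closure Ω := fun w hw =>
    subset_closure (polar_mem hR hB hw)
  have hVre : ∀ w : ℂ, 0 ≤ w.im → 0 ≤ (V w).re := fun w hw => by
    have := (Complex.re_le_norm _).trans (hΦ.bound _ (hmem w hw))
    simp [hV]; linarith
  have hVim : ∀ w : ℂ, 0 ≤ w.im → (V w).im = 0 := fun w hw => by
    simp [hV, hreal _ (hmem w hw)]
  have hVfc : ∀ y : ℝ, 0 ≤ y → ∀ n, lc V n y =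
      -1 * lc (fun w => Φ (polar p R w)) n y + fc (fun _ => 1) n := fun y hy n => by
    simp only [lc, hV]
    rw [fc_add ((hcont y hy).const_mul (-1)) continuous_const, fc_const_mul]
  set A := 1 - (Φ p).re + K ^ 2 / 4 with hA
  have h0 : ∀ y, 0 ≤ y → (lc V 0 y).re ≤ A := fun y hy => by
    have := polar_mean_ge hΦ hR hB hy
    rw [hVfc y hy, fc_const_zero]
    simp only [neg_mul, one_mul, Complex.add_re, Complex.neg_re, Complex.one_re]
    linarith
  have hnorm : ∀ y, 0 ≤ y → ∀ n, ‖lc V n y‖ ≤ A := fun y hy n =>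
    (norm_fc_le_of_nonneg (hVc y hy) (fun x => hVre _ (by rwa [im_line]))
      (fun x => hVim _ (by rwa [im_line])) n).trans (h0 y hy)
  have hA0 : 0 ≤ A := (norm_nonneg _).trans (hnorm 0 le_rfl 0)
  have hy : 0 ≤ w.im := hy₁.le.trans hw
  have hb : ∀ n : ℤ, ‖fc (fun x : ℝ => V (x + w.im * Complex.I)) n‖ ≤
      A * Real.exp (-(y₁ / 2 * |(n : ℝ)|)) := by
    intro n
    change ‖lc V n w.im‖ ≤ _
    by_cases hn : n = 0
    · rw [hn]; simpa using hnorm _ hy 0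
    · have hn1 : (1 : ℝ) ≤ (n : ℝ) ^ 2 := by
        have : 0 < n ^ 2 := by positivity
        have : (1 : ℤ) ≤ n ^ 2 := this
        exact_mod_cast this
      have h1 := polar_coeff_decay hΦ hR hB (n := n) (by nlinarith) hy
      have h2 : ∀ y, 0 ≤ y → ‖lc V n y‖ = ‖lc (fun w => Φ (polar p R w)) n y‖ := fun y hy => by
        rw [hVfc y hy, fc_const_of_ne hn, add_zero, norm_mul, norm_neg, norm_one, one_mul]
      rw [← h2 _ hy, ← h2 0 le_rfl] at h1
      refine h1.trans (mul_le_mul (hnorm 0 le_rfl n) (Real.exp_le_exp.2 ?_) (Real.exp_pos _).le hA0)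
      nlinarith [abs_nonneg (n : ℝ)]
  have hVp : Function.Periodic (fun x : ℝ => V (x + w.im * Complex.I)) (2 * π) := by
    refine XPeriodic.line (fun z => ?_) _
    simp only [hV]
    have : Φ (polar p R (z + 2 * π)) = Φ (polar p R z) := xPeriodic_polar Φ p R z
    rw [this]
  have hfin := norm_le_of_fc (hVc _ hy) hVp hb
      ((hasSum_expSum (c := y₁ / 2) (by positivity)).mul_left A) w.re
  simp only [Complex.re_add_im] at hfin
  refine le_trans ?_ ((Complex.re_le_norm _).trans hfin)
  simp [hV]

end Harnack

/-- A local property that spreads from small balls to balls of fixed relative size holds near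
every point of a connected open set. -/
lemma exists_ball_of_spread {Ω : Set ℂ} (hΩo : IsOpen Ω) (hΩc : IsPreconnected Ω)
    {P : Set ℂ → Prop} (hmono : ∀ s t, s ⊆ t → P t → P s)
    (h0 : ∃ x ∈ Ω, ∃ r > 0, P (Metric.ball x r))
    (hs : ∀ p R r, 0 < R → R ≤ 1 / 2 → 0 < r → Metric.closedBall p R ⊆ Ω →
      P (Metric.ball p r) → P (Metric.ball p (R / 4))) :
    ∀ x ∈ Ω, ∃ r > 0, P (Metric.ball x r) := by
  set U : Set ℂ := {x | ∃ r > 0, P (Metric.ball x r)} with hU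
  have hUo : IsOpen U := by
    rw [Metric.isOpen_iff]
    rintro x ⟨r, hr, hP⟩
    refine ⟨r / 2, by positivity, fun x' hx' => ⟨r / 2, by positivity, hmono _ _ ?_ hP⟩⟩
    refine Metric.ball_subset_ball' ?_
    have := Metric.mem_ball.1 hx'
    linarith
  refine hΩc.subset_of_closure_inter_subset hUo ?_ ?_
  · obtain ⟨x, hx, r, hr, hP⟩ := h0
    exact ⟨x, hx, r, hr, hP⟩
  · rintro p ⟨hp, hpΩ⟩
    obtain ⟨R', hR', hball⟩ := Metric.nhds_basis_closedBall.mem_iff.1 (hΩo.mem_nhds hpΩ)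
    set R := min R' 1 with hR
    have hR0 : 0 < R := lt_min hR' one_pos
    have hball' : Metric.closedBall p R ⊆ Ω :=
      (Metric.closedBall_subset_closedBall (min_le_left _ _)).trans hball
    obtain ⟨p', ⟨r, hr, hP⟩, hd⟩ := Metric.mem_closure_iff.1 hp (R / 16) (by positivity)
    have h1 := hs p' (R / 2) r (by positivity) (by linarith [min_le_right R' 1]) hr
      ((Metric.closedBall_subset_closedBall' (by rw [dist_comm] at hd; linarith)).trans hball') hP
    exact ⟨R / 16, by positivity, hmono _ _ (Metric.ball_subset_ball' (by linarith)) h1⟩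

lemma polar_im_ge {p : ℂ} {R : ℝ} (hR : 0 < R) {w : ℂ} {y : ℝ}
    (h : ‖polar p R w - p‖ ≤ R * Real.exp (-y)) : y ≤ w.im := by
  rw [norm_polar_sub hR.le, mul_le_mul_iff_right₀ hR, Real.exp_le_exp] at h
  linarith

lemma exists_polar_im {p z : ℂ} {R y : ℝ} (hR : 0 < R) (hz : z ≠ p)
    (h : ‖z - p‖ ≤ R * Real.exp (-y)) : ∃ w : ℂ, polar p R w = z ∧ y ≤ w.im := by
  obtain ⟨a, b, hab⟩ := exists_polar hR hz
  exact ⟨_, hab, polar_im_ge hR (by rwa [hab])⟩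

/-- Smallness on `E` forces smallness on `S`, uniformly over a class of functions. -/
def Ctrl (Good : ℝ → (ℂ → ℂ) → Prop) (E S : Set ℂ) : Prop :=
  ∃ C θ : ℝ, 1 ≤ C ∧ 0 < θ ∧ θ ≤ 1 ∧ ∀ lam Φ, Good lam Φ → ∀ δ : ℝ, 0 < δ → δ ≤ 1 →
    (∀ z ∈ E, ‖Φ z‖ ≤ δ) → ∀ z ∈ S, ‖Φ z‖ ≤ C * Real.exp (C * lam) * δ ^ θ

section Ctrl

variable {Ω : Set ℂ} {Good : ℝ → (ℂ → ℂ) → Prop} {E S T : Set ℂ}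

lemma Ctrl.empty : Ctrl Good E ∅ :=
  ⟨1, 1, le_rfl, one_pos, le_rfl, fun _ _ _ _ _ _ _ _ hz => hz.elim⟩

lemma Ctrl.mono (h : S ⊆ T) (hT : Ctrl Good E T) : Ctrl Good E S := by
  obtain ⟨C, θ, hC, hθ, hθ1, H⟩ := hT
  exact ⟨C, θ, hC, hθ, hθ1, fun lam Φ hg δ h0 h1 hE z hz => H lam Φ hg δ h0 h1 hE z (h hz)⟩

lemma ctrl_bound_mono {C C' θ θ' lam δ : ℝ} (hlam : 0 < lam) (hδ : 0 < δ) (hδ1 : δ ≤ 1)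
    (hC : 1 ≤ C) (hCC : C ≤ C') (hθ : θ' ≤ θ) :
    C * Real.exp (C * lam) * δ ^ θ ≤ C' * Real.exp (C' * lam) * δ ^ θ' := by
  have h1 := Real.rpow_le_rpow_of_exponent_ge hδ hδ1 hθ
  have h2 : Real.exp (C * lam) ≤ Real.exp (C' * lam) :=
    Real.exp_le_exp.2 (mul_le_mul_of_nonneg_right hCC hlam.le)
  exact mul_le_mul (mul_le_mul hCC h2 (Real.exp_pos _).le (by linarith)) h1
    (Real.rpow_nonneg hδ.le _) (mul_nonneg (by linarith) (Real.exp_pos _).le)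

lemma Ctrl.union (hG : ∀ lam Φ, Good lam Φ → 0 < lam) (hS : Ctrl Good E S)
    (hT : Ctrl Good E T) : Ctrl Good E (S ∪ T) := by
  obtain ⟨C, θ, hC, hθ, hθ1, H⟩ := hS
  obtain ⟨C', θ', hC', hθ', hθ1', H'⟩ := hT
  refine ⟨max C C', min θ θ', hC.trans (le_max_left _ _), lt_min hθ hθ',
    (min_le_left _ _).trans hθ1, fun lam Φ hg δ h0 h1 hE z hz => ?_⟩
  rcases hz with hz | hz
  · exact (H lam Φ hg δ h0 h1 hE z hz).trans
      (ctrl_bound_mono (hG _ _ hg) h0 h1 hC (le_max_left _ _) (min_le_left _ _))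
  · exact (H' lam Φ hg δ h0 h1 hE z hz).trans
      (ctrl_bound_mono (hG _ _ hg) h0 h1 hC' (le_max_right _ _) (min_le_right _ _))

lemma Ctrl.trans (hG : ∀ lam Φ, Good lam Φ → 0 < lam ∧ Adm Ω lam Φ) (hSΩ : S ⊆ Ω)
    (hS : Ctrl Good E S) (hT : Ctrl Good S T) : Ctrl Good E T := by
  obtain ⟨C, θ, hC, hθ, hθ1, H⟩ := hS
  obtain ⟨C', θ', hC', hθ', hθ1', H'⟩ := hT
  refine ⟨C' * C + C' + C, θ * θ', by nlinarith, by positivity, by nlinarith,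
    fun lam Φ hg δ h0 h1 hE z hz => ?_⟩
  have hlam := (hG _ _ hg).1
  have hδθ : 0 < δ ^ θ := Real.rpow_pos_of_pos h0 _
  set X := C * Real.exp (C * lam) * δ ^ θ with hX
  have hX0 : 0 < X := by positivity
  have h2 := H' lam Φ hg (min 1 X) (lt_min one_pos hX0) (min_le_left _ _) (fun z hz =>
    le_min ((hG _ _ hg).2.bound z (subset_closure (hSΩ hz))) (H lam Φ hg δ h0 h1 hE z hz)) z hz
  refine h2.trans ?_
  have h3 : (min 1 X) ^ θ' ≤ C * Real.exp (C * lam) * δ ^ (θ * θ') := by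
    refine (Real.rpow_le_rpow (by positivity) (min_le_right _ _) hθ'.le).trans ?_
    rw [hX, Real.mul_rpow (by positivity) hδθ.le, ← Real.rpow_mul h0.le]
    refine mul_le_mul_of_nonneg_right ?_ (Real.rpow_nonneg h0.le _)
    have h4 : 1 ≤ C * Real.exp (C * lam) :=
      one_le_mul_of_one_le_of_one_le hC (Real.one_le_exp (by positivity))
    calc (C * Real.exp (C * lam)) ^ θ' ≤ (C * Real.exp (C * lam)) ^ (1 : ℝ) :=
          Real.rpow_le_rpow_of_exponent_le h4 hθ1'
      _ = _ := Real.rpow_one _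
  calc C' * Real.exp (C' * lam) * (min 1 X) ^ θ' ≤
        C' * Real.exp (C' * lam) * (C * Real.exp (C * lam) * δ ^ (θ * θ')) := by gcongr
    _ = (C' * C) * Real.exp ((C' + C) * lam) * δ ^ (θ * θ') := by
        rw [add_mul, Real.exp_add]; ring
    _ ≤ _ := by
        refine mul_le_mul_of_nonneg_right (mul_le_mul (by linarith) (Real.exp_le_exp.2 ?_)
          (Real.exp_pos _).le (by positivity)) (Real.rpow_nonneg h0.le _)
        exact mul_le_mul_of_nonneg_right (by nlinarith) hlam.le

lemma ctrl_ball (hG : ∀ lam Φ, Good lam Φ → 0 < lam ∧ Adm Ω lam Φ) {p : ℂ} {R r : ℝ}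
    (hR : 0 < R) (hr : 0 < r) (hrR : r ≤ R) (hB : Metric.closedBall p R ⊆ Ω) :
    Ctrl Good (Metric.ball p r) (Metric.ball p (R / 4)) := by
  set y₀ := Real.log (2 * R / r) with hy₀
  set y₁ := Real.log 2 with hy₁
  have hy₁0 : 0 < y₁ := Real.log_pos one_lt_two
  have hy₀0 : 0 ≤ y₀ := Real.log_nonneg (by rw [le_div_iff₀ hr]; linarith)
  have he₀ : R * Real.exp (-y₀) = r / 2 := by
    rw [Real.exp_neg, hy₀, Real.exp_log (by positivity)]; field_simp
  have he₁ : R * Real.exp (-y₁) = R / 2 := by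
    rw [Real.exp_neg, hy₁, Real.exp_log (by positivity)]; ring
  set θ := (y₁ / 4) / (y₁ / 2 + 1 + y₀) with hθ
  have hE := expSum_nonneg (y₁ / 4)
  have hθ0 : 0 < θ := by positivity
  have hθ1 : θ ≤ 1 := by rw [hθ, div_le_one (by positivity)]; linarith
  set C := (1 + expSum (y₁ / 4)) * Real.exp (3 * (1 + y₀)) + 3 * R * (1 + y₀) with hC
  have hC1 : 1 ≤ (1 + expSum (y₁ / 4)) * Real.exp (3 * (1 + y₀)) :=
    one_le_mul_of_one_le_of_one_le (by linarith) (Real.one_le_exp (by positivity))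
  have hC2 : 0 ≤ 3 * R * (1 + y₀) := by positivity
  refine ⟨C, θ, by linarith, hθ0, hθ1, fun lam Φ hg δ h0 h1 hsm z hz => ?_⟩
  obtain ⟨hlam, hΦ⟩ := hG _ _ hg
  have hδθ : 0 < δ ^ θ := Real.rpow_pos_of_pos h0 _
  by_cases hzp : z = p
  · rw [hzp]
    refine (hsm p (Metric.mem_ball_self hr)).trans
      ((Real.self_le_rpow_of_le_one h0.le h1 hθ1).trans (le_mul_of_one_le_left hδθ.le ?_))
    exact one_le_mul_of_one_le_of_one_le (by linarith) (Real.one_le_exp (by positivity))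
  · obtain ⟨w, rfl, hw⟩ := exists_polar_im (y := y₁) hR hzp (by
      rw [he₁, ← dist_eq_norm]; linarith [Metric.mem_ball.1 hz])
    refine (three_ball hΦ hlam hR hB h0 h1 hy₁0 hy₀0 hθ0.le hθ1
      (div_mul_cancel₀ _ (by positivity)).le (fun w hw => hsm _ ?_) hw).trans ?_
    · rw [Metric.mem_ball, dist_eq_norm, norm_polar_sub hR.le]
      calc R * Real.exp (-w.im) ≤ R * Real.exp (-y₀) := by gcongr
        _ < r := by rw [he₀]; linarith
    · refine mul_le_mul_of_nonneg_right ?_ hδθ.le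
      rw [show (3 + 3 * (lam * R)) * (1 + y₀) = 3 * (1 + y₀) + 3 * R * (1 + y₀) * lam by ring,
        Real.exp_add, ← mul_assoc]
      refine mul_le_mul (by linarith) (Real.exp_le_exp.2 ?_) (Real.exp_pos _).le (by linarith)
      exact mul_le_mul_of_nonneg_right (by linarith) hlam.le

lemma exists_ctrl_ball (hΩo : IsOpen Ω) (hΩc : IsPreconnected Ω)
    (hG : ∀ lam Φ, Good lam Φ → 0 < lam ∧ Adm Ω lam Φ)
    (h0 : ∃ x ∈ Ω, ∃ r > 0, Ctrl Good E (Metric.ball x r)) :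
    ∀ x ∈ Ω, ∃ r > 0, Ctrl Good E (Metric.ball x r) := by
  refine exists_ball_of_spread hΩo hΩc (fun s t => Ctrl.mono) h0 ?_
  intro p R r hR _ hr hB hP
  have h1 : Ctrl Good E (Metric.ball p (min r R)) :=
    hP.mono (Metric.ball_subset_ball (min_le_left _ _))
  refine h1.trans hG ?_ (ctrl_ball hG hR (lt_min hr hR) (min_le_right _ _) hB)
  exact (Metric.ball_subset_ball (min_le_right _ _)).trans
    (Metric.ball_subset_closedBall.trans hB)

end Ctrl

/-- Comparison of the defects `1 - Φ` at points of `S` and of `T`. -/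
def HRel (Ω : Set ℂ) (Good : ℝ → (ℂ → ℂ) → Prop) (S T : Set ℂ) : Prop :=
  ∃ C : ℝ, 0 ≤ C ∧ ∀ lam Φ, Good lam Φ → ∀ z ∈ S ∩ closure Ω, ∀ w ∈ T ∩ closure Ω,
    1 - (Φ w).re ≤ C * (1 - (Φ z).re + lam ^ 2)

section HRel

variable {Ω : Set ℂ} {Good : ℝ → (ℂ → ℂ) → Prop} {S S' T T' U : Set ℂ}

lemma HRel.mono (hS : S ⊆ S') (hT : T ⊆ T') (h : HRel Ω Good S' T') : HRel Ω Good S T := by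
  obtain ⟨C, hC, H⟩ := h
  exact ⟨C, hC, fun lam Φ hg z hz w hw => H lam Φ hg z ⟨hS hz.1, hz.2⟩ w ⟨hT hw.1, hw.2⟩⟩

lemma Adm.one_sub_re_nonneg {lam : ℝ} {Φ : ℂ → ℂ} (hΦ : Adm Ω lam Φ) {z : ℂ}
    (hz : z ∈ closure Ω) : 0 ≤ 1 - (Φ z).re :=
  sub_nonneg.2 ((Complex.re_le_norm _).trans (hΦ.bound z hz))

lemma HRel.union_right (hG : ∀ lam Φ, Good lam Φ → Adm Ω lam Φ) (h : HRel Ω Good S T)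
    (h' : HRel Ω Good S T') : HRel Ω Good S (T ∪ T') := by
  obtain ⟨C, hC, H⟩ := h
  obtain ⟨C', hC', H'⟩ := h'
  refine ⟨max C C', hC.trans (le_max_left _ _), fun lam Φ hg z hz w hw => ?_⟩
  have h0 := (hG _ _ hg).one_sub_re_nonneg hz.2
  have h1 : 0 ≤ 1 - (Φ z).re + lam ^ 2 := by positivity
  rcases hw.1 with hw' | hw'
  · exact (H lam Φ hg z hz w ⟨hw', hw.2⟩).trans
      (mul_le_mul_of_nonneg_right (le_max_left _ _) h1)
  · exact (H' lam Φ hg z hz w ⟨hw', hw.2⟩).trans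
      (mul_le_mul_of_nonneg_right (le_max_right _ _) h1)

lemma HRel.union_left (hG : ∀ lam Φ, Good lam Φ → Adm Ω lam Φ) (h : HRel Ω Good S T)
    (h' : HRel Ω Good S' T) : HRel Ω Good (S ∪ S') T := by
  obtain ⟨C, hC, H⟩ := h
  obtain ⟨C', hC', H'⟩ := h'
  refine ⟨max C C', hC.trans (le_max_left _ _), fun lam Φ hg z hz w hw => ?_⟩
  have h0 := (hG _ _ hg).one_sub_re_nonneg hz.2
  have h1 : 0 ≤ 1 - (Φ z).re + lam ^ 2 := by positivity
  rcases hz.1 with hz' | hz'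
  · exact (H lam Φ hg z ⟨hz', hz.2⟩ w hw).trans
      (mul_le_mul_of_nonneg_right (le_max_left _ _) h1)
  · exact (H' lam Φ hg z ⟨hz', hz.2⟩ w hw).trans
      (mul_le_mul_of_nonneg_right (le_max_right _ _) h1)

lemma HRel.trans (hG : ∀ lam Φ, Good lam Φ → Adm Ω lam Φ) (hT : (T ∩ closure Ω).Nonempty)
    (h : HRel Ω Good S T) (h' : HRel Ω Good T U) : HRel Ω Good S U := by
  obtain ⟨C, hC, H⟩ := h
  obtain ⟨C', hC', H'⟩ := h'
  obtain ⟨t, ht⟩ := hT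
  refine ⟨C' * (C + 1), by positivity, fun lam Φ hg z hz w hw => ?_⟩
  have h0 := (hG _ _ hg).one_sub_re_nonneg hz.2
  rw [mul_assoc]
  refine (H' lam Φ hg t ht w hw).trans (mul_le_mul_of_nonneg_left ?_ hC')
  linarith [H lam Φ hg z hz t ht]

lemma hRel_center (hG : ∀ lam Φ, Good lam Φ →
      0 < lam ∧ lam ≤ 1 ∧ Adm Ω lam Φ ∧ ∀ z ∈ closure Ω, (Φ z).im = 0) {R : ℝ} (hR : 0 < R)
    (hR1 : R ≤ 1 / 2) : ∃ C : ℝ, 0 ≤ C ∧ ∀ lam Φ, Good lam Φ → ∀ p : ℂ,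
      Metric.closedBall p R ⊆ Ω → ∀ z ∈ Metric.closedBall p (R / 2),
        1 - (Φ z).re ≤ C * (1 - (Φ p).re + lam ^ 2) := by
  set y₁ := Real.log 2 with hy₁
  have hy₁0 : 0 < y₁ := Real.log_pos one_lt_two
  have he₁ : R * Real.exp (-y₁) = R / 2 := by
    rw [Real.exp_neg, hy₁, Real.exp_log (by positivity)]; ring
  have hE := expSum_nonneg (y₁ / 2)
  refine ⟨1 + expSum (y₁ / 2), by linarith, fun lam Φ hg p hB z hz => ?_⟩
  obtain ⟨hlam, hlam1, hΦ, hreal⟩ := hG _ _ hg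
  have h0 := hΦ.one_sub_re_nonneg (subset_closure (hB (Metric.mem_closedBall_self hR.le)))
  have h1 := sq_nonneg lam
  by_cases hzp : z = p
  · rw [hzp]; nlinarith
  · obtain ⟨w, rfl, hw⟩ := exists_polar_im (y := y₁) hR hzp (by
      rw [he₁, ← dist_eq_norm]; exact Metric.mem_closedBall.1 hz)
    refine (harnack hΦ hreal hlam hR (by nlinarith) hB hy₁0 hw).trans ?_
    have h2 : (lam * R) ^ 2 ≤ lam ^ 2 := by
      rw [mul_pow]; exact mul_le_of_le_one_right h1 (pow_le_one₀ hR.le (by linarith))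
    nlinarith

/-- On compact subsets of a connected open set, the defects are comparable. -/
lemma hRel_of_isCompact (hΩo : IsOpen Ω) (hΩc : IsConnected Ω)
    (hG : ∀ lam Φ, Good lam Φ →
      0 < lam ∧ lam ≤ 1 ∧ Adm Ω lam Φ ∧ ∀ z ∈ closure Ω, (Φ z).im = 0)
    {K : Set ℂ} (hK : IsCompact K) (hKΩ : K ⊆ Ω) : HRel Ω Good K K := by
  have hA : ∀ lam Φ, Good lam Φ → Adm Ω lam Φ := fun lam Φ h => (hG lam Φ h).2.2.1
  obtain ⟨x₀, hx₀⟩ := hΩc.nonempty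
  have hcenter : ∀ p R, 0 < R → R ≤ 1 / 2 → Metric.closedBall p R ⊆ Ω →
      HRel Ω Good {p} (Metric.ball p (R / 4)) ∧ HRel Ω Good (Metric.ball p (R / 4)) {p} := by
    intro p R hR hR1 hB
    constructor
    · obtain ⟨C, hC, H⟩ := hRel_center hG hR hR1
      refine ⟨C, hC, fun lam Φ hg z hz w hw => ?_⟩
      obtain rfl : z = p := hz.1
      exact H lam Φ hg z hB w (Metric.ball_subset_closedBall.trans
        (Metric.closedBall_subset_closedBall (by linarith)) hw.1)
    · obtain ⟨C, hC, H⟩ := hRel_center hG (R := R / 2) (by positivity) (by linarith)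
      refine ⟨C, hC, fun lam Φ hg z hz w hw => ?_⟩
      obtain rfl : w = p := hw.1
      have hd := Metric.mem_ball.1 hz.1
      refine H lam Φ hg z ((Metric.closedBall_subset_closedBall' (by linarith)).trans hB) w ?_
      rw [Metric.mem_closedBall, dist_comm]; linarith
  have hstart : ∃ x ∈ Ω, ∃ r > 0, HRel Ω Good {x₀} (Metric.ball x r) ∧
      HRel Ω Good (Metric.ball x r) {x₀} := by
    obtain ⟨R, hR, hball⟩ := Metric.nhds_basis_closedBall.mem_iff.1 (hΩo.mem_nhds hx₀)
    exact ⟨x₀, hx₀, min R (1 / 2) / 4, by positivity, hcenter x₀ _ (by positivity)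
      (min_le_right _ _) ((Metric.closedBall_subset_closedBall (min_le_left _ _)).trans hball)⟩
  have hloc := exists_ball_of_spread hΩo hΩc.isPreconnected
    (P := fun S => HRel Ω Good {x₀} S ∧ HRel Ω Good S {x₀})
    (fun s t hst h => ⟨h.1.mono Subset.rfl hst, h.2.mono hst Subset.rfl⟩) hstart (by
      intro p R r hR hR1 hr hB hP
      have hp : ({p} ∩ closure Ω).Nonempty :=
        ⟨p, rfl, subset_closure (hB (Metric.mem_closedBall_self hR.le))⟩
      have hpb : ({p} : Set ℂ) ⊆ Metric.ball p r :=
        singleton_subset_iff.2 (Metric.mem_ball_self hr)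
      obtain ⟨h1, h2⟩ := hcenter p R hR hR1 hB
      exact ⟨(hP.1.mono Subset.rfl hpb).trans hA hp h1,
        h2.trans hA hp (hP.2.mono hpb Subset.rfl)⟩)
  have hKK : HRel Ω Good {x₀} K ∧ HRel Ω Good K {x₀} := by
    refine hK.induction_on (p := fun S => HRel Ω Good {x₀} S ∧ HRel Ω Good S {x₀})
      ⟨⟨0, le_rfl, fun _ _ _ _ _ _ hw => hw.1.elim⟩, ⟨0, le_rfl, fun _ _ _ _ hz => hz.1.elim⟩⟩
      (fun s t hst h => ⟨h.1.mono Subset.rfl hst, h.2.mono hst Subset.rfl⟩)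
      (fun s t hs ht => ⟨hs.1.union_right hA ht.1, hs.2.union_left hA ht.2⟩) (fun x hx => ?_)
    obtain ⟨r, hr, h⟩ := hloc x (hKΩ hx)
    exact ⟨_, mem_nhdsWithin_of_mem_nhds (Metric.ball_mem_nhds x hr), h⟩
  exact HRel.trans (T := {x₀}) hA ⟨x₀, mem_singleton _, subset_closure hx₀⟩ hKK.2 hKK.1

end HRel

/-- A finite family of collars which together cover a one-sided neighbourhood of the boundary
parametrized by `q`. -/
structure Atlas (Ω : Set ℂ) (q q' : ℝ → ℂ) (S : Set ((ℂ → ℂ) × (ℂ → ℂ))) (Y H : ℝ) : Prop where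
  collar : ∀ p ∈ S, Collar Ω p.1 p.2 Y H
  real : ∀ p ∈ S, ∃ c : ℝ, c ^ 2 = 1 ∧ ∀ x : ℝ, p.1 x = q (c * x) ∧ p.2 x = c * q' (c * x)
  nonempty : S.Nonempty
  finite : S.Finite
  cover : ∀ η > 0, ∀ x ∈ frontier Ω, ∃ r > 0, ∀ z ∈ Metric.ball x r ∩ closure Ω,
    ∃ p ∈ S, ∃ w : ℂ, 0 ≤ w.im ∧ w.im ≤ η ∧ p.1 w = z

lemma subset_or_disjoint_of_frontier {Ω A : Set ℂ} (hΩ : IsOpen Ω) (hA : IsPreconnected A)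
    (h : Disjoint A (frontier Ω)) : A ⊆ Ω ∨ Disjoint A (closure Ω) := by
  by_cases hne : (A ∩ Ω).Nonempty
  · left
    refine hA.subset_of_closure_inter_subset hΩ hne fun z hz => ?_
    by_contra hzΩ
    exact Set.disjoint_left.1 h hz.2 (by rw [hΩ.frontier_eq]; exact ⟨hz.1, hzΩ⟩)
  · right
    refine Set.disjoint_left.2 fun z hzA hzc => ?_
    by_cases hzΩ : z ∈ Ω
    · exact hne ⟨z, hzA, hzΩ⟩
    · exact Set.disjoint_left.1 h hzA (by rw [hΩ.frontier_eq]; exact ⟨hzc, hzΩ⟩)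

section Extension

variable {q : ℝ → ℂ} {Q Q₁ : ℂ → ℂ}

/-- Points off the real axis near a real point are not mapped to the curve. -/
lemma eventually_notMem_range (hq : Continuous q) (hp : Function.Periodic q (2 * π))
    (hinj : ∀ s t, q s = q t → ∃ n : ℤ, s = t + n * (2 * π)) (hQ : ∀ x : ℝ, Q x = q x) {x : ℝ}
    (hd : HasStrictDerivAt Q (Q₁ x) x) (h0 : Q₁ x ≠ 0) :
    ∀ᶠ z in 𝓝 (x : ℂ), Q z ∈ range q → z.im = 0 := by
  have hinv := hd.eventually_left_inverse h0
  obtain ⟨ε, hε, hball⟩ := Metric.nhds_basis_closedBall.mem_iff.1 hinv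
  set δ := min ε 1 with hδ
  have hδ0 : 0 < δ := by positivity
  have hpi := Real.pi_gt_three
  have hδ1 : δ ≤ 1 := min_le_right _ _
  have hK : IsCompact (q '' Icc (x + δ) (x + 2 * π - δ)) := isCompact_Icc.image hq
  have hxK : Q x ∈ (q '' Icc (x + δ) (x + 2 * π - δ))ᶜ := by
    rintro ⟨s, hs, hsx⟩
    rw [hQ] at hsx
    obtain ⟨n, rfl⟩ := hinj _ _ hsx
    have h1 : (0 : ℝ) < n := by
      by_contra h
      have : (n : ℝ) * (2 * π) ≤ 0 := mul_nonpos_of_nonpos_of_nonneg (not_lt.1 h) (by positivity)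
      linarith [hs.1]
    have h2 : (1 : ℝ) ≤ n := by exact_mod_cast (show (0 : ℤ) < n by exact_mod_cast h1)
    nlinarith [hs.2]
  filter_upwards [hd.hasDerivAt.continuousAt.eventually (hK.isClosed.isOpen_compl.mem_nhds hxK),
    Metric.ball_mem_nhds _ hδ0] with z hzK hzδ hzr
  obtain ⟨s, hs⟩ := hzr
  obtain ⟨t, ht, hst⟩ := hp.exists_mem_Ico (by positivity) s (x - δ)
  have hsz : Q z = q t := by rw [← hst, hs]
  have htx : t < x + δ := by
    by_contra h
    exact hzK ⟨t, ⟨not_lt.1 h, by linarith [ht.2]⟩, hsz.symm⟩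
  have hz' : z ∈ Metric.closedBall (x : ℂ) ε :=
    Metric.mem_closedBall.2 ((Metric.mem_ball.1 hzδ).le.trans (min_le_left _ _))
  have ht' : (t : ℂ) ∈ Metric.closedBall (x : ℂ) ε := by
    rw [Metric.mem_closedBall, Complex.dist_of_im_eq (by simp), Complex.ofReal_re,
      Complex.ofReal_re, Real.dist_eq]
    exact (abs_le.2 ⟨by linarith [ht.1], by linarith⟩).trans (min_le_left _ _)
  have h1 := hball hz'
  have h2 := hball ht'
  simp only [mem_ofPred_eq] at h1 h2
  have h3 : z = t := by rw [← h1, ← h2, hsz, hQ]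
  rw [h3, Complex.ofReal_im]

lemma exists_strip_notMem_range (hq : Continuous q) (hp : Function.Periodic q (2 * π))
    (hinj : ∀ s t, q s = q t → ∃ n : ℤ, s = t + n * (2 * π)) (hQ : ∀ x : ℝ, Q x = q x)
    (hQp : XPeriodic Q) (hd : ∀ x : ℝ, HasStrictDerivAt Q (Q₁ x) x) (h0 : ∀ x : ℝ, Q₁ x ≠ 0) :
    ∃ Y > 0, ∀ z : ℂ, |z.im| ≤ Y → Q z ∈ range q → z.im = 0 := by
  have hcpt : ∃ Y > 0, ∀ x ∈ Icc (0 : ℝ) (2 * π), ∀ y : ℝ, |y| ≤ Y →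
      Q (x + y * Complex.I) ∈ range q → y = 0 := by
    refine (isCompact_Icc (a := (0 : ℝ)) (b := 2 * π)).induction_on
      (p := fun s => ∃ Y > 0, ∀ x ∈ s, ∀ y : ℝ, |y| ≤ Y →
      Q (x + y * Complex.I) ∈ range q → y = 0) ⟨1, one_pos, fun x hx => hx.elim⟩
      (fun s t hst ⟨Y, hY, h⟩ => ⟨Y, hY, fun x hx => h x (hst hx)⟩)
      (fun s t ⟨Y, hY, h⟩ ⟨Y', hY', h'⟩ => ⟨min Y Y', lt_min hY hY', fun x hx y hy => ?_⟩)
      (fun x _ => ?_)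
    · rcases hx with hx | hx
      · exact h x hx y (hy.trans (min_le_left _ _))
      · exact h' x hx y (hy.trans (min_le_right _ _))
    · obtain ⟨ε, hε, hball⟩ := Metric.nhds_basis_ball.mem_iff.1
        (eventually_notMem_range hq hp hinj hQ (hd x) (h0 x))
      refine ⟨Metric.ball x (ε / 2), mem_nhdsWithin_of_mem_nhds (Metric.ball_mem_nhds _ (by
        positivity)), ε / 3, by positivity, fun t ht y hy hr => ?_⟩
      have hmem : (t + y * Complex.I : ℂ) ∈ Metric.ball (x : ℂ) ε := by
        rw [Metric.mem_ball, dist_eq_norm]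
        have h1 : (t + y * Complex.I - x : ℂ) = ((t - x : ℝ) : ℂ) + (y : ℂ) * Complex.I := by
          push_cast; ring
        rw [h1]
        refine (norm_add_le _ _).trans_lt ?_
        rw [norm_mul, Complex.norm_I, mul_one, Complex.norm_real, Complex.norm_real,
          Real.norm_eq_abs, Real.norm_eq_abs]
        have h2 : |t - x| < ε / 2 := by simpa [Real.dist_eq] using ht
        linarith
      simpa using hball hmem hr
  obtain ⟨Y, hY, h⟩ := hcpt
  refine ⟨Y, hY, fun z hz hr => ?_⟩
  have hper : Function.Periodic (fun x : ℝ => Q (x + z.im * Complex.I)) (2 * π) := fun x => by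
    show Q _ = Q _
    rw [← hQp (x + z.im * Complex.I)]
    congr 1; push_cast; ring
  obtain ⟨t, ht, hst⟩ := hper.exists_mem_Ico₀ (by positivity) z.re
  refine h t (Ico_subset_Icc_self ht) z.im hz ?_
  rwa [← hst, Complex.re_add_im]

end Extension

/-- The parametrization of one of the two sides of the curve. -/
def side (Q Q₁ : ℂ → ℂ) (c : ℝ) : (ℂ → ℂ) × (ℂ → ℂ) :=
  (fun z => Q (c * z), fun z => c * Q₁ (c * z))

lemma im_real_mul (c : ℝ) (z : ℂ) : ((c : ℂ) * z).im = c * z.im := by simp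

lemma eq_one_or_of_sq {c : ℝ} (hc : c ^ 2 = 1) : c = 1 ∨ c = -1 := mul_self_eq_one_iff.1 (by rwa [← sq])

lemma abs_eq_one_of_sq {c : ℝ} (hc : c ^ 2 = 1) : |c| = 1 := by
  rcases eq_one_or_of_sq hc with rfl | rfl <;> simp

lemma collar_side {Ω : Set ℂ} {a : ℤ → ℂ} {B r Y c : ℝ} (hr : 0 < r) (hY : 0 < Y)
    (hYr : Y ≤ r / 4) (ha : ∀ n : ℤ, ‖a n‖ ≤ B * Real.exp (-(r * |(n : ℝ)|)))
    (hne : fser (fun n => Complex.I * n * a n) 0 ≠ 0) (hc : c ^ 2 = 1)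
    (hm : ∀ z : ℂ, 0 < z.im → z.im ≤ Y → fser a (c * z) ∈ Ω)
    (hr0 : ∀ x : ℝ, fser a x ∈ frontier Ω) :
    Collar Ω (side (fser a) (fser fun n => Complex.I * n * a n) c).1
      (side (fser a) (fser fun n => Complex.I * n * a n) c).2 Y
      (∑' m : ℤ, ‖Complex.I * m * a m‖ * Real.exp (Y * |(m : ℝ)|) * Real.exp (Y * |(m : ℝ)|)) := by
  set b : ℤ → ℂ := fun n => Complex.I * n * a n with hb
  have hb1 := fun n => norm_deriv_coeff_le (show 0 < r / 4 by positivity) ha n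
  have hcY : ∀ z : ℂ, |z.im| ≤ Y → |((c : ℂ) * z).im| ≤ Y := fun z hz => by
    rwa [im_real_mul, abs_mul, abs_eq_one_of_sq hc, one_mul]
  have hmul : ∀ z : ℂ, HasDerivAt (fun w : ℂ => (c : ℂ) * w) c z := fun z => by
    simpa using (hasDerivAt_id z).const_mul (c : ℂ)
  have hsum : Summable fun m : ℤ =>
      ‖b m‖ * Real.exp (Y * |(m : ℝ)|) * Real.exp (Y * |(m : ℝ)|) := by
    refine Summable.of_nonneg_of_le (fun m => by positivity) (fun m => ?_)
      ((summable_exp_abs (show 0 < r / 4 by positivity)).mul_left (B / (r / 4)))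
    have h1 : Real.exp (Y * |(m : ℝ)|) ≤ Real.exp (r / 4 * |(m : ℝ)|) :=
      Real.exp_le_exp.2 (by gcongr)
    calc _ ≤ (B / (r / 4) * Real.exp (-((r - r / 4) * |(m : ℝ)|))) *
          Real.exp (r / 4 * |(m : ℝ)|) * Real.exp (r / 4 * |(m : ℝ)|) := by
          have := (norm_nonneg _).trans (hb1 m)
          refine mul_le_mul (mul_le_mul (hb1 m) h1 (Real.exp_pos _).le this) h1
            (Real.exp_pos _).le (mul_nonneg this (Real.exp_pos _).le)
      _ = _ := by
          rw [mul_assoc, mul_assoc, ← Real.exp_add, ← Real.exp_add]; congr 2; ring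
  have hser : ∀ z : ℂ, |z.im| ≤ Y →
      HasSum (fun m : ℤ => b m * Complex.exp (Complex.I * m * z)) (fser b z) := fun z hz =>
    fser_hasSum hb1 (by linarith)
  refine ⟨hY, ?_, fun z hz => ?_, fun z hz => ?_, fun z => ?_, ?_, hm, fun x => ?_⟩
  · have hex : ∃ m, b m ≠ 0 := by
      by_contra h
      push Not at h
      exact hne (by simp only [fser, h, zero_mul, tsum_zero])
    obtain ⟨m, hbm⟩ := hex
    exact hsum.tsum_pos (fun m => by positivity) m (by positivity)
  · have hopen : {w : ℂ | |w.im| < r} ∈ 𝓝 z := (isOpen_strip r).mem_nhds (by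
      show |z.im| < r
      linarith)
    filter_upwards [hopen] with w hw
    have h2 : |((c : ℂ) * w).im| < r := by
      rwa [im_real_mul, abs_mul, abs_eq_one_of_sq hc, one_mul]
    have h3 := (fser_hasDerivAt ha h2).comp w (hmul w)
    exact h3.congr_deriv (mul_comm _ _)
  · have h2 : |((c : ℂ) * z).im| < r - r / 4 := by linarith [hcY z hz]
    have h3 := (fser_hasDerivAt hb1 h2).comp z (hmul z)
    exact (h3.differentiableAt).const_mul _
  · show fser a (c * (z + 2 * π)) = fser a (c * z)
    rcases eq_one_or_of_sq hc with rfl | rfl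
    · rw [Complex.ofReal_one, one_mul, one_mul, fser_add_two_pi]
    · rw [← fser_add_two_pi a (((-1 : ℝ) : ℂ) * (z + 2 * π))]
      congr 1; push_cast; ring
  · rcases eq_one_or_of_sq hc with rfl | rfl
    · exact ⟨b, hsum.hasSum, fun z hz => by simpa [side] using hser z hz⟩
    · refine ⟨fun m => -b (-m), ?_, fun z hz => ?_⟩
      · have h := (Equiv.neg ℤ).hasSum_iff.2 hsum.hasSum
        convert h using 2 with m
        simp
      · have h := ((Equiv.neg ℤ).hasSum_iff.2 (hser _ (hcY z hz))).neg
        simp only [side, Function.comp_def, Equiv.neg_apply] at h ⊢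
        rw [show ((-1 : ℝ) : ℂ) * fser b (((-1 : ℝ) : ℂ) * z) = -fser b (((-1 : ℝ) : ℂ) * z) by simp]
        refine hasSum_congr_of_eq h fun m => ?_
        rw [neg_mul]
        congr 3; push_cast; ring
  · have h := hr0 (c * x)
    simpa [side] using h

theorem exists_atlas {Ω : Set ℂ} (hΩo : IsOpen Ω) {q q' : ℝ → ℂ} (hqa : ∀ x, AnalyticAt ℝ q x)
    (hqd : ∀ x, HasDerivAt q (q' x) x) (hq0 : ∀ x, q' x ≠ 0)
    (hp : Function.Periodic q (2 * π))
    (hinj : ∀ s t, q s = q t → ∃ n : ℤ, s = t + n * (2 * π)) (hr : range q = frontier Ω) :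
    ∃ S Y H, Atlas Ω q q' S Y H := by
  obtain ⟨B, r, hr0, ha⟩ := exists_fc_decay hqa hp
  set Q := fser (fc q) with hQdef
  set Q₁ := fser fun n => Complex.I * n * fc q n with hQ₁def
  have hqc : Continuous q := continuous_iff_continuousAt.2 fun x => (hqd x).continuousAt
  have hsum : Summable fun n => ‖fc q n‖ :=
    Summable.of_nonneg_of_le (fun n => norm_nonneg _) ha ((summable_exp_abs hr0).mul_left B)
  have hQ : ∀ x : ℝ, Q x = q x := fun x => (fc_hasSum hqc hp hsum x).tsum_eq
  have hQd : ∀ z : ℂ, |z.im| < r → HasDerivAt Q (Q₁ z) z := fun z hz => fser_hasDerivAt ha hz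
  have hQ₁ : ∀ x : ℝ, Q₁ x = q' x := fun x => by
    have h := (hQd x (by simpa using hr0)).comp_ofReal
    simp only [hQ] at h
    exact h.unique (hqd x)
  have hstrict : ∀ x : ℝ, HasStrictDerivAt Q (Q₁ x) x := fun x => by
    have h : AnalyticAt ℂ Q x := by
      refine Complex.analyticAt_iff_eventually_differentiableAt.2 ?_
      filter_upwards [(isOpen_strip r).mem_nhds (show |(x : ℂ).im| < r by simpa using hr0)]
        with w hw using (hQd w hw).differentiableAt
    have h1 := h.hasStrictDerivAt
    rwa [(hQd x (by simpa using hr0)).deriv] at h1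
  have hne : ∀ x : ℝ, Q₁ x ≠ 0 := fun x => by rw [hQ₁]; exact hq0 x
  obtain ⟨Y₀, hY₀, hstrip⟩ := exists_strip_notMem_range hqc hp hinj hQ
    (fun z => fser_add_two_pi _ z) hstrict hne
  set Y := min Y₀ (r / 4) with hYdef
  have hY : 0 < Y := by positivity
  have hYr : Y ≤ r / 4 := min_le_right _ _
  have hside : ∀ c : ℝ, c ^ 2 = 1 → (∀ z : ℂ, 0 < z.im → z.im ≤ Y → Q (c * z) ∈ Ω) ∨
      ∀ z : ℂ, 0 < z.im → z.im ≤ Y → Q (c * z) ∉ closure Ω := by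
    intro c hc
    have hcim : ∀ z : ℂ, |((c : ℂ) * z).im| = |z.im| := fun z => by
      rw [im_real_mul, abs_mul, abs_eq_one_of_sq hc, one_mul]
    have hconv : Convex ℝ {z : ℂ | 0 < z.im ∧ z.im ≤ Y} :=
      (convex_halfSpace_im_gt 0).inter (convex_halfSpace_im_le Y)
    have hcont : ContinuousOn (fun z : ℂ => Q (c * z)) {z : ℂ | 0 < z.im ∧ z.im ≤ Y} := by
      intro z hz
      refine ContinuousAt.continuousWithinAt (ContinuousAt.comp (f := fun z : ℂ => (c : ℂ) * z)
        (hQd _ ?_).continuousAt (by fun_prop))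
      rw [hcim, abs_of_pos hz.1]
      linarith [hz.2]
    have h := subset_or_disjoint_of_frontier hΩo (hconv.isPreconnected.image _ hcont) (by
      rw [← hr, Set.disjoint_left]
      rintro _ ⟨z, hz, rfl⟩ hzr
      have h1 := hstrip (c * z) (by
        rw [hcim, abs_of_pos hz.1]; exact hz.2.trans (min_le_left _ _)) hzr
      have h2 := hcim z
      rw [h1, abs_zero, abs_of_pos hz.1] at h2
      exact hz.1.ne h2)
    rcases h with h | h
    · exact Or.inl fun z h0 h1 => h ⟨z, ⟨h0, h1⟩, rfl⟩
    · exact Or.inr fun z h0 h1 => Set.disjoint_left.1 h ⟨z, ⟨h0, h1⟩, rfl⟩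
  set S : Set ((ℂ → ℂ) × (ℂ → ℂ)) := {p | ∃ c : ℝ, c ^ 2 = 1 ∧
    (∀ z : ℂ, 0 < z.im → z.im ≤ Y → Q (c * z) ∈ Ω) ∧ p = side Q Q₁ c} with hS
  have hloc : ∀ η > 0, ∀ x : ℝ, ∃ ρ > 0, ∀ z ∈ Metric.ball (q x) ρ ∩ closure Ω,
      ∃ w : ℂ, |w.im| < η ∧ Q w = z ∧ (w.im ≠ 0 → ∃ c : ℝ, c ^ 2 = 1 ∧ 0 ≤ c * w.im ∧
        side Q Q₁ c ∈ S) := by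
    intro η hη x
    have hball : Metric.ball (x : ℂ) (min η Y) ∈ 𝓝 (x : ℂ) :=
      Metric.ball_mem_nhds _ (by positivity)
    have h1 := (hstrict x).map_nhds_eq (hne x)
    have h2 : Q '' Metric.ball (x : ℂ) (min η Y) ∈ 𝓝 (Q x) := by
      rw [← h1]; exact image_mem_map hball
    rw [hQ] at h2
    obtain ⟨ρ, hρ, hsub⟩ := Metric.mem_nhds_iff.1 h2
    refine ⟨ρ, hρ, fun z hz => ?_⟩
    obtain ⟨w, hw, hwz⟩ := hsub hz.1
    have him : |w.im| < min η Y := by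
      have h3 := Complex.abs_im_le_norm (w - x)
      rw [Complex.sub_im, Complex.ofReal_im, sub_zero] at h3
      exact h3.trans_lt (by rwa [Metric.mem_ball, dist_eq_norm] at hw)
    refine ⟨w, him.trans_le (min_le_left _ _), hwz, fun hw0 => ?_⟩
    obtain ⟨c, hc, hcw⟩ : ∃ c : ℝ, c ^ 2 = 1 ∧ c * w.im = |w.im| := by
      rcases le_total 0 w.im with h | h
      · exact ⟨1, by norm_num, by rw [abs_of_nonneg h, one_mul]⟩
      · exact ⟨-1, by norm_num, by rw [abs_of_nonpos h, neg_one_mul]⟩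
    refine ⟨c, hc, hcw ▸ abs_nonneg _, c, hc, (hside c hc).resolve_right fun h => ?_, rfl⟩
    refine h (c * w) ?_ ?_ ?_
    · rw [im_real_mul, hcw]; exact abs_pos.2 hw0
    · rw [im_real_mul, hcw]; exact him.le.trans (min_le_right _ _)
    · rw [← mul_assoc, ← Complex.ofReal_mul, ← sq, hc, Complex.ofReal_one, one_mul, hwz]
      exact hz.2
  have hfr : ∀ x : ℝ, q x ∈ frontier Ω := fun x => hr ▸ mem_range_self x
  have hSne : S.Nonempty := by
    obtain ⟨ρ, hρ, h⟩ := hloc 1 one_pos 0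
    obtain ⟨z, hzΩ, hz⟩ := Metric.mem_closure_iff.1 (frontier_subset_closure (hfr 0)) ρ hρ
    obtain ⟨w, _, hwz, hw⟩ := h z ⟨by rwa [Metric.mem_ball, dist_comm], subset_closure hzΩ⟩
    obtain ⟨c, _, _, hcS⟩ := hw fun hw0 => by
      have hwr : w = (w.re : ℂ) := by apply Complex.ext <;> simp [hw0]
      have h1 := hfr w.re
      rw [← hQ, ← hwr, hwz, hΩo.frontier_eq] at h1
      exact h1.2 hzΩ
    exact ⟨_, hcS⟩
  refine ⟨S, Y, ∑' m : ℤ, ‖Complex.I * m * fc q m‖ * Real.exp (Y * |(m : ℝ)|) *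
    Real.exp (Y * |(m : ℝ)|), ?_, ?_, hSne, ?_, ?_⟩
  rotate_left
  · rintro p ⟨c, hc, -, rfl⟩
    refine ⟨c, hc, fun x => ?_⟩
    rw [← hQ, ← hQ₁]
    simp [side]
  · refine (Set.toFinite ({side Q Q₁ 1, side Q Q₁ (-1)} : Set _)).subset ?_
    rintro p ⟨c, hc, -, rfl⟩
    rcases eq_one_or_of_sq hc with rfl | rfl <;> simp
  · intro η hη x hx
    rw [← hr] at hx
    obtain ⟨t, rfl⟩ := hx
    obtain ⟨ρ, hρ, h⟩ := hloc η hη t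
    refine ⟨ρ, hρ, fun z hz => ?_⟩
    obtain ⟨w, hwη, hwz, hw⟩ := h z hz
    have hex : ∃ c : ℝ, c ^ 2 = 1 ∧ 0 ≤ c * w.im ∧ side Q Q₁ c ∈ S := by
      by_cases hw0 : w.im = 0
      · obtain ⟨p, c, hc, hcS⟩ := hSne
        exact ⟨c, hc, by rw [hw0, mul_zero], c, hc, hcS.1, rfl⟩
      · exact hw hw0
    obtain ⟨c, hc, hcw, hcS⟩ := hex
    refine ⟨_, hcS, c * w, by rwa [im_real_mul], ?_, ?_⟩
    · rw [im_real_mul]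
      refine (le_abs_self _).trans ?_
      rw [abs_mul, abs_eq_one_of_sq hc, one_mul]
      exact hwη.le
    · show Q (c * (c * w)) = z
      rw [← mul_assoc, ← Complex.ofReal_mul, ← sq, hc, Complex.ofReal_one, one_mul, hwz]
  · rintro p ⟨c, hc, hcm, rfl⟩
    exact collar_side hr0 hY hYr ha (by simpa using hne 0) hc hcm fun x => by
      rw [← hQdef, hQ]; exact hfr x

/-- A normalized solution of the Helmholtz equation satisfying the Neumann condition. -/
structure Neu (Ω : Set ℂ) (S : Set ((ℂ → ℂ) × (ℂ → ℂ))) (lam : ℝ) (Φ : ℂ → ℂ) : Prop where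
  pos : 0 < lam
  adm : Adm Ω lam Φ
  neumann : ∀ p ∈ S, ∀ x : ℝ, fderiv ℝ Φ (p.1 x) (p.2 x * Complex.I) = 0

section Count

variable {Ω : Set ℂ} {q q' : ℝ → ℂ} {S : Set ((ℂ → ℂ) × (ℂ → ℂ))} {Y H : ℝ}

lemma Ctrl.biUnion {Good : ℝ → (ℂ → ℂ) → Prop} (hG : ∀ lam Φ, Good lam Φ → 0 < lam)
    {ι : Type*} {s : Set ι} (hs : s.Finite) {E : Set ℂ} {A : ι → Set ℂ}
    (h : ∀ i ∈ s, Ctrl Good E (A i)) : Ctrl Good E (⋃ i ∈ s, A i) := by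
  induction s, hs using Set.Finite.induction_on with
  | empty => simpa using Ctrl.empty
  | @insert a s _ _ ih =>
    rw [biUnion_insert]
    exact (h a (mem_insert _ _)).union hG (ih fun i hi => h i (mem_insert_of_mem _ hi))

lemma ctrl_collar (hS : Atlas Ω q q' S Y H) {p : (ℂ → ℂ) × (ℂ → ℂ)} (hp : p ∈ S) :
    Ctrl (Neu Ω S) (frontier Ω) (p.1 '' {w | 0 ≤ w.im ∧ w.im ≤ Y / 8}) := by
  have hC := hS.collar p hp
  have hY := hC.Y_pos
  have hH := hC.H_pos
  have hE := expSum_nonneg (Y / 8)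
  have hK : 0 ≤ 5 * H * Y := by positivity
  refine ⟨1 + 2 * expSum (Y / 8) + 5 * H * Y, 1 / 2, by linarith, by norm_num, by norm_num, ?_⟩
  rintro lam Φ hg δ h0 - hsm _ ⟨w, hw, rfl⟩
  refine (norm_le_near_boundary hC hg.pos hg.adm (hg.neumann p hp) h0
    (fun x => hsm _ (hC.maps_real x)) hw.1 hw.2).trans ?_
  refine mul_le_mul_of_nonneg_right (mul_le_mul (by linarith) (Real.exp_le_exp.2 ?_)
    (Real.exp_pos _).le (by linarith)) (Real.rpow_nonneg h0.le _)
  rw [show 5 * (lam * H) * Y = 5 * H * Y * lam by ring]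
  exact mul_le_mul_of_nonneg_right (by linarith) hg.pos.le

lemma frontier_nonempty (hS : Atlas Ω q q' S Y H) : (frontier Ω).Nonempty := by
  obtain ⟨p, hp⟩ := hS.nonempty
  exact ⟨_, (hS.collar p hp).maps_real 0⟩

/-- The boundary values control an eigenfunction on the whole domain. -/
lemma ctrl_closure (hΩo : IsOpen Ω) (hΩc : IsPreconnected Ω) (hΩb : Bornology.IsBounded Ω)
    (hS : Atlas Ω q q' S Y H) : Ctrl (Neu Ω S) (frontier Ω) (closure Ω) := by
  have hpos : ∀ lam Φ, Neu Ω S lam Φ → 0 < lam := fun _ _ h => h.pos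
  have hN : Ctrl (Neu Ω S) (frontier Ω) (⋃ p ∈ S, p.1 '' {w | 0 ≤ w.im ∧ w.im ≤ Y / 8}) :=
    Ctrl.biUnion hpos hS.finite fun p hp => ctrl_collar hS hp
  have hY : 0 < Y := (hS.collar _ hS.nonempty.some_mem).Y_pos
  have hbd : ∀ x ∈ frontier Ω, ∃ r > 0, Metric.ball x r ∩ closure Ω ⊆
      ⋃ p ∈ S, p.1 '' {w | 0 ≤ w.im ∧ w.im ≤ Y / 8} := by
    intro x hx
    obtain ⟨r, hr, h⟩ := hS.cover (Y / 8) (by positivity) x hx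
    refine ⟨r, hr, fun z hz => ?_⟩
    obtain ⟨p, hp, w, h0, h1, hw⟩ := h z hz
    exact mem_biUnion hp ⟨w, ⟨h0, h1⟩, hw⟩
  have hint := exists_ctrl_ball (Good := Neu Ω S) (E := frontier Ω) hΩo hΩc
    (fun lam Φ h => ⟨h.pos, h.adm⟩) (by
    obtain ⟨x, hx⟩ := frontier_nonempty hS
    obtain ⟨r, hr, h⟩ := hbd x hx
    obtain ⟨z, hzΩ, hz⟩ := Metric.mem_closure_iff.1 (frontier_subset_closure hx) r hr
    obtain ⟨ρ, hρ, hball⟩ := Metric.isOpen_iff.1 (hΩo.inter Metric.isOpen_ball) z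
      ⟨hzΩ, Metric.mem_ball'.2 hz⟩
    exact ⟨z, hzΩ, ρ, hρ, hN.mono fun y hy =>
      h ⟨(hball hy).2, subset_closure (hball hy).1⟩⟩)
  refine hΩb.isCompact_closure.induction_on (p := fun s => Ctrl (Neu Ω S) (frontier Ω) s)
    Ctrl.empty (fun s t hst h => h.mono hst) (fun s t hs ht => hs.union hpos ht) (fun x hx => ?_)
  by_cases hxΩ : x ∈ Ω
  · obtain ⟨r, hr, h⟩ := hint x hxΩ
    exact ⟨_, mem_nhdsWithin_of_mem_nhds (Metric.ball_mem_nhds x hr), h⟩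
  · obtain ⟨r, hr, h⟩ := hbd x (by rw [hΩo.frontier_eq]; exact ⟨hx, hxΩ⟩)
    exact ⟨_, inter_comm _ _ ▸ inter_mem_nhdsWithin _ (Metric.ball_mem_nhds x hr), hN.mono h⟩

/-- The number of boundary zeros grows at most linearly with the frequency. -/
theorem exists_card_zeros_le (hΩo : IsOpen Ω) (hΩc : IsPreconnected Ω)
    (hΩb : Bornology.IsBounded Ω) (hr : range q = frontier Ω)
    (hS : Atlas Ω q q' S Y H) :
    ∃ C₁ C₂ : ℝ, 0 ≤ C₂ ∧ ∀ lam Φ, Neu Ω S lam Φ → (∃ z ∈ closure Ω, ‖Φ z‖ = 1) →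
      ∀ T : Finset ℝ, (∀ a ∈ T, a ∈ Ico 0 (2 * π) ∧ Φ (q a) = 0) →
        (T.card : ℝ) ≤ C₁ * lam + C₂ := by
  obtain ⟨C, θ, hC, hθ, -, hctrl⟩ := ctrl_closure hΩo hΩc hΩb hS
  obtain ⟨p, hpS⟩ := hS.nonempty
  have hcol := hS.collar p hpS
  obtain ⟨c, hc, hreal⟩ := hS.real p hpS
  have hY := hcol.Y_pos
  have hH := hcol.H_pos
  have hE := expSum_nonneg (Y / 4)
  set A := 2 * expSum (Y / 4) + 1 with hA
  set τ := Real.tanh (π / Y * (4 * π)) with hτ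
  have hτ0 : 0 < τ := by
    rw [hτ, Real.tanh_eq_sinh_div_cosh]
    exact div_pos (Real.sinh_pos_iff.2 (by positivity)) (Real.cosh_pos _)
  have hτ1 : τ < 1 := Real.tanh_lt_one _
  set κ := -Real.log τ with hκ
  have hκ0 : 0 < κ := by
    have := Real.log_neg hτ0 hτ1
    linarith
  have hlC : 0 ≤ Real.log (2 * C) := Real.log_nonneg (by linarith)
  have hlA : 0 ≤ Real.log A := Real.log_nonneg (by linarith)
  refine ⟨(3 * H * Y + C / θ) / κ, (Real.log A + Real.log (2 * C) / θ) / κ, by positivity,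
    fun lam Φ hg hmax T hT => ?_⟩
  have hlam := hg.pos
  set δ := Real.exp (-(Real.log (2 * C) + C * lam) / θ) with hδ
  have hδ1 : δ ≤ 1 := Real.exp_le_one_iff.2
    (div_nonpos_of_nonpos_of_nonneg (by nlinarith) hθ.le)
  obtain ⟨z, hz, hzδ⟩ : ∃ z ∈ frontier Ω, δ < ‖Φ z‖ := by
    by_contra h
    push Not at h
    obtain ⟨z, hz, hz1⟩ := hmax
    have h1 := hctrl lam Φ hg δ (Real.exp_pos _) hδ1 h z hz
    rw [hz1, hδ, ← Real.exp_mul, div_mul_cancel₀ _ hθ.ne', mul_assoc, ← Real.exp_add,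
      show C * lam + -(Real.log (2 * C) + C * lam) = -Real.log (2 * C) by ring, Real.exp_neg,
      Real.exp_log (by linarith)] at h1
    have h2 : C * (2 * C)⁻¹ = 1 / 2 := by field_simp
    rw [h2] at h1
    norm_num at h1
  rw [← hr] at hz
  obtain ⟨t, rfl⟩ := hz
  have hc1 := abs_eq_one_of_sq hc
  have hcc : ∀ s, c * (c * s) = s := fun s => by rw [← mul_assoc, ← sq, hc, one_mul]
  have hper : Function.Periodic (fun x : ℝ => p.1 x) (2 * π) := fun x => by
    show p.1 _ = p.1 _
    rw [← hcol.periodic x]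
    push_cast; ring
  obtain ⟨x, hx, hxt⟩ := hper.exists_mem_Ico₀ (by positivity) (c * t)
  have hpx : p.1 x = q t := by
    rw [← hxt, (hreal (c * t)).1, hcc]
  have hcard : (T.image fun a => c * a).card = T.card :=
    Finset.card_image_of_injective _ fun a b hab => by
      simpa only [hcc] using congrArg (c * ·) hab
  have h1 := le_pow_card_of_zeros hcol hlam hg.adm (hg.neumann p hpS) (T.image fun a => c * a)
    (fun a ha => by
      obtain ⟨b, hb, rfl⟩ := Finset.mem_image.1 ha
      rw [(hreal (c * b)).1, hcc]
      exact (hT b hb).2) (x := x) (L := 4 * π) (fun a ha => by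
      obtain ⟨b, hb, rfl⟩ := Finset.mem_image.1 ha
      have hb' := (hT b hb).1
      calc |x - c * b| ≤ |x| + |c * b| := abs_sub _ _
        _ = x + b := by rw [abs_mul, hc1, one_mul, abs_of_nonneg hx.1, abs_of_nonneg hb'.1]
        _ ≤ _ := by linarith [hx.2, hb'.2])
  rw [hpx, hcard] at h1
  have h2 : δ ≤ Real.exp (3 * (lam * H) * Y + Real.log A - κ * T.card) := by
    refine hzδ.le.trans (h1.trans ?_)
    rw [sub_eq_add_neg, Real.exp_add, Real.exp_add, Real.exp_log (by linarith),
      show -(κ * T.card) = Real.log τ * (T.card : ℝ) by rw [hκ]; ring, mul_comm (Real.log τ),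
      Real.exp_nat_mul, Real.exp_log hτ0]
    refine mul_le_mul_of_nonneg_right ?_ (by positivity)
    nlinarith [Real.exp_pos (3 * (lam * H) * Y)]
  rw [hδ, Real.exp_le_exp] at h2
  rw [div_mul_eq_mul_div, ← add_div, le_div_iff₀ hκ0]
  have h3 : -(Real.log (2 * C) + C * lam) / θ = -(Real.log (2 * C) / θ) - C / θ * lam := by
    field_simp; ring
  rw [h3] at h2
  linarith

end Count

lemma second_deriv_nonpos {f f' : ℝ → ℝ} {a f₂ : ℝ} (hf : ∀ᶠ x in 𝓝 a, HasDerivAt f (f' x) x)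
    (hf' : HasDerivAt f' f₂ a) (h0 : f' a = 0) (hmax : ∀ᶠ x in 𝓝[>] a, f x ≤ f a) : f₂ ≤ 0 := by
  by_contra h
  push Not at h
  set g : ℝ → ℝ := fun x => f x - f₂ / 4 * (x - a) ^ 2 with hg
  have hsq : ∀ x, HasDerivAt (fun x => f₂ / 4 * (x - a) ^ 2) (f₂ / 2 * (x - a)) x := fun x =>
    ((((hasDerivAt_id x).sub_const a).pow 2).const_mul (f₂ / 4)).congr_deriv (by simp; ring)
  have hg1 : deriv g =ᶠ[𝓝 a] fun x => f' x - f₂ / 2 * (x - a) := by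
    filter_upwards [hf] with x hx using (hx.sub (hsq x)).deriv
  have hg2 : HasDerivAt (fun x => f' x - f₂ / 2 * (x - a)) (f₂ - f₂ / 2) a :=
    (hf'.sub (((hasDerivAt_id a).sub_const a).const_mul (f₂ / 2))).congr_deriv (by ring)
  have hmin : IsLocalMin g a := by
    refine isLocalMin_of_deriv_deriv_pos ?_ ?_ ?_
    · rw [hg1.deriv_eq, hg2.deriv]; linarith
    · rw [hg1.self_of_nhds]; simp [h0]
    · exact (hf.self_of_nhds.sub (hsq a)).continuousAt
  obtain ⟨x, ⟨h1, h2⟩, h3⟩ := ((hmax.and (hmin.filter_mono nhdsWithin_le_nhds)).and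
    self_mem_nhdsWithin).exists
  have h4 : 0 < x - a := sub_pos.2 h3
  simp only [hg, sub_self] at h2
  have : 0 < f₂ / 4 * (x - a) ^ 2 := by positivity
  nlinarith

lemma eventually_hasDerivAt_line {G : ℂ → ℂ} {z : ℂ} (hG : AnalyticAt ℝ G z) (v : ℂ) :
    ∀ᶠ t : ℝ in 𝓝 0, HasDerivAt (fun t : ℝ => G (z + t * v)) (fderiv ℝ G (z + t * v) v) t := by
  have hc : ContinuousAt (fun t : ℝ => z + (t : ℂ) * v) 0 := by fun_prop
  have h1 : ∀ᶠ t : ℝ in 𝓝 0, AnalyticAt ℝ G (z + t * v) :=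
    hc.eventually (by simpa using hG.eventually_analyticAt)
  filter_upwards [h1] with t ht
  have hl : HasDerivAt (fun t : ℝ => z + (t : ℂ) * v) v t := by
    simpa using ((Complex.ofRealCLM.hasDerivAt (x := t)).mul_const v).const_add z
  exact ht.differentiableAt.hasFDerivAt.comp_hasDerivAt t hl

section SmallFrequency

variable {Ω : Set ℂ} {Q Q₁ : ℂ → ℂ} {Y H lam : ℝ} {Φ : ℂ → ℂ}

lemma Collar.norm_le (hC : Collar Ω Q Q₁ Y H) {z : ℂ} (hz : |z.im| ≤ Y) : ‖Q₁ z‖ ≤ H := by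
  obtain ⟨b, hb, hs⟩ := hC.series
  rw [← (hs z hz).tsum_eq]
  refine tsum_of_norm_bounded hb fun m => ?_
  rw [norm_mul]
  calc _ ≤ ‖b m‖ * Real.exp (Y * |(m : ℝ)|) := by gcongr; exact norm_cexp_le m hz
    _ ≤ _ := le_mul_of_one_le_right (by positivity)
      (Real.one_le_exp (mul_nonneg hC.Y_pos.le (abs_nonneg _)))

lemma second_deriv_line_nonpos {G : ℂ → ℂ} {z v : ℂ} {σ k : ℝ} (hG : AnalyticAt ℝ G z)
    (h0 : σ * (fderiv ℝ G z v).re + 2 * k * z.im * v.im = 0)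
    (hmax : ∀ᶠ t : ℝ in 𝓝[>] 0, σ * (G (z + t * v)).re + k * (z + t * v).im ^ 2 ≤
      σ * (G z).re + k * z.im ^ 2) :
    σ * (fderiv ℝ (fun w => fderiv ℝ G w v) z v).re + 2 * k * v.im ^ 2 ≤ 0 := by
  have him : ∀ t : ℝ, (z + t * v).im = z.im + t * v.im := fun t => by simp
  have hi : ∀ t : ℝ, HasDerivAt (fun t : ℝ => z.im + t * v.im) v.im t := fun t => by
    simpa using ((hasDerivAt_id t).mul_const v.im).const_add z.im
  simp only [him] at hmax
  refine second_deriv_nonpos (a := 0)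
    (f := fun t : ℝ => σ * (G (z + t * v)).re + k * (z.im + t * v.im) ^ 2)
    (f' := fun t : ℝ => σ * (fderiv ℝ G (z + t * v) v).re + 2 * k * (z.im + t * v.im) * v.im)
    ?_ ?_ ?_ ?_
  · filter_upwards [eventually_hasDerivAt_line hG v] with t ht
    have h1 := (Complex.reCLM.hasFDerivAt.comp_hasDerivAt t ht).const_mul σ
    have h2 := ((hi t).pow 2).const_mul k
    exact (h1.add h2).congr_deriv (by simp; ring)
  · have ht := (eventually_hasDerivAt_line (analyticAt_fderiv_apply hG v) v).self_of_nhds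
    have h1 := (Complex.reCLM.hasFDerivAt.comp_hasDerivAt 0 ht).const_mul σ
    have h2 := ((hi 0).const_mul (2 * k)).mul_const v.im
    exact (h1.add h2).congr_deriv (by simp; ring)
  · simpa using h0
  · simpa using hmax

/-- A maximum principle in a collar: a Neumann solution is almost dominated by its values on the
inner side of the collar. -/
lemma Collar.exists_le_add (hC : Collar Ω Q Q₁ Y H) (hlam : 0 < lam) (hΦ : Adm Ω lam Φ)
    (hN : ∀ x : ℝ, fderiv ℝ Φ (Q x) (Q₁ x * Complex.I) = 0) {σ : ℝ} (hσ : σ ^ 2 = 1)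
    {z : ℂ} (hz0 : 0 ≤ z.im) (hz1 : z.im ≤ Y) :
    ∃ x ∈ Icc (0 : ℝ) (2 * π), σ * (Φ (Q z)).re ≤
      σ * (Φ (Q (x + Y * Complex.I))).re + lam ^ 2 * H ^ 2 * Y ^ 2 := by
  have hY := hC.Y_pos
  have hH := hC.H_pos
  set G : ℂ → ℂ := fun w => Φ (Q w) with hG
  set k := lam ^ 2 * H ^ 2 with hk
  have hk0 : 0 < k := by positivity
  set U : ℂ → ℝ := fun w => σ * (G w).re + k * w.im ^ 2 with hU
  have hGa : ∀ w : ℂ, 0 ≤ w.im → w.im ≤ Y → AnalyticAt ℝ G w := fun w h0 h1 =>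
    hC.analyticAt_comp hΦ h0 h1
  have hUc : ContinuousOn U (Icc 0 (2 * π) ×ℂ Icc 0 Y) := fun w hw =>
    ContinuousAt.continuousWithinAt <| by
      have h1 := (hGa w hw.2.1 hw.2.2).continuousAt
      have h2 : ContinuousAt (fun w => (G w).re) w := Complex.continuous_re.continuousAt.comp h1
      exact (h2.const_mul σ).add (by fun_prop)
  have hcpt : IsCompact (Icc 0 (2 * π) ×ℂ Icc 0 Y) := isCompact_Icc.reProdIm isCompact_Icc
  obtain ⟨z₀, hz₀, hmax⟩ := hcpt.exists_isMaxOn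
    ⟨0, by simp [Complex.mem_reProdIm]; constructor <;> positivity⟩ hUc
  have hper : ∀ w : ℂ, U (w + 2 * π) = U w := fun w => by
    simp only [hU, hG]
    rw [hC.periodic w]
    simp
  have hmax' : ∀ w : ℂ, 0 ≤ w.im → w.im ≤ Y → U w ≤ U z₀ := by
    intro w h0 h1
    have hp : Function.Periodic (fun x : ℝ => U (x + w.im * Complex.I)) (2 * π) := fun x => by
      show U _ = U _
      rw [← hper (x + w.im * Complex.I)]
      push_cast; ring_nf
    obtain ⟨x, hx, hxw⟩ := hp.exists_mem_Ico₀ (by positivity) w.re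
    rw [Complex.re_add_im] at hxw
    rw [hxw]
    exact hmax ⟨by simpa using Ico_subset_Icc_self hx, by simpa using ⟨h0, h1⟩⟩
  have hz₀Y : z₀.im = Y := by
    by_contra hne
    have h0 : 0 ≤ z₀.im := hz₀.2.1
    have h1 : z₀.im < Y := lt_of_le_of_ne hz₀.2.2 hne
    have ha := hGa z₀ h0 h1.le
    have hx : σ * (fderiv ℝ (fun w => fderiv ℝ G w 1) z₀ 1).re + 2 * k * (1 : ℂ).im ^ 2 ≤ 0 := by
      have hd := (eventually_hasDerivAt_line ha 1).self_of_nhds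
      have hle : ∀ t : ℝ, U (z₀ + t * 1) ≤ U z₀ := fun t =>
        hmax' _ (by simpa using h0) (by simpa using h1.le)
      refine second_deriv_line_nonpos ha ?_ (Eventually.of_forall hle)
      have hloc : IsLocalMax (fun t : ℝ => σ * (G (z₀ + t * 1)).re) 0 :=
        Eventually.of_forall fun t => by
          have := hle t
          simp only [hU] at this
          simpa using this
      have h3 := hloc.hasDerivAt_eq_zero
        ((Complex.reCLM.hasFDerivAt.comp_hasDerivAt 0 hd).const_mul σ)
      simpa using h3
    have hy : σ * (fderiv ℝ (fun w => fderiv ℝ G w Complex.I) z₀ Complex.I).re +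
        2 * k * Complex.I.im ^ 2 ≤ 0 := by
      have hd := (eventually_hasDerivAt_line ha Complex.I).self_of_nhds
      have hlt : ∀ᶠ t : ℝ in 𝓝 0, t < Y - z₀.im := gt_mem_nhds (by linarith)
      have hle : ∀ t : ℝ, 0 ≤ z₀.im + t → t < Y - z₀.im → U (z₀ + t * Complex.I) ≤ U z₀ :=
        fun t ht0 ht1 => hmax' _ (by simpa using ht0) (by simp; linarith)
      refine second_deriv_line_nonpos ha ?_ ?_
      · rcases h0.eq_or_lt with h0 | h0
        · have hzr : z₀ = (z₀.re : ℂ) := by apply Complex.ext <;> simp [← h0]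
          have h3 : fderiv ℝ G z₀ Complex.I = 0 := by
            have h4 := (hΦ.analytic _ (hC.mem_closure h0.le h1.le)).differentiableAt.hasFDerivAt.comp
              z₀ ((hC.deriv z₀ (hC.abs_im h0.le h1.le)).self_of_nhds.hasFDerivAt.restrictScalars ℝ)
            have h5 : fderiv ℝ G z₀ = _ := h4.fderiv
            rw [h5]
            have h6 := hN z₀.re
            rw [← hzr] at h6
            simpa [mul_comm] using h6
          rw [h3, ← h0]; simp
        · have hloc : IsLocalMax
              (fun t : ℝ => σ * (G (z₀ + t * Complex.I)).re + k * (z₀.im + t) ^ 2) 0 := by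
            filter_upwards [hlt, lt_mem_nhds (show -z₀.im < 0 by linarith)] with t ht1 ht2
            have := hle t (by linarith) ht1
            simp only [hU] at this
            simpa using this
          have h2 : HasDerivAt (fun t : ℝ => k * (z₀.im + t) ^ 2) (2 * k * z₀.im) 0 :=
            ((((hasDerivAt_id (0 : ℝ)).const_add z₀.im).pow 2).const_mul k).congr_deriv
              (by simp; ring)
          have h3 := hloc.hasDerivAt_eq_zero
            (((Complex.reCLM.hasFDerivAt.comp_hasDerivAt 0 hd).const_mul σ).add h2)
          simpa using h3
      · filter_upwards [hlt.filter_mono nhdsWithin_le_nhds, self_mem_nhdsWithin] with t ht1 ht2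
        exact hle t (add_nonneg h0 (le_of_lt ht2)) ht1
    have hl := congrArg Complex.re (hC.lapl_comp hΦ h0 h1.le)
    rw [lapl, Complex.add_re] at hl
    have hre : (-(lam : ℂ) ^ 2 * ((Complex.normSq (Q₁ z₀) : ℂ) * Φ (Q z₀))).re =
        -(lam ^ 2 * Complex.normSq (Q₁ z₀)) * (Φ (Q z₀)).re := by
      rw [← mul_assoc, ← Complex.ofReal_pow, ← Complex.ofReal_neg, ← Complex.ofReal_mul,
        Complex.re_ofReal_mul]
      ring
    rw [hre] at hl
    have hσΦ : σ * (Φ (Q z₀)).re ≤ 1 := by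
      refine (le_abs_self _).trans ?_
      rw [abs_mul, abs_eq_one_of_sq hσ, one_mul]
      exact (Complex.abs_re_le_norm _).trans (hΦ.bound _ (hC.mem_closure h0 h1.le))
    have hnorm : lam ^ 2 * Complex.normSq (Q₁ z₀) ≤ k := by
      rw [hk, Complex.normSq_eq_norm_sq]
      have := hC.norm_le (hC.abs_im h0 h1.le)
      gcongr
    have hnn : 0 ≤ lam ^ 2 * Complex.normSq (Q₁ z₀) :=
      mul_nonneg (sq_nonneg _) (Complex.normSq_nonneg _)
    have hsum : σ * (-(lam ^ 2 * Complex.normSq (Q₁ z₀)) * (Φ (Q z₀)).re) + 2 * k ≤ 0 := by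
      rw [← hl]
      simp only [Complex.one_im, Complex.I_im] at hx hy
      linarith
    nlinarith
  refine ⟨z₀.re, hz₀.1, ?_⟩
  have h1 := hmax' z hz0 hz1
  have h2 : (z₀.re + Y * Complex.I : ℂ) = z₀ := by rw [← hz₀Y, Complex.re_add_im]
  rw [h2, ← hz₀Y]
  simp only [hU, hG] at h1
  nlinarith [sq_nonneg z.im]

end SmallFrequency

/-- Eigenfunctions of small frequency do not vanish on the boundary. -/
theorem exists_forall_ne_zero {Ω : Set ℂ} {q q' : ℝ → ℂ} {S : Set ((ℂ → ℂ) × (ℂ → ℂ))} {Y H : ℝ}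
    (hΩo : IsOpen Ω) (hΩc : IsConnected Ω) (hΩb : Bornology.IsBounded Ω)
    (hS : Atlas Ω q q' S Y H) :
    ∃ lam₀ > 0, ∀ lam Φ, Neu Ω S lam Φ → (∀ z ∈ closure Ω, (Φ z).im = 0) →
      (∃ z ∈ closure Ω, Φ z = 1) → lam ≤ lam₀ → ∀ t, Φ (q t) ≠ 0 := by
  obtain ⟨p₀, hp₀⟩ := hS.nonempty
  have hY := (hS.collar p₀ hp₀).Y_pos
  choose! r hr hcov using hS.cover Y hY
  set W : Set ℂ := ⋃ x ∈ frontier Ω, Metric.ball x (r x) with hW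
  have hWo : IsOpen W := isOpen_biUnion fun x _ => Metric.isOpen_ball
  have hfW : frontier Ω ⊆ W := fun x hx => mem_biUnion hx (Metric.mem_ball_self (hr x hx))
  set L : (ℂ → ℂ) × (ℂ → ℂ) → Set ℂ := fun p =>
    (fun x : ℝ => p.1 (x + Y * Complex.I)) '' Icc 0 (2 * π) with hL
  set K : Set ℂ := (closure Ω \ W) ∪ ⋃ p ∈ S, L p with hK
  have hLΩ : ∀ p ∈ S, L p ⊆ Ω := by
    rintro p hp _ ⟨x, -, rfl⟩
    exact (hS.collar p hp).maps _ (by rw [im_line]; exact hY) (by rw [im_line])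
  have hLc : ∀ p ∈ S, IsCompact (L p) := fun p hp => by
    refine isCompact_Icc.image (continuous_iff_continuousAt.2 fun x => ?_)
    exact ContinuousAt.comp (f := fun x : ℝ => (x + Y * Complex.I : ℂ))
      ((hS.collar p hp).analyticAt (by rw [im_line, abs_of_pos hY])).continuousAt (by fun_prop)
  have hKc : IsCompact K :=
    (hΩb.isCompact_closure.diff hWo).union (hS.finite.isCompact_biUnion hLc)
  have hKΩ : K ⊆ Ω := by
    rintro z (⟨hz, hzW⟩ | hz)
    · by_contra h
      exact hzW (hfW (by rw [hΩo.frontier_eq]; exact ⟨hz, h⟩))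
    · obtain ⟨p, hp, hz⟩ := mem_iUnion₂.1 hz
      exact hLΩ p hp hz
  obtain ⟨C, hC, hrel⟩ := hRel_of_isCompact (Good := fun lam Φ =>
      Neu Ω S lam Φ ∧ lam ≤ 1 ∧ ∀ z ∈ closure Ω, (Φ z).im = 0) hΩo hΩc
    (fun lam Φ h => ⟨h.1.pos, h.2.1, h.1.adm, h.2.2⟩) hKc hKΩ
  set D := C * (H ^ 2 * Y ^ 2 + 1) + H ^ 2 * Y ^ 2 with hD
  have hD0 : 0 ≤ D := by positivity
  refine ⟨1 / (D + 1), by positivity, fun lam Φ hg him ⟨z, hz, hz1⟩ hlam t ht => ?_⟩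
  have hpos := hg.pos
  have hlam1 : lam ≤ 1 := hlam.trans (by rw [div_le_one (by positivity)]; linarith)
  have hclK : ∀ k ∈ K, k ∈ K ∩ closure Ω := fun k hk => ⟨hk, subset_closure (hKΩ hk)⟩
  obtain ⟨k, hk, hkΦ⟩ : ∃ k ∈ K, 1 - (Φ k).re ≤ lam ^ 2 * H ^ 2 * Y ^ 2 := by
    by_cases hzW : z ∈ W
    · obtain ⟨x, hx, hzx⟩ := mem_iUnion₂.1 hzW
      obtain ⟨p, hp, w, h0, h1, rfl⟩ := hcov x hx z ⟨hzx, hz⟩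
      obtain ⟨y, hy, hle⟩ := (hS.collar p hp).exists_le_add hpos hg.adm (hg.neumann p hp)
        (one_pow 2) h0 h1
      refine ⟨_, Or.inr (mem_biUnion hp ⟨y, hy, rfl⟩), ?_⟩
      rw [hz1] at hle
      simp only [Complex.one_re] at hle
      linarith
    · exact ⟨z, Or.inl ⟨hz, hzW⟩, by rw [hz1, Complex.one_re, sub_self]; positivity⟩
  obtain ⟨c, hc, hreal⟩ := hS.real p₀ hp₀
  have hqt : p₀.1 ((c * t : ℝ) : ℂ) = q t := by
    rw [(hreal (c * t)).1, ← mul_assoc, ← sq, hc, one_mul]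
  obtain ⟨y, hy, hle⟩ := (hS.collar p₀ hp₀).exists_le_add hpos hg.adm (hg.neumann p₀ hp₀)
    (σ := -1) (by norm_num) (z := ((c * t : ℝ) : ℂ)) (by simp) (by simpa using hY.le)
  rw [hqt, ht, Complex.zero_re] at hle
  have h1 := hrel lam Φ ⟨hg, hlam1, him⟩ k (hclK k hk) (p₀.1 (y + Y * Complex.I))
    (hclK _ (Or.inr (mem_biUnion hp₀ ⟨y, hy, rfl⟩)))
  have h2 : C * (1 - (Φ k).re + lam ^ 2) ≤ C * (lam ^ 2 * H ^ 2 * Y ^ 2 + lam ^ 2) := by gcongr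
  have h3 : 1 ≤ D * lam ^ 2 := by
    rw [hD]; linarith
  rw [le_div_iff₀ (by positivity)] at hlam
  nlinarith

/-- The identification of `ℂ` with the Euclidean plane. -/
def planeIso : ℂ ≃ₗᵢ[ℝ] E2 := Complex.orthonormalBasisOneI.repr

lemma planeIso_one : planeIso 1 = EuclideanSpace.single 0 1 := by
  have h := Complex.orthonormalBasisOneI.repr_self 0
  rwa [Complex.coe_orthonormalBasisOneI] at h

lemma planeIso_I : planeIso Complex.I = EuclideanSpace.single 1 1 := by
  have h := Complex.orthonormalBasisOneI.repr_self 1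
  rwa [Complex.coe_orthonormalBasisOneI] at h

/-- The complex-valued function on `ℂ` corresponding to a multiple of a function on the plane. -/
def pull (κ : ℝ) (φ : E2 → ℝ) (z : ℂ) : ℂ := ((κ * φ (planeIso z) : ℝ) : ℂ)

lemma analyticAt_pull {κ : ℝ} {φ : E2 → ℝ} {z : ℂ} (hφ : AnalyticAt ℝ φ (planeIso z)) :
    AnalyticAt ℝ (pull κ φ) z :=
  (Complex.ofRealCLM.analyticAt _).comp (analyticAt_const.mul
    (hφ.comp (planeIso.toContinuousLinearEquiv.toContinuousLinearMap.analyticAt z)))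

lemma fderiv_pull {κ : ℝ} {φ : E2 → ℝ} {z : ℂ} (hφ : DifferentiableAt ℝ φ (planeIso z)) (v : ℂ) :
    fderiv ℝ (pull κ φ) z v = pull κ (fun y => fderiv ℝ φ y (planeIso v)) z := by
  have h1 : HasFDerivAt (fun w => φ (planeIso w)) _ z := hφ.hasFDerivAt.comp z
    planeIso.toContinuousLinearEquiv.toContinuousLinearMap.hasFDerivAt
  have h2 : HasFDerivAt (pull κ φ) _ z := Complex.ofRealCLM.hasFDerivAt.comp z (h1.const_mul κ)
  rw [h2.fderiv]
  simp [pull]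

lemma lapl_pull {κ : ℝ} {φ : E2 → ℝ} {z : ℂ} (hφ : AnalyticAt ℝ φ (planeIso z)) :
    lapl (pull κ φ) z = pull κ (lap φ) z := by
  have h : ∀ v : ℂ, fderiv ℝ (fun w => fderiv ℝ (pull κ φ) w v) z v = pull κ (fun x =>
      fderiv ℝ (fun y => fderiv ℝ φ y (planeIso v)) x (planeIso v)) z := by
    intro v
    have h1 : (fun w => fderiv ℝ (pull κ φ) w v) =ᶠ[𝓝 z]
        pull κ fun y => fderiv ℝ φ y (planeIso v) := by
      filter_upwards [planeIso.continuous.continuousAt.eventually hφ.eventually_analyticAt]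
        with w hw using fderiv_pull hw.differentiableAt v
    rw [h1.fderiv_eq, fderiv_pull]
    exact (((ContinuousLinearMap.apply ℝ ℝ (planeIso v)).analyticAt _).comp
      hφ.fderiv).differentiableAt
  rw [lapl, h, h, planeIso_one, planeIso_I]
  simp only [pull, lap, Fin.sum_univ_two, mul_add, Complex.ofReal_add]

section Transfer

variable {Ω : Set E2}

lemma closure_preimage : closure (planeIso ⁻¹' Ω) = planeIso ⁻¹' closure Ω :=
  (planeIso.toHomeomorph.preimage_closure Ω).symm

lemma frontier_preimage : frontier (planeIso ⁻¹' Ω) = planeIso ⁻¹' frontier Ω :=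
  (planeIso.toHomeomorph.preimage_frontier Ω).symm

lemma eq_add_of_q_eq (B : BoundaryParam Ω) {s t : ℝ} (h : B.q s = B.q t) :
    ∃ n : ℤ, s = t + n * B.len := by
  have hq : ∀ x, B.q (toIcoMod B.len_pos 0 x) = B.q x := fun x => by
    rw [toIcoMod]; exact B.periodic.sub_zsmul_eq _
  have hm : ∀ x, toIcoMod B.len_pos 0 x ∈ Ico 0 B.len := fun x => by
    simpa using toIcoMod_mem_Ico B.len_pos 0 x
  have h1 := B.injOn (hm s) (hm t) (by rw [hq, hq, h])
  refine ⟨toIcoDiv B.len_pos 0 s - toIcoDiv B.len_pos 0 t, ?_⟩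
  rw [toIcoMod, toIcoMod, zsmul_eq_mul, zsmul_eq_mul] at h1
  push_cast
  linarith

/-- The boundary curve in `ℂ`, parametrized with period `2π`. -/
def curve (B : BoundaryParam Ω) (t : ℝ) : ℂ := planeIso.symm (B.q (B.len / (2 * π) * t))

/-- The velocity of `curve`. -/
def curveDeriv (B : BoundaryParam Ω) (t : ℝ) : ℂ :=
  (B.len / (2 * π)) • planeIso.symm (B.qd (B.len / (2 * π) * t))

lemma range_curve (B : BoundaryParam Ω) : range (curve B) = frontier (planeIso ⁻¹' Ω) := by
  have hl := B.len_pos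
  have hc : 0 < B.len / (2 * π) := by positivity
  rw [frontier_preimage, ← B.range_eq]
  ext z
  constructor
  · rintro ⟨t, rfl⟩
    exact ⟨B.len / (2 * π) * t, by simp [curve]⟩
  · rintro ⟨s, hs⟩
    refine ⟨s / (B.len / (2 * π)), ?_⟩
    rw [curve, mul_div_cancel₀ _ hc.ne', hs, planeIso.symm_apply_apply]

lemma curve_atlas (hΩ : IsPlaneDomain Ω) (B : BoundaryParam Ω) (hB : B.IsAnalytic) :
    ∃ S Y H, Atlas (planeIso ⁻¹' Ω) (curve B) (curveDeriv B) S Y H := by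
  have hl := B.len_pos
  have hc : 0 < B.len / (2 * π) := by positivity
  refine exists_atlas (hΩ.isOpen.preimage planeIso.continuous) (fun x => ?_) (fun x => ?_)
    (fun x => ?_) (fun x => ?_) (fun s t h => ?_) ?_
  · have h1 : AnalyticAt ℝ (fun t : ℝ => B.len / (2 * π) * t) x := analyticAt_const.mul analyticAt_id
    exact (planeIso.symm.toContinuousLinearEquiv.toContinuousLinearMap.analyticAt _).comp
      ((hB _ (mem_univ _)).comp h1)
  · have h1 : HasDerivAt (fun t : ℝ => B.len / (2 * π) * t) (B.len / (2 * π)) x := by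
      simpa using (hasDerivAt_id x).const_mul (B.len / (2 * π))
    have h2 := (B.hasDerivAt (B.len / (2 * π) * x)).scomp x h1
    have h3 := planeIso.symm.toContinuousLinearEquiv.toContinuousLinearMap.hasFDerivAt.comp_hasDerivAt
      x h2
    exact h3.congr_deriv (by simp [curveDeriv])
  · rw [curveDeriv]
    refine smul_ne_zero hc.ne' ?_
    rw [← norm_pos_iff, planeIso.symm.norm_map, B.unitSpeed]
    exact one_pos
  · simp only [curve]
    rw [mul_add, div_mul_cancel₀ _ (by positivity), B.periodic]
  · obtain ⟨n, hn⟩ := eq_add_of_q_eq B (planeIso.symm.injective h)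
    refine ⟨n, mul_left_cancel₀ hc.ne' ?_⟩
    rw [hn]; field_simp
  · exact range_curve B

lemma exists_normal_eq (B : BoundaryParam Ω) (s : ℝ) :
    ∃ r : ℝ, planeIso (planeIso.symm (B.qd s) * Complex.I) = r • B.ν s := by
  set a := planeIso.symm (B.qd s) with ha
  set n := planeIso.symm (B.ν s) with hn
  have h1 : ((starRingEnd ℂ) n * a).re = 0 := by
    rw [mul_comm, ← Complex.inner, ha, hn, planeIso.symm.inner_map_map]
    exact B.ν_orth s
  have h2 : n * (starRingEnd ℂ) n = 1 := by
    rw [Complex.mul_conj, Complex.normSq_eq_norm_sq, hn, planeIso.symm.norm_map, B.ν_unit]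
    simp
  set r := ((starRingEnd ℂ) n * a).im with hr
  have h3 : (starRingEnd ℂ) n * a = r * Complex.I := by
    apply Complex.ext <;> simp [h1, hr]
  refine ⟨-r, ?_⟩
  have h4 : a * Complex.I = (-r) • n := by
    rw [Complex.real_smul]
    calc a * Complex.I = (n * (starRingEnd ℂ) n) * a * Complex.I := by rw [h2, one_mul]
      _ = n * ((starRingEnd ℂ) n * a) * Complex.I := by ring
      _ = n * r * (Complex.I * Complex.I) := by rw [h3]; ring
      _ = _ := by rw [Complex.I_mul_I]; push_cast; ring
  rw [h4, map_smul, hn, planeIso.apply_symm_apply]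

variable {B : BoundaryParam Ω} {lam : ℝ} {φ : E2 → ℝ}

lemma analyticAt_of_isNeumannEigenfunction (hφ : IsNeumannEigenfunction B lam φ) {x : E2}
    (hx : x ∈ closure Ω) : AnalyticAt ℝ φ x := by
  obtain ⟨U, -, hU, h⟩ := hφ.analytic
  exact h x (hU hx)

/-- A suitable multiple of an eigenfunction is a normalized Neumann solution on `ℂ`. -/
lemma exists_neu (hΩ : IsPlaneDomain Ω) {S : Set ((ℂ → ℂ) × (ℂ → ℂ))} {Y H : ℝ}
    (hS : Atlas (planeIso ⁻¹' Ω) (curve B) (curveDeriv B) S Y H) (hlam : 0 < lam)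
    (hφ : IsNeumannEigenfunction B lam φ) :
    ∃ κ : ℝ, Neu (planeIso ⁻¹' Ω) S lam (pull κ φ) ∧
      ∃ z ∈ closure (planeIso ⁻¹' Ω), pull κ φ z = 1 := by
  have hcpt : IsCompact (closure Ω) := hΩ.isBounded.isCompact_closure
  obtain ⟨x₁, hx₁, hx₁0⟩ := hφ.nontrivial
  obtain ⟨x₀, hx₀, hmax⟩ := hcpt.exists_isMaxOn ⟨x₁, subset_closure hx₁⟩
    (f := fun x => |φ x|) fun x hx =>
      (continuous_abs.continuousAt.comp
        (analyticAt_of_isNeumannEigenfunction hφ hx).continuousAt).continuousWithinAt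
  have hx₀0 : φ x₀ ≠ 0 := by
    have h := hmax (subset_closure hx₁)
    have h1 := abs_pos.2 hx₁0
    exact abs_pos.1 (h1.trans_le h)
  have han : ∀ z ∈ closure (planeIso ⁻¹' Ω), AnalyticAt ℝ φ (planeIso z) := fun z hz =>
    analyticAt_of_isNeumannEigenfunction hφ (by rwa [closure_preimage] at hz)
  refine ⟨(φ x₀)⁻¹, ⟨hlam, ⟨fun z hz => analyticAt_pull (han z hz), fun z hz => ?_,
    fun z hz => ?_⟩, fun p hp x => ?_⟩, planeIso.symm x₀, ?_, ?_⟩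
  · have ha := analyticAt_pull (κ := (φ x₀)⁻¹) (han z hz)
    refine tendsto_nhds_unique_of_frequently_eq (analyticAt_lapl ha).continuousAt.tendsto
      (ha.continuousAt.const_mul (-(lam : ℂ) ^ 2)).tendsto
      ((mem_closure_iff_frequently.1 hz).mono fun w hw => ?_)
    rw [lapl_pull (han w (subset_closure hw)), pull, pull, hφ.eigen _ hw]
    push_cast; ring
  · rw [closure_preimage] at hz
    have h : |φ (planeIso z)| ≤ |φ x₀| := hmax hz
    rw [pull, Complex.norm_real, Real.norm_eq_abs, abs_mul, abs_inv, inv_mul_le_one₀ (by positivity)]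
    exact h
  · obtain ⟨c, -, hreal⟩ := hS.real p hp
    obtain ⟨h1, h2⟩ := hreal x
    set s := B.len / (2 * π) * (c * x) with hs
    have hq : planeIso (p.1 x) = B.q s := by
      rw [h1, curve, planeIso.apply_symm_apply]
    have hmem : planeIso (p.1 x) ∈ closure Ω := by
      rw [hq]
      exact frontier_subset_closure (B.range_eq ▸ mem_range_self s)
    obtain ⟨r, hr⟩ := exists_normal_eq B s
    have hv : planeIso (p.2 x * Complex.I) = (c * (B.len / (2 * π)) * r) • B.ν s := by
      have h3 : p.2 x * Complex.I =
          (c * (B.len / (2 * π))) • (planeIso.symm (B.qd s) * Complex.I) := by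
        rw [h2, curveDeriv, ← hs, Complex.real_smul, Complex.real_smul]
        push_cast; ring
      rw [h3, map_smul, hr, smul_smul]
    have hn : fderiv ℝ φ (B.q s) (B.ν s) = 0 := by
      rw [← hφ.neumann s, gradient, InnerProductSpace.toDual_symm_apply]
    rw [fderiv_pull (analyticAt_of_isNeumannEigenfunction hφ hmem).differentiableAt, pull, hv, hq,
      map_smul, hn]
    simp
  · rw [closure_preimage]; simpa using hx₀
  · simp [pull, hx₀0]

theorem exists_bound (hΩ : IsPlaneDomain Ω) (B : BoundaryParam Ω) (hB : B.IsAnalytic) :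
    ∃ C > 0, ∀ lam : ℝ, 0 < lam → ∀ φ : E2 → ℝ, IsNeumannEigenfunction B lam φ →
      ({s ∈ Ico (0 : ℝ) B.len | φ (B.q s) = 0}).Finite ∧
      (({s ∈ Ico (0 : ℝ) B.len | φ (B.q s) = 0}).ncard : ℝ) ≤ C * lam := by
  obtain ⟨S, Y, H, hS⟩ := curve_atlas hΩ B hB
  have hl := B.len_pos
  have hpi := Real.pi_pos
  have hΩo := hΩ.isOpen.preimage planeIso.continuous
  have hΩc : IsConnected (planeIso ⁻¹' Ω) :=
    planeIso.toHomeomorph.isConnected_preimage.2 hΩ.isConnected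
  have hΩb : Bornology.IsBounded (planeIso ⁻¹' Ω) :=
    planeIso.antilipschitz.isBounded_preimage hΩ.isBounded
  have hr : range (curve B) = frontier (planeIso ⁻¹' Ω) := range_curve B
  obtain ⟨C₁, C₂, hC₂, hcount⟩ := exists_card_zeros_le hΩo hΩc.isPreconnected hΩb hr hS
  obtain ⟨lam₀, hlam₀, hsmall⟩ := exists_forall_ne_zero hΩo hΩc hΩb hS
  refine ⟨|C₁| + C₂ / lam₀ + 1, by positivity, fun lam hlam φ hφ => ?_⟩
  set Z := {s ∈ Ico (0 : ℝ) B.len | φ (B.q s) = 0} with hZ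
  obtain ⟨κ, hneu, z, hz, hz1⟩ := exists_neu hΩ hS hlam hφ
  have hcurve : ∀ s, curve B (2 * π / B.len * s) = planeIso.symm (B.q s) := fun s => by
    rw [curve]; congr 2; field_simp
  have hzero : ∀ s ∈ Z, pull κ φ (curve B (2 * π / B.len * s)) = 0 := fun s hs => by
    rw [hcurve, pull, planeIso.apply_symm_apply, hs.2]; simp
  have hfin : ∀ T : Finset ℝ, ↑T ⊆ Z → (T.card : ℝ) ≤ (|C₁| + C₂ / lam₀ + 1) * lam := by
    intro T hT
    rcases le_total lam lam₀ with h | h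
    · have hT0 : T = ∅ := Finset.eq_empty_of_forall_notMem fun s hs =>
        hsmall lam _ hneu (fun w _ => by simp [pull]) ⟨z, hz, hz1⟩ h _ (hzero s (hT hs))
      rw [hT0, Finset.card_empty, Nat.cast_zero]
      positivity
    · have hcard : (T.image fun s => 2 * π / B.len * s).card = T.card :=
        Finset.card_image_of_injective _ (mul_right_injective₀ (by positivity))
      have h1 := hcount lam _ hneu ⟨z, hz, by rw [hz1, norm_one]⟩
        (T.image fun s => 2 * π / B.len * s) (fun a ha => by
          obtain ⟨s, hs, rfl⟩ := Finset.mem_image.1 ha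
          have hs' := (hT hs).1
          refine ⟨⟨mul_nonneg (by positivity) hs'.1, ?_⟩, hzero s (hT hs)⟩
          rw [div_mul_eq_mul_div, div_lt_iff₀ hl]
          exact mul_lt_mul_of_pos_left hs'.2 (by positivity))
      rw [hcard] at h1
      have h2 : C₂ ≤ C₂ / lam₀ * lam := by
        rw [div_mul_eq_mul_div, le_div_iff₀ hlam₀]
        gcongr
      nlinarith [mul_le_mul_of_nonneg_right (le_abs_self C₁) hlam.le]
  have hZfin : Z.Finite := by
    by_contra hinf
    obtain ⟨n, hn⟩ := exists_nat_gt ((|C₁| + C₂ / lam₀ + 1) * lam)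
    obtain ⟨T, hT, hTn⟩ := Set.Infinite.exists_subset_card_eq hinf n
    have := hfin T hT
    rw [hTn] at this
    linarith
  refine ⟨hZfin, ?_⟩
  rw [Set.ncard_eq_toFinset_card Z hZfin]
  exact hfin _ (by simp)

end Transfer

end NeumannNodal

/-- The number of boundary nodal points of a Neumann eigenfunction is at most `C·λ`. -/
theorem neumann_boundary_nodal_points
    (Ω : Set E2) (hΩ : IsPlaneDomain Ω) (B : BoundaryParam Ω) (hB : B.IsAnalytic) :
    ∃ C > 0, ∀ lam : ℝ, 0 < lam → ∀ φ : E2 → ℝ, IsNeumannEigenfunction B lam φ →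
      ({s ∈ Set.Ico (0 : ℝ) B.len | φ (B.q s) = 0}).Finite ∧
      (({s ∈ Set.Ico (0 : ℝ) B.len | φ (B.q s) = 0}).ncard : ℝ) ≤ C * lam := by
  exact NeumannNodal.exists_bound hΩ B hB
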